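/- For p = 0 or p a prime, the punctured theory ACFO_p^× of circularly ordered multiplicative groups of models of ACFO_p, in the language L_m ∪ {⊲} ∪ Σ with addition encoded by the relations Σ_n, is NATP. -/

import Mathlib

open FirstOrder FirstOrder.Language

universe u

namespace NATPPaper

/-! ### ATP / NATP -/

section ATP

variable {L : FirstOrder.Language.{0, 0}}

def TreeComparable (η ν : List Bool) : Prop := η <+: ν ∨ ν <+: η

def IsTreeAntichain (X : Set (List Bool)) : Prop :=
  ∀ η ∈ X, ∀ ν ∈ X, η ≠ ν → ¬ TreeComparable η ν

def ATPWitness {M : Type w} [L.Structure M] {n m : ℕ}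
    (φ : L.Formula (Fin n ⊕ Fin m)) (a : List Bool → Fin m → M) : Prop :=
  (∀ X : Finset (List Bool), IsTreeAntichain ↑X →
      ∃ b : Fin n → M, ∀ η ∈ X, φ.Realize (Sum.elim b (a η))) ∧
  (∀ η ν : List Bool, η ≠ ν → TreeComparable η ν →
      ¬ ∃ b : Fin n → M, φ.Realize (Sum.elim b (a η)) ∧ φ.Realize (Sum.elim b (a ν)))

def _root_.FirstOrder.Language.Theory.HasATP (T : L.Theory) : Prop :=
  ∃ (M : Theory.ModelType.{0, 0, 0} T) (n m : ℕ)
    (φ : L.Formula (Fin n ⊕ Fin m)) (a : List Bool → Fin m → M), ATPWitness φ a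

def _root_.FirstOrder.Language.Theory.IsNATP (T : L.Theory) : Prop := ¬ T.HasATP

end ATP

/-! ### The language `L_t` and the class of models of `ACFO⁻` -/

/-- Function symbols of `L_t = {0, 1, +, −, ·, ⁻¹}`. -/
def ltFuncs : ℕ → Type
  | 0 => Bool
  | 1 => Bool
  | 2 => Bool
  | _ + 3 => PEmpty

/-- The language `L_t = {0, 1, +, −, ·, ⁻¹, ⊲}` with `⊲` a ternary relation. -/
def Lt : FirstOrder.Language := ⟨ltFuncs, fun n => PLift (n = 3)⟩

def zeroSym : Lt.Functions 0 := false
def oneSym : Lt.Functions 0 := true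
def negSym : Lt.Functions 1 := false
def invSym : Lt.Functions 1 := true
def addSym : Lt.Functions 2 := false
def mulSym : Lt.Functions 2 := true
def circSym : Lt.Relations 3 := ⟨rfl⟩

section ACFOminus

variable (F : Type u) [Lt.Structure F]

/-- The circular order relation `⊲`. -/
def circRel (a b c : F) : Prop := Structure.RelMap circSym ![a, b, c]

variable [Field F]

/-- The interpretations of the symbols of `L_t` agree with the field operations
(with the convention `0⁻¹ = 0`). -/
def LtCompat : Prop :=
  Structure.funMap zeroSym (![] : Fin 0 → F) = 0 ∧
  Structure.funMap oneSym (![] : Fin 0 → F) = 1 ∧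
  (∀ x : F, Structure.funMap negSym ![x] = -x) ∧
  (∀ x : F, Structure.funMap invSym ![x] = x⁻¹) ∧
  (∀ x y : F, Structure.funMap addSym ![x, y] = x + y) ∧
  (∀ x y : F, Structure.funMap mulSym ![x, y] = x * y)

/-- `F` is a model of `ACFO⁻`: an algebraically closed field together with a circular order on
`F^×` invariant under multiplication. -/
def IsACFOminusWith : Prop :=
  LtCompat F ∧ IsAlgClosed F ∧
  (∀ a b c : F, circRel F a b c → a ≠ 0 ∧ b ≠ 0 ∧ c ≠ 0) ∧
  (∀ a b c : F, circRel F a b c → circRel F b c a) ∧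
  (∀ a b c : F, circRel F a b c → ¬ circRel F c b a) ∧
  (∀ a b c d : F, circRel F a b c → circRel F a c d → circRel F a b d) ∧
  (∀ a b c : F, a ≠ 0 → b ≠ 0 → c ≠ 0 → a ≠ b → b ≠ c → a ≠ c →
    (circRel F a b c ∨ circRel F c b a)) ∧
  (∀ a b c d : F, d ≠ 0 → circRel F a b c → circRel F (d * a) (d * b) (d * c))

end ACFOminus

/-- `F` (an `L_t`-structure) belongs to the class of models of `ACFO⁻`. -/
def IsACFOminus (F : Type u) (SF : Lt.Structure F) : Prop :=
  ∃ fi : Field F, @IsACFOminusWith F SF fi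

/-- A theory is model complete. -/
def IsModelComplete (T : Lt.Theory) : Prop :=
  ∀ (M N : Type u) [Lt.Structure M] [Lt.Structure N],
    M ⊨ T → N ⊨ T → ∀ (f : M ↪[Lt] N) (n : ℕ) (φ : Lt.Formula (Fin n)) (w : Fin n → M),
      φ.Realize (⇑f ∘ w) ↔ φ.Realize w

/-- `Tc` is the model companion of the class `Cl` of `L_t`-structures: `Tc` is model complete
and each model of `Tc` embeds into a member of `Cl` and vice versa. -/
def IsModelCompanionOfClass (Tc : Lt.Theory)
    (Cl : ∀ F : Type u, Lt.Structure F → Prop) : Prop :=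
  IsModelComplete.{u} Tc ∧
  (∀ (M : Type u) (SM : Lt.Structure M), Cl M SM →
      ∃ (N : Type u) (SN : Lt.Structure N),
        @Theory.Model Lt N SN Tc ∧ Nonempty (@Language.Embedding Lt M N SM SN)) ∧
  (∀ (N : Type u) (SN : Lt.Structure N), @Theory.Model Lt N SN Tc →
      ∃ (M : Type u) (SM : Lt.Structure M),
        Cl M SM ∧ Nonempty (@Language.Embedding Lt N M SN SM))

/-! ### The punctured structure -/

/-- The language `L_m ∪ {⊲} ∪ Σ` of punctured models: group operations `1, ·, ⁻¹`, the circular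
order `⊲`, and an `n`-ary relation `Σ_n` for each `n ≥ 2` encoding addition. -/
def pmLang : FirstOrder.Language :=
  ⟨fun n => match n with
    | 0 => PUnit
    | 1 => PUnit
    | 2 => PUnit
    | _ + 3 => PEmpty,
   fun n => PLift (n = 3) ⊕ PLift (2 ≤ n)⟩

/-- The multiplicative group `F^×` of a field `F`. -/
def Punct (F : Type u) [Field F] : Type u := {x : F // x ≠ 0}

/-- The punctured structure: `F^×` with the group operations, the circular order, and the
relations `Σ_n(a_1, …, a_n) ↔ a_1 + ⋯ + a_{n-1} = a_n`. -/
def punctStructure (F : Type u) [Field F] [Lt.Structure F] : pmLang.Structure (Punct F) where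
  funMap {n} f w :=
    match n, f, w with
    | 0, _, _ => ⟨1, one_ne_zero⟩
    | 1, _, w => ⟨(w 0).1⁻¹, inv_ne_zero (w 0).2⟩
    | 2, _, w => ⟨(w 0).1 * (w 1).1, mul_ne_zero (w 0).2 (w 1).2⟩
    | _ + 3, f, _ => (show PEmpty from f).elim
  RelMap {n} r w :=
    match r with
    | Sum.inl h => circRel F (w ⟨0, by have := h.down; omega⟩).1
        (w ⟨1, by have := h.down; omega⟩).1 (w ⟨2, by have := h.down; omega⟩).1
    | Sum.inr h =>
        (∑ i : Fin (n - 1), (w (Fin.castLE (by omega) i)).1) =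
          (w ⟨n - 1, by have := h.down; omega⟩).1

section Auxiliary

open Filter Topology TensorProduct

section Rotation

/-- A circular order on a commutative group, invariant under translations. -/
structure IsCircGroup {G : Type*} [CommGroup G] (R : G → G → G → Prop) : Prop where
  cyc : ∀ a b c, R a b c → R b c a
  asymm : ∀ a b c, R a b c → ¬ R c b a
  trans : ∀ a b c d, R a b c → R a c d → R a b d
  total : ∀ a b c, a ≠ b → b ≠ c → a ≠ c → R a b c ∨ R c b a
  mul : ∀ a b c d, R a b c → R (d * a) (d * b) (d * c)

/-- A rotation function on a commutative group. -/
structure IsRotation {G : Type*} [CommGroup G] (r : G → ℝ) : Prop where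
  nonneg : ∀ x, 0 ≤ r x
  le_one : ∀ x, r x ≤ 1
  one : r 1 = 0
  inv : ∀ x, x ≠ 1 → r x + r x⁻¹ = 1
  mul : ∀ x y, r x + r y = r (x * y) ∨ r x + r y = r (x * y) + 1

/-- The ternary relation attached to a rotation function. -/
def rotRel {G : Type*} [CommGroup G] (r : G → ℝ) (a b c : G) : Prop :=
  a ≠ b ∧ b ≠ c ∧ a ≠ c ∧ r (b / a) + r (c / b) + r (a / c) = 1

theorem IsRotation.isCircGroup {G : Type*} [CommGroup G] {r : G → ℝ} (hr : IsRotation r) :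
    IsCircGroup (rotRel r) := by
  have inv' : ∀ a b : G, a ≠ b → r (a / b) + r (b / a) = 1 := by
    intro a b h
    have := hr.inv (a / b) (by rwa [ne_eq, div_eq_one])
    rwa [inv_div] at this
  have mul' : ∀ a b c : G, r (b / a) + r (c / b) = r (c / a) ∨
      r (b / a) + r (c / b) = r (c / a) + 1 := by
    intro a b c
    have := hr.mul (b / a) (c / b)
    rwa [mul_comm (b / a), div_mul_div_cancel] at this
  refine ⟨?_, ?_, ?_, ?_, ?_⟩
  · rintro a b c ⟨h1, h2, h3, h4⟩
    exact ⟨h2, h3.symm, h1.symm, by linarith⟩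
  · rintro a b c ⟨h1, h2, h3, h4⟩ ⟨_, _, _, h5⟩
    have := inv' _ _ h1
    have := inv' _ _ h2
    have := inv' _ _ h3
    linarith
  · rintro a b c d ⟨h1, h2, h3, h4⟩ ⟨h1', h2', h3', h4'⟩
    have e1 := inv' _ _ h1
    have e2 := inv' _ _ h2
    have e3 := inv' _ _ h3
    have e4 := inv' _ _ h2'
    have e5 := inv' _ _ h3'
    have hbd : b ≠ d := by
      rintro rfl
      linarith
    have e6 := inv' _ _ hbd
    refine ⟨h1, hbd, h3', ?_⟩
    rcases mul' b c d with h | h <;> rcases mul' a b d with h' | h' <;> linarith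
  · intro a b c h1 h2 h3
    have e1 := inv' _ _ h1
    have e2 := inv' _ _ h2
    have e3 := inv' _ _ h3
    rcases mul' a b c with h | h
    · left; exact ⟨h1, h2, h3, by linarith⟩
    · right; exact ⟨h2.symm, h1.symm, h3.symm, by linarith⟩
  · rintro a b c d ⟨h1, h2, h3, h4⟩
    refine ⟨by simpa using h1, by simpa using h2, by simpa using h3, ?_⟩
    simpa only [mul_div_mul_left_eq_div] using h4

open Classical in
/-- The bounded cocycle of a circular order. -/
noncomputable def circCocycle {G : Type*} [CommGroup G] (R : G → G → G → Prop) (x y : G) : ℤ :=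
  if x = 1 ∨ y = 1 then 0 else if x * y = 1 then 1 else if R 1 x (x * y) then 0 else 1

/-- The winding sums of powers of an element. -/
noncomputable def circWinding {G : Type*} [CommGroup G] (R : G → G → G → Prop) (x : G) : ℕ → ℤ
  | 0 => 0
  | n + 1 => circWinding R x n + circCocycle R (x ^ n) x

/-- The rotation number of an element. -/
noncomputable def rot {G : Type*} [CommGroup G] (R : G → G → G → Prop) (x : G) : ℝ :=
  limUnder atTop (fun n : ℕ => (circWinding R x n : ℝ) / n)

open Classical in
theorem rot_map {G H : Type*} [CommGroup G] [CommGroup H] {R : G → G → G → Prop}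
    {S : H → H → H → Prop} (f : G →* H) (hf : Function.Injective f)
    (hRS : ∀ a b c, S (f a) (f b) (f c) ↔ R a b c) (x : G) : rot S (f x) = rot R x := by
  have h1 : ∀ x y, circCocycle S (f x) (f y) = circCocycle R x y := by
    intro x y
    have e1 : S 1 (f x) (f (x * y)) ↔ R 1 x (x * y) := by
      rw [← hRS, map_one]
    have e2 : ∀ z, f z = 1 ↔ z = 1 := fun z => by rw [← map_one f, hf.eq_iff]
    rw [circCocycle, circCocycle, ← map_mul]
    exact if_congr (or_congr (e2 x) (e2 y)) rfl (if_congr (e2 _) rfl (if_congr e1 rfl rfl))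
  have h2 : ∀ n, circWinding S (f x) n = circWinding R x n := by
    intro n
    induction n with
    | zero => rfl
    | succ n ih => rw [circWinding, circWinding, ih, ← map_pow, h1]
  simp only [rot, h2]

variable {G : Type*} [CommGroup G] {R : G → G → G → Prop}

theorem IsCircGroup.mul_iff (hR : IsCircGroup R) (a b c d : G) :
    R (d * a) (d * b) (d * c) ↔ R a b c :=
  ⟨fun h => by simpa using hR.mul _ _ _ d⁻¹ h, hR.mul a b c d⟩

theorem IsCircGroup.distinct (hR : IsCircGroup R) {a b c : G} (h : R a b c) :
    a ≠ b ∧ b ≠ c ∧ a ≠ c := by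
  refine ⟨?_, ?_, ?_⟩ <;> rintro rfl
  · have h1 := hR.cyc _ _ _ h
    have h2 := hR.cyc _ _ _ h1
    exact hR.asymm _ _ _ h h2
  · have h1 := hR.cyc _ _ _ h
    have h2 := hR.cyc _ _ _ h1
    exact hR.asymm _ _ _ h h1
  · exact hR.asymm _ _ _ h h

open Classical in
/-- The orientation cocycle of a triple. -/
noncomputable def circTriple (R : G → G → G → Prop) (a b c : G) : ℤ :=
  if a = b ∨ b = c then 0 else if a = c then 1 else if R a b c then 0 else 1

theorem circCocycle_zero_or_one (x y : G) :
    circCocycle R x y = 0 ∨ circCocycle R x y = 1 := by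
  unfold circCocycle; split_ifs <;> simp

open Classical in
theorem circCocycle_eq_triple (x y : G) :
    circCocycle R x y = circTriple R 1 x (x * y) := by
  rw [circCocycle, circTriple]
  exact if_congr (or_congr eq_comm left_eq_mul.symm) rfl (if_congr eq_comm rfl rfl)

open Classical in
theorem circTriple_mul (hR : IsCircGroup R) (a b c d : G) :
    circTriple R (d * a) (d * b) (d * c) = circTriple R a b c := by
  rw [circTriple, circTriple]
  exact if_congr (or_congr (mul_right_inj _) (mul_right_inj _)) rfl
    (if_congr (mul_right_inj _) rfl (if_congr (hR.mul_iff _ _ _ _) rfl rfl))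

theorem circTriple_cocycle (hR : IsCircGroup R) (a b c d : G) :
    circTriple R a b c + circTriple R a c d = circTriple R a b d + circTriple R b c d := by
  have h1 := hR.trans
  have h2 := hR.cyc
  have h3 := hR.asymm
  have h4 := hR.total
  have h5 : ∀ a b c, R a b c → a ≠ b ∧ b ≠ c ∧ a ≠ c := fun a b c h => hR.distinct h
  unfold circTriple
  grind

theorem circCocycle_cocycle (hR : IsCircGroup R) (x y z : G) :
    circCocycle R x y + circCocycle R (x * y) z
      = circCocycle R x (y * z) + circCocycle R y z := by
  have := circTriple_cocycle hR 1 x (x * y) (x * y * z)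
  rw [circCocycle_eq_triple, circCocycle_eq_triple, circCocycle_eq_triple,
    circCocycle_eq_triple, this, ← mul_assoc, ← circTriple_mul hR 1 y (y * z) x, mul_one,
    ← mul_assoc]

theorem circCocycle_comm (hR : IsCircGroup R) (x y : G) :
    circCocycle R x y = circCocycle R y x := by
  have h1 := circCocycle_cocycle hR x y y
  have h2 := circCocycle_cocycle hR y x y
  have h3 := circCocycle_cocycle hR y y x
  rw [mul_comm y x] at h2 h3
  rcases circCocycle_zero_or_one (R := R) x y with h | h <;>
  rcases circCocycle_zero_or_one (R := R) y x with h' | h' <;>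
  rcases circCocycle_zero_or_one (R := R) x (y * y) with k | k <;>
  rcases circCocycle_zero_or_one (R := R) (y * y) x with k' | k' <;> omega

theorem circCocycle_one (x : G) : circCocycle R 1 x = 0 := by simp [circCocycle]

theorem circWinding_add (hR : IsCircGroup R) (x : G) (n m : ℕ) : circWinding R x (n + m) =
    circWinding R x n + circWinding R x m + circCocycle R (x ^ n) (x ^ m) := by
  induction m with
  | zero => simp [circWinding, circCocycle]
  | succ m ih =>
    have := circCocycle_cocycle hR (x ^ n) (x ^ m) x
    rw [← pow_add, ← pow_succ] at this
    rw [← add_assoc, circWinding, ih, circWinding]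
    linarith

theorem circWinding_nonneg (x : G) (n : ℕ) : 0 ≤ circWinding R x n := by
  induction n with
  | zero => simp [circWinding]
  | succ m ih =>
    rw [circWinding]
    rcases circCocycle_zero_or_one (R := R) (x ^ m) x with h | h <;> omega

theorem circWinding_le (x : G) (n : ℕ) : circWinding R x n ≤ n := by
  induction n with
  | zero => simp [circWinding]
  | succ m ih =>
    rw [circWinding]
    rcases circCocycle_zero_or_one (R := R) (x ^ m) x with h | h <;> omega

theorem tendsto_rot (hR : IsCircGroup R) (x : G) :
    Tendsto (fun n : ℕ => (circWinding R x n : ℝ) / n) atTop (𝓝 (rot R x)) := by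
  have hs : Subadditive (fun n : ℕ => (circWinding R x n : ℝ) + 1) := by
    intro m n
    have := circWinding_add hR x m n
    have h' : circWinding R x (m + n) ≤ circWinding R x m + circWinding R x n + 1 := by
      rcases circCocycle_zero_or_one (R := R) (x ^ m) (x ^ n) with h | h <;> omega
    have h'' : (circWinding R x (m + n) : ℝ) ≤ circWinding R x m + circWinding R x n + 1 := by
      exact_mod_cast h'
    linarith
  have hb : BddBelow (Set.range fun n : ℕ => ((circWinding R x n : ℝ) + 1) / n) := by
    refine ⟨0, ?_⟩
    rintro _ ⟨n, rfl⟩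
    have : (0 : ℝ) ≤ circWinding R x n := by exact_mod_cast circWinding_nonneg x n
    positivity
  have h1 := hs.tendsto_lim hb
  have h2 : Tendsto (fun n : ℕ => (1 : ℝ) / n) atTop (𝓝 0) := tendsto_one_div_atTop_nhds_zero_nat
  have h3 := h1.sub h2
  refine tendsto_nhds_limUnder ⟨hs.lim - 0, h3.congr fun n => ?_⟩
  rw [← sub_div, add_sub_cancel_right]

theorem circWinding_mul (hR : IsCircGroup R) (x y : G) (n : ℕ) :
    circWinding R (x * y) n + n * circCocycle R x y =
      circWinding R x n + circWinding R y n + circCocycle R (x ^ n) (y ^ n) := by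
  induction n with
  | zero => simp [circWinding, circCocycle]
  | succ n ih =>
    simp only [circWinding]
    have h1 := circCocycle_cocycle hR (x ^ n) (y ^ n) (x * y)
    have h2 := circCocycle_cocycle hR (y ^ n) x y
    have h3 := circCocycle_cocycle hR (x ^ n) x (y ^ n * y)
    have h4 := circCocycle_cocycle hR x (y ^ n) y
    have e1 : y ^ n * (x * y) = x * (y ^ n * y) := mul_left_comm _ _ _
    rw [e1] at h1
    rw [circCocycle_comm hR (y ^ n) x, mul_comm (y ^ n) x] at h2
    rw [mul_pow, pow_succ, pow_succ]
    push_cast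
    linarith

theorem rot_mul (hR : IsCircGroup R) (x y : G) :
    rot R x + rot R y = rot R (x * y) + circCocycle R x y := by
  have h1 := (tendsto_rot hR x).add (tendsto_rot hR y)
  have h2 := (tendsto_rot hR (x * y)).add_const (circCocycle R x y : ℝ)
  have h3 : Tendsto (fun n : ℕ => (circCocycle R (x ^ n) (y ^ n) : ℝ) / n) atTop (𝓝 0) := by
    refine squeeze_zero (fun n => ?_) (fun n => ?_)
      (tendsto_one_div_atTop_nhds_zero_nat (𝕜 := ℝ))
    · rcases circCocycle_zero_or_one (R := R) (x ^ n) (y ^ n) with h | h <;> simp [h]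
    · rcases circCocycle_zero_or_one (R := R) (x ^ n) (y ^ n) with h | h <;> simp [h]
  have h4 := h1.add h3
  rw [add_zero] at h4
  refine tendsto_nhds_unique h4 (h2.congr' ?_)
  filter_upwards [eventually_gt_atTop 0] with n hn
  have hn' : (n : ℝ) ≠ 0 := by positivity
  have := circWinding_mul hR x y n
  have h5 : (circWinding R (x * y) n + n * circCocycle R x y : ℝ) =
      circWinding R x n + circWinding R y n + circCocycle R (x ^ n) (y ^ n) := by
    exact_mod_cast this
  field_simp
  linarith

theorem IsCircGroup.isRotation (hR : IsCircGroup R) : IsRotation (rot R) := by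
  have h1 : rot R 1 = 0 := by
    have := rot_mul hR 1 1
    rw [circCocycle_one] at this
    simpa using this
  refine ⟨fun x => ?_, fun x => ?_, h1, fun x hx => ?_, fun x y => ?_⟩
  · refine ge_of_tendsto' (tendsto_rot hR x) fun n => ?_
    have : (0 : ℝ) ≤ circWinding R x n := by exact_mod_cast circWinding_nonneg x n
    positivity
  · refine le_of_tendsto' (tendsto_rot hR x) fun n => ?_
    have : (circWinding R x n : ℝ) ≤ n := by exact_mod_cast circWinding_le x n
    exact div_le_one_of_le₀ this (by positivity)
  · rw [rot_mul hR, mul_inv_cancel, h1, circCocycle]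
    simp [hx]
  · rw [rot_mul hR]
    rcases circCocycle_zero_or_one (R := R) x y with h | h <;> simp [h]

open Classical in
theorem IsCircGroup.rotRel_rot (hR : IsCircGroup R) (a b c : G) :
    rotRel (rot R) a b c ↔ R a b c := by
  by_cases hd : a ≠ b ∧ b ≠ c ∧ a ≠ c
  swap
  · exact ⟨fun h => absurd ⟨h.1, h.2.1, h.2.2.1⟩ hd, fun h => absurd (hR.distinct h) hd⟩
  obtain ⟨h1, h2, h3⟩ := hd
  have e1 := rot_mul hR (b / a) (c / b)
  rw [mul_comm (b / a), div_mul_div_cancel] at e1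
  have e2 := hR.isRotation.inv (c / a) (by rw [ne_eq, div_eq_one]; exact h3.symm)
  rw [inv_div] at e2
  have e3 : R 1 (b / a) (c / a) ↔ R a b c := by
    rw [← hR.mul_iff _ _ _ a]; simp
  have e4 : circCocycle R (b / a) (c / b) = if R a b c then 0 else 1 := by
    rw [circCocycle, if_neg, if_neg, mul_comm (b / a), div_mul_div_cancel]
    · exact if_congr e3 rfl rfl
    · rw [mul_comm (b / a), div_mul_div_cancel, div_eq_one]; exact h3.symm
    · rw [div_eq_one, div_eq_one]; tauto
  rw [e4] at e1
  simp only [rotRel, h1, h2, h3, ne_eq, not_false_eq_true, true_and]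
  split_ifs at e1 with h
  · simp only [h, iff_true]
    push_cast at e1; linarith
  · simp only [h, iff_false]
    push_cast at e1; intro h; linarith

end Rotation

section RotationExtension

/-- The reduction of a rotation function modulo `1`. -/
noncomputable def IsRotation.toCircle {G : Type*} [CommGroup G] {r : G → ℝ} (hr : IsRotation r) :
    Additive G →+ AddCircle (1 : ℝ) where
  toFun x := ((r x.toMul : ℝ) : AddCircle (1 : ℝ))
  map_zero' := by simp [hr.one]
  map_add' x y := by
    rw [toMul_add, ← AddCircle.coe_add]
    rcases hr.mul x.toMul y.toMul with h | h
    · rw [h]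
    · rw [h, AddCircle.coe_add, AddCircle.coe_period, add_zero]

theorem AddCircle_coe_eq_coe_iff {x y : ℝ} :
    (x : AddCircle (1 : ℝ)) = y ↔ ∃ k : ℤ, x = y + k := by
  rw [← sub_eq_zero, ← AddCircle.coe_sub, AddCircle.coe_eq_zero_iff]
  constructor
  · rintro ⟨k, hk⟩; exact ⟨k, by simp at hk; linarith⟩
  · rintro ⟨k, hk⟩; exact ⟨k, by simp; linarith⟩

/-- A pointed submonoid of a group with no torsion inside `N` extends to a pointed submonoid
that is total on `N`. -/
theorem exists_total_cone {Γ : Type*} [CommGroup Γ] (N : Subgroup Γ)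
    (htf : ∀ g ∈ N, ∀ n : ℕ, 0 < n → g ^ n = 1 → g = 1)
    (P₀ : Submonoid Γ) (hP₀ : P₀ ≤ N.toSubmonoid) (hpt : ∀ g ∈ P₀, g⁻¹ ∈ P₀ → g = 1) :
    ∃ P : Submonoid Γ, P₀ ≤ P ∧ P ≤ N.toSubmonoid ∧ (∀ g ∈ P, g⁻¹ ∈ P → g = 1) ∧
      ∀ g ∈ N, g ∈ P ∨ g⁻¹ ∈ P := by
  let S : Set (Submonoid Γ) := {P | P ≤ N.toSubmonoid ∧ ∀ g ∈ P, g⁻¹ ∈ P → g = 1}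
  obtain ⟨P, hle, hmax⟩ := zorn_le_nonempty₀ S (by
    intro c hc hch y hy
    refine ⟨sSup c, ⟨sSup_le fun P hP => (hc hP).1, fun g hg hg' => ?_⟩,
      fun P hP => le_sSup hP⟩
    rw [Submonoid.mem_sSup_of_directedOn ⟨y, hy⟩ hch.directedOn] at hg hg'
    obtain ⟨P, hP, hgP⟩ := hg
    obtain ⟨Q, hQ, hgQ⟩ := hg'
    rcases hch.total hP hQ with h | h
    · exact (hc hQ).2 g (h hgP) hgQ
    · exact (hc hP).2 g hgP (h hgQ)) P₀ ⟨hP₀, hpt⟩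
  obtain ⟨⟨hPN, hPpt⟩, hPmax⟩ := hmax
  refine ⟨P, hle, hPN, hPpt, ?_⟩
  have key : ∀ g ∈ N, g ∉ P → ∃ n : ℕ, 0 < n ∧ (g ^ n)⁻¹ ∈ P := by
    intro g hgN hgP
    by_contra hno
    push Not at hno
    have hQS : P ⊔ Submonoid.powers g ∈ S := by
      refine ⟨sup_le hPN ?_, ?_⟩
      · rw [Submonoid.powers_le]; exact hgN
      · intro h hh hh'
        rw [Submonoid.mem_sup] at hh hh'
        obtain ⟨p, hp, _, ⟨n, rfl⟩, rfl⟩ := hh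
        obtain ⟨q, hq, _, ⟨m, rfl⟩, hqm⟩ := hh'
        have e : (g ^ (n + m))⁻¹ = p * q := by
          rw [eq_comm, eq_inv_iff_mul_eq_one]
          have h1 : (p * g ^ n) * (q * g ^ m) = 1 := by
            simp only at hqm
            rw [hqm]; simp
          rw [← h1, pow_add]
          exact mul_mul_mul_comm _ _ _ _
        rcases Nat.eq_zero_or_pos (n + m) with h0 | h0
        · obtain ⟨rfl, rfl⟩ : n = 0 ∧ m = 0 := by omega
          simp only [pow_zero, mul_one] at hqm ⊢
          exact hPpt p hp (hqm ▸ hq)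
        · exact absurd (e ▸ P.mul_mem hp hq) (hno _ h0)
    have := hPmax hQS le_sup_left
    exact hgP (this (le_sup_right (a := P) (Submonoid.mem_powers g)))
  intro g hg
  by_contra hno
  push Not at hno
  obtain ⟨n, hn, h1⟩ := key g hg hno.1
  obtain ⟨m, hm, h2⟩ := key g⁻¹ (N.inv_mem hg) hno.2
  rw [← inv_pow, inv_inv] at h2
  have h3 := hPpt (g ^ (m * n)) (by rw [pow_mul]; exact P.pow_mem h2 n)
    (by rw [mul_comm, pow_mul, ← inv_pow]; exact P.pow_mem h1 m)
  have := htf g hg _ (Nat.mul_pos hm hn) h3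
  exact hno.1 (this ▸ P.one_mem)

theorem exists_rotation_of_cone {Γ : Type*} [CommGroup Γ] (ρ : Additive Γ →+ AddCircle (1 : ℝ))
    (P₀ : Submonoid Γ) (hρP : ∀ g ∈ P₀, ρ (Additive.ofMul g) = 0)
    (hpt : ∀ g ∈ P₀, g⁻¹ ∈ P₀ → g = 1)
    (htf : ∀ g, ρ (Additive.ofMul g) = 0 → ∀ n : ℕ, 0 < n → g ^ n = 1 → g = 1) :
    ∃ r : Γ → ℝ, IsRotation r ∧ (∀ g, (r g : AddCircle (1 : ℝ)) = ρ (Additive.ofMul g)) ∧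
      ∀ g ∈ P₀, r g = 0 := by
  classical
  let N : Subgroup Γ := AddSubgroup.toSubgroup' ρ.ker
  have hN : ∀ g, g ∈ N ↔ ρ (Additive.ofMul g) = 0 := fun g => Iff.rfl
  obtain ⟨P, hle, hPN, hPpt, htot⟩ := exists_total_cone N htf P₀ hρP hpt
  have hex : ∀ t : AddCircle (1 : ℝ), ∃ s : ℝ, 0 ≤ s ∧ s < 1 ∧ (s : AddCircle (1 : ℝ)) = t := by
    intro t
    have : Fact ((0 : ℝ) < 1) := ⟨one_pos⟩
    refine ⟨AddCircle.equivIco 1 0 t, (AddCircle.equivIco 1 0 t).2.1, ?_,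
      (AddCircle.equivIco 1 0).symm_apply_apply t⟩
    simpa using (AddCircle.equivIco (1 : ℝ) 0 t).2.2
  choose s hs0 hs1 hs using hex
  let r : Γ → ℝ := fun g =>
    if ρ (Additive.ofMul g) = 0 then (if g ∈ P then 0 else 1) else s (ρ (Additive.ofMul g))
  have hr : ∀ g, r g =
    if ρ (Additive.ofMul g) = 0 then (if g ∈ P then 0 else 1) else s (ρ (Additive.ofMul g)) :=
    fun g => rfl
  have hcoe : ∀ g, (r g : AddCircle (1 : ℝ)) = ρ (Additive.ofMul g) := by
    intro g
    rw [hr]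
    split_ifs with h1 h2
    · simp [h1]
    · rw [h1, AddCircle.coe_period]
    · exact hs _
  have h0 : ∀ g, 0 ≤ r g := by
    intro g; rw [hr]; split_ifs <;> first | positivity | exact hs0 _
  have h1 : ∀ g, r g ≤ 1 := by
    intro g; rw [hr]; split_ifs <;> first | exact (hs1 _).le | norm_num
  have hP0 : ∀ g, r g = 0 ↔ g ∈ P := by
    intro g
    constructor
    · intro h
      have hk : ρ (Additive.ofMul g) = 0 := by rw [← hcoe, h, AddCircle.coe_zero]
      rw [hr, if_pos hk] at h
      by_contra h'
      rw [if_neg h'] at h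
      norm_num at h
    · intro h
      rw [hr, if_pos ((hN g).1 (hPN h)), if_pos h]
  have hP1 : ∀ g, r g = 1 ↔ g⁻¹ ∈ P ∧ g ≠ 1 := by
    intro g
    constructor
    · intro h
      have hk : ρ (Additive.ofMul g) = 0 := by rw [← hcoe, h, AddCircle.coe_period]
      have : g ∉ P := fun h' => by rw [(hP0 g).2 h'] at h; norm_num at h
      refine ⟨(htot g hk).resolve_left this, fun h' => this (h' ▸ P.one_mem)⟩
    · rintro ⟨h, hne⟩
      have hk : g ∈ N := by
        have := N.inv_mem (hPN h)
        rwa [inv_inv] at this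
      rw [hr, if_pos ((hN g).1 hk), if_neg]
      intro h'
      exact hne (hPpt g h' h)
  have hadd : ∀ x y, ∃ k : ℤ, r x + r y = r (x * y) + k := by
    intro x y
    rw [← AddCircle_coe_eq_coe_iff, AddCircle.coe_add, hcoe, hcoe, hcoe, ofMul_mul, map_add]
  have hone : r 1 = 0 := (hP0 1).2 P.one_mem
  refine ⟨r, ⟨h0, h1, hone, fun x hx => ?_, fun x y => ?_⟩, hcoe,
    fun g hg => (hP0 g).2 (hle hg)⟩
  · obtain ⟨k, hk⟩ := hadd x x⁻¹
    rw [mul_inv_cancel, hone, zero_add] at hk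
    have a1 := h0 x
    have a2 := h0 x⁻¹
    have a3 := h1 x
    have a4 := h1 x⁻¹
    have b1 : k ≥ 0 := by have : (0 : ℝ) ≤ k := by linarith
                          exact_mod_cast this
    have b2 : k ≤ 2 := by have : (k : ℝ) ≤ 2 := by linarith
                          exact_mod_cast this
    have : k = 0 ∨ k = 1 ∨ k = 2 := by omega
    rcases this with rfl | rfl | rfl
    · push_cast at hk
      have c1 : r x = 0 := by linarith
      have c2 : r x⁻¹ = 0 := by linarith
      exact absurd (hPpt x ((hP0 _).1 c1) ((hP0 _).1 c2)) hx
    · simpa using hk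
    · push_cast at hk
      have c1 : r x = 1 := by linarith
      have c2 : r x⁻¹ = 1 := by linarith
      have d1 := ((hP1 _).1 c1).1
      have d2 := ((hP1 _).1 c2).1
      rw [inv_inv] at d2
      exact absurd (hPpt x d2 d1) hx
  · obtain ⟨k, hk⟩ := hadd x y
    have a1 := h0 x
    have a2 := h0 y
    have a3 := h1 x
    have a4 := h1 y
    have a5 := h0 (x * y)
    have a6 := h1 (x * y)
    have b1 : k ≥ -1 := by have : (-1 : ℝ) ≤ k := by linarith
                           exact_mod_cast this
    have b2 : k ≤ 2 := by have : (k : ℝ) ≤ 2 := by linarith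
                          exact_mod_cast this
    have : k = -1 ∨ k = 0 ∨ k = 1 ∨ k = 2 := by omega
    rcases this with rfl | rfl | rfl | rfl
    · push_cast at hk
      have c1 : r x = 0 := by linarith
      have c2 : r y = 0 := by linarith
      have c3 := (hP0 _).2 (P.mul_mem ((hP0 _).1 c1) ((hP0 _).1 c2))
      linarith
    · left; simpa using hk
    · right; simpa using hk
    · push_cast at hk
      have c1 : r x = 1 := by linarith
      have c2 : r y = 1 := by linarith
      have c3 : r (x * y) = 0 := by linarith
      have d1 := (hP1 _).1 c1
      have d2 := (hP1 _).1 c2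
      have d3 := (hP0 _).1 c3
      have d4 : (x * y)⁻¹ ∈ P := by rw [mul_inv]; exact P.mul_mem d1.1 d2.1
      have d5 := hPpt _ d3 d4
      have d6 : y = x⁻¹ := by rw [eq_inv_iff_mul_eq_one, mul_comm]; exact d5
      rw [d6, inv_inv] at d2
      exact absurd (hPpt x d2.1 d1.1) d1.2

theorem IsRotation.eq_one_of_pow_eq_one {G : Type*} [CommGroup G] {r : G → ℝ}
    (hr : IsRotation r) {x : G} (hx : r x = 0) {n : ℕ} (hn : 0 < n) (h : x ^ n = 1) : x = 1 := by
  have h1 : ∀ k : ℕ, r (x ^ k) = 0 := by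
    intro k
    induction k with
    | zero => simp [hr.one]
    | succ k ih =>
      have h0 := hr.nonneg (x ^ k * x)
      have := hr.mul (x ^ k) x
      rw [pow_succ]
      rcases this with h | h <;> linarith
  by_contra hne
  have h2 := hr.inv x hne
  have h3 : x ^ (n - 1) = x⁻¹ := by
    rw [eq_inv_iff_mul_eq_one, ← pow_succ, Nat.sub_add_cancel hn, h]
  rw [← h3, h1, hx] at h2
  norm_num at h2

theorem IsRotation.mul_eq_zero {G : Type*} [CommGroup G] {r : G → ℝ} (hr : IsRotation r)
    {x y : G} (hx : r x = 0) (hy : r y = 0) : r (x * y) = 0 := by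
  have := hr.nonneg (x * y)
  rcases hr.mul x y with h | h <;> linarith

theorem IsRotation.eq_one_of_mul_eq_one {G : Type*} [CommGroup G] {r : G → ℝ}
    (hr : IsRotation r) {x y : G} (hx : r x = 0) (hy : r y = 0) (hxy : x * y = 1) : x = 1 := by
  by_contra hne
  have := hr.inv x hne
  rw [inv_eq_of_mul_eq_one_right hxy, hx, hy] at this
  norm_num at this

theorem IsRotation.eq_zero_or_of_eq_intCast {G : Type*} [CommGroup G] {r : G → ℝ}
    (hr : IsRotation r) {x : G} {k : ℤ} (hk : r x = k) : r x = 0 ∨ r x⁻¹ = 0 := by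
  by_cases hx : x = 1
  · left; rw [hx, hr.one]
  have h2 := hr.inv x hx
  have h3 := hr.nonneg x⁻¹
  have h4 := hr.nonneg x
  have h5 : k ≤ 1 := by have : (k : ℝ) ≤ 1 := by linarith
                        exact_mod_cast this
  have h6 : 0 ≤ k := by have : (0 : ℝ) ≤ k := by linarith
                        exact_mod_cast this
  obtain rfl | rfl : k = 0 ∨ k = 1 := by omega
  · left; simpa using hk
  · right; push_cast at hk; linarith

theorem IsRotation.comp_eq {G Γ : Type*} [CommGroup G] [CommGroup Γ] {s : G → ℝ} {r : Γ → ℝ}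
    (hs : IsRotation s) (hr : IsRotation r) (ψ : G →* Γ) (hψ : ∀ x, ψ x = 1 → x = 1)
    (h0 : ∀ x, s x = 0 → r (ψ x) = 0)
    (hsr : ∀ x, (r (ψ x) : AddCircle (1 : ℝ)) = s x) (x : G) : r (ψ x) = s x := by
  obtain ⟨k, hk⟩ := AddCircle_coe_eq_coe_iff.1 (hsr x)
  have a1 := hs.nonneg x
  have a2 := hs.le_one x
  have a3 := hr.nonneg (ψ x)
  have a4 := hr.le_one (ψ x)
  have h5 : k ≤ 1 := by have : (k : ℝ) ≤ 1 := by linarith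
                        exact_mod_cast this
  have h6 : -1 ≤ k := by have : (-1 : ℝ) ≤ k := by linarith
                         exact_mod_cast this
  obtain rfl | rfl | rfl : k = -1 ∨ k = 0 ∨ k = 1 := by omega
  · push_cast at hk
    have b1 : x ≠ 1 := by rintro rfl; rw [hs.one] at hk; linarith
    have b2 := h0 x⁻¹ (by have := hs.inv x b1; linarith)
    have b3 := hr.inv (ψ x) (fun h => b1 (hψ x h))
    rw [map_inv] at b2
    linarith
  · simpa using hk
  · push_cast at hk
    have := h0 x (by linarith)
    linarith

theorem exists_rotation_extension {G₀ G₁ G₂ Γ : Type*} [CommGroup G₀] [CommGroup G₁]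
    [CommGroup G₂] [CommGroup Γ] {r₀ : G₀ → ℝ} {r₁ : G₁ → ℝ} {r₂ : G₂ → ℝ}
    (h₀ : IsRotation r₀) (h₁ : IsRotation r₁) (h₂ : IsRotation r₂)
    (ψ₀ : G₀ →* Γ) (ψ₁ : G₁ →* Γ) (ψ₂ : G₂ →* Γ)
    (hglue : ∀ x y z, ψ₀ x * ψ₁ y * ψ₂ z = 1 → ∃ k : ℤ, r₀ x + r₁ y + r₂ z = k)
    (hcone : ∀ x y z, ψ₀ x * ψ₁ y * ψ₂ z = 1 → r₀ x = 0 → r₁ y = 0 → r₂ z = 0 →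
      x = 1 ∧ y = 1 ∧ z = 1)
    (htors : ∀ (g : Γ) (n : ℕ), 0 < n → g ^ n = 1 → ∃ x, ψ₀ x = g) :
    ∃ r : Γ → ℝ, IsRotation r ∧ (∀ x, r (ψ₀ x) = r₀ x) ∧ (∀ x, r (ψ₁ x) = r₁ x) ∧
      (∀ x, r (ψ₂ x) = r₂ x) := by
  let Ψ : G₀ × G₁ × G₂ →* Γ := ψ₀.coprod (ψ₁.coprod ψ₂)
  have hΨ : ∀ x y z, Ψ (x, y, z) = ψ₀ x * ψ₁ y * ψ₂ z := fun x y z => by simp [Ψ, mul_assoc]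
  let f : Additive (G₀ × G₁ × G₂) →+ AddCircle (1 : ℝ) :=
    h₀.toCircle.comp (MonoidHom.toAdditive (MonoidHom.fst G₀ (G₁ × G₂))) +
    (h₁.toCircle.comp (MonoidHom.toAdditive ((MonoidHom.fst G₁ G₂).comp (MonoidHom.snd G₀ _))) +
     h₂.toCircle.comp (MonoidHom.toAdditive ((MonoidHom.snd G₁ G₂).comp (MonoidHom.snd G₀ _))))
  have hf : ∀ x y z, f (Additive.ofMul (x, y, z)) =
      ((r₀ x + r₁ y + r₂ z : ℝ) : AddCircle (1 : ℝ)) := by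
    intro x y z
    rw [AddCircle.coe_add, AddCircle.coe_add, add_assoc]
    rfl
  let Ψ' : Additive (G₀ × G₁ × G₂) →+ Additive Γ := MonoidHom.toAdditive Ψ
  have hker : Ψ'.ker ≤ f.ker := by
    intro v hv
    obtain ⟨x, y, z⟩ := v
    have h1 : ψ₀ x * ψ₁ y * ψ₂ z = 1 := by rw [← hΨ]; exact hv
    obtain ⟨k, hk⟩ := hglue x y z h1
    have := hf x y z
    rw [hk, ← zero_add (k : ℝ)] at this
    exact this.trans ((AddCircle_coe_eq_coe_iff (y := 0)).2 ⟨k, rfl⟩)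
  obtain ⟨ρ, hρ⟩ : ∃ ρ : Additive Γ →+ AddCircle (1 : ℝ), ∀ v, ρ (Ψ' v) = f v := by
    have : Fact ((0 : ℝ) < 1) := ⟨one_pos⟩
    have hb : Module.Baer ℤ (AddCircle (1 : ℝ)) := Module.Baer.of_divisible _
    obtain ⟨ρ, hρ⟩ := hb.extension_property_addMonoidHom
      (QuotientAddGroup.kerLift Ψ') (QuotientAddGroup.kerLift_injective Ψ')
      (QuotientAddGroup.lift Ψ'.ker f hker)
    refine ⟨ρ, fun v => ?_⟩
    exact DFunLike.congr_fun hρ (v : Additive (G₀ × G₁ × G₂) ⧸ Ψ'.ker)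
  have hρ' : ∀ x y z, ρ (Additive.ofMul (ψ₀ x * ψ₁ y * ψ₂ z)) =
      ((r₀ x + r₁ y + r₂ z : ℝ) : AddCircle (1 : ℝ)) := by
    intro x y z
    rw [← hf, ← hρ, ← hΨ]; rfl
  let P₀ : Submonoid Γ :=
    { carrier := {g | ∃ x y z, r₀ x = 0 ∧ r₁ y = 0 ∧ r₂ z = 0 ∧ ψ₀ x * ψ₁ y * ψ₂ z = g}
      one_mem' := ⟨1, 1, 1, h₀.one, h₁.one, h₂.one, by simp⟩
      mul_mem' := by
        rintro _ _ ⟨x, y, z, hx, hy, hz, rfl⟩ ⟨x', y', z', hx', hy', hz', rfl⟩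
        refine ⟨x * x', y * y', z * z', ?_, ?_, ?_, ?_⟩
        · exact h₀.mul_eq_zero hx hx'
        · exact h₁.mul_eq_zero hy hy'
        · exact h₂.mul_eq_zero hz hz'
        · simp only [map_mul]
          rw [mul_mul_mul_comm (ψ₀ x), mul_mul_mul_comm] }
  have hP₀pt : ∀ g ∈ P₀, g⁻¹ ∈ P₀ → g = 1 := by
    rintro _ ⟨x, y, z, hx, hy, hz, rfl⟩ ⟨x', y', z', hx', hy', hz', he⟩
    have e : ψ₀ (x * x') * ψ₁ (y * y') * ψ₂ (z * z') = 1 := by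
      rw [eq_inv_iff_mul_eq_one] at he
      rw [← he]
      simp only [map_mul]
      rw [mul_mul_mul_comm (ψ₀ x), mul_mul_mul_comm, mul_comm]
    obtain ⟨e1, e2, e3⟩ := hcone _ _ _ e (h₀.mul_eq_zero hx hx') (h₁.mul_eq_zero hy hy')
      (h₂.mul_eq_zero hz hz')
    rw [h₀.eq_one_of_mul_eq_one hx hx' e1, h₁.eq_one_of_mul_eq_one hy hy' e2,
      h₂.eq_one_of_mul_eq_one hz hz' e3]
    simp
  have hinj₀ : ∀ x, ψ₀ x = 1 → x = 1 := by
    intro x hx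
    obtain ⟨k, hk⟩ := hglue x 1 1 (by simp [hx])
    rw [h₁.one, h₂.one, add_zero, add_zero] at hk
    rcases h₀.eq_zero_or_of_eq_intCast hk with h | h
    · exact (hcone x 1 1 (by simp [hx]) h h₁.one h₂.one).1
    · exact inv_eq_one.1 (hcone x⁻¹ 1 1 (by simp [hx]) h h₁.one h₂.one).1
  have hinj₁ : ∀ x, ψ₁ x = 1 → x = 1 := by
    intro x hx
    obtain ⟨k, hk⟩ := hglue 1 x 1 (by simp [hx])
    rw [h₀.one, h₂.one, add_zero, zero_add] at hk
    rcases h₁.eq_zero_or_of_eq_intCast hk with h | h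
    · exact (hcone 1 x 1 (by simp [hx]) h₀.one h h₂.one).2.1
    · exact inv_eq_one.1 (hcone 1 x⁻¹ 1 (by simp [hx]) h₀.one h h₂.one).2.1
  have hinj₂ : ∀ x, ψ₂ x = 1 → x = 1 := by
    intro x hx
    obtain ⟨k, hk⟩ := hglue 1 1 x (by simp [hx])
    rw [h₀.one, h₁.one, add_zero, zero_add] at hk
    rcases h₂.eq_zero_or_of_eq_intCast hk with h | h
    · exact (hcone 1 1 x (by simp [hx]) h₀.one h₁.one h).2.2
    · exact inv_eq_one.1 (hcone 1 1 x⁻¹ (by simp [hx]) h₀.one h₁.one h).2.2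
  have hc₀ : ∀ x, ρ (Additive.ofMul (ψ₀ x)) = ((r₀ x : ℝ) : AddCircle (1 : ℝ)) := fun x => by
    simpa [h₁.one, h₂.one] using hρ' x 1 1
  have hc₁ : ∀ x, ρ (Additive.ofMul (ψ₁ x)) = ((r₁ x : ℝ) : AddCircle (1 : ℝ)) := fun x => by
    simpa [h₀.one, h₂.one] using hρ' 1 x 1
  have hc₂ : ∀ x, ρ (Additive.ofMul (ψ₂ x)) = ((r₂ x : ℝ) : AddCircle (1 : ℝ)) := fun x => by
    simpa [h₀.one, h₁.one] using hρ' 1 1 x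
  obtain ⟨r, hr, hrρ, hrP⟩ := exists_rotation_of_cone ρ P₀
    (by
      rintro _ ⟨x, y, z, hx, hy, hz, rfl⟩
      rw [hρ', hx, hy, hz]; simp)
    hP₀pt
    (by
      intro g hg n hn hgn
      obtain ⟨x, rfl⟩ := htors g n hn hgn
      have hxn : x ^ n = 1 := hinj₀ _ (by rw [map_pow, hgn])
      rw [hc₀] at hg
      obtain ⟨k, hk⟩ := (AddCircle_coe_eq_coe_iff (x := r₀ x) (y := 0)).1 (by rw [hg]; simp)
      rw [zero_add] at hk
      rcases h₀.eq_zero_or_of_eq_intCast hk with h | h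
      · rw [h₀.eq_one_of_pow_eq_one h hn hxn, map_one]
      · rw [inv_eq_one.1 (h₀.eq_one_of_pow_eq_one h hn (by rw [inv_pow, hxn, inv_one])),
          map_one])
  exact ⟨r, hr,
    h₀.comp_eq hr ψ₀ hinj₀ (fun x hx => hrP _ ⟨x, 1, 1, hx, h₁.one, h₂.one, by simp⟩)
      (fun x => by rw [hrρ, hc₀]),
    h₁.comp_eq hr ψ₁ hinj₁ (fun x hx => hrP _ ⟨1, x, 1, h₀.one, hx, h₂.one, by simp⟩)
      (fun x => by rw [hrρ, hc₁]),
    h₂.comp_eq hr ψ₂ hinj₂ (fun x hx => hrP _ ⟨1, 1, x, h₀.one, h₁.one, hx, by simp⟩)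
      (fun x => by rw [hrρ, hc₂])⟩
end RotationExtension

section CircField

/-- A circular order on the nonzero elements of a field, invariant under multiplication. -/
structure IsCircField {K : Type*} [Field K] (R : K → K → K → Prop) : Prop where
  ne_zero : ∀ a b c, R a b c → a ≠ 0 ∧ b ≠ 0 ∧ c ≠ 0
  cyc : ∀ a b c, R a b c → R b c a
  asymm : ∀ a b c, R a b c → ¬ R c b a
  trans : ∀ a b c d, R a b c → R a c d → R a b d
  total : ∀ a b c, a ≠ 0 → b ≠ 0 → c ≠ 0 → a ≠ b → b ≠ c → a ≠ c → R a b c ∨ R c b a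
  mul : ∀ a b c d, d ≠ 0 → R a b c → R (d * a) (d * b) (d * c)

/-- The restriction of a ternary relation on a field to the group of units. -/
def unitRel {K : Type*} [Field K] (R : K → K → K → Prop) (a b c : Kˣ) : Prop := R a b c

theorem IsCircField.isCircGroup {K : Type*} [Field K] {R : K → K → K → Prop}
    (hR : IsCircField R) : IsCircGroup (unitRel R) where
  cyc a b c h := hR.cyc _ _ _ h
  asymm a b c h := hR.asymm _ _ _ h
  trans a b c d h h' := hR.trans _ _ _ _ h h'
  total a b c h1 h2 h3 := hR.total _ _ _ a.ne_zero b.ne_zero c.ne_zero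
    (fun h => h1 (Units.ext h)) (fun h => h2 (Units.ext h)) (fun h => h3 (Units.ext h))
  mul a b c d h := by
    simpa [unitRel] using hR.mul _ _ _ (d : K) d.ne_zero h

theorem IsCircGroup.isCircField {K : Type*} [Field K] {S : Kˣ → Kˣ → Kˣ → Prop}
    (hS : IsCircGroup S) :
    IsCircField (fun a b c : K => ∃ x y z : Kˣ, (x : K) = a ∧ (y : K) = b ∧ (z : K) = c ∧ S x y z) where
  ne_zero := by
    rintro _ _ _ ⟨x, y, z, rfl, rfl, rfl, h⟩
    exact ⟨x.ne_zero, y.ne_zero, z.ne_zero⟩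
  cyc := by
    rintro _ _ _ ⟨x, y, z, rfl, rfl, rfl, h⟩
    exact ⟨y, z, x, rfl, rfl, rfl, hS.cyc _ _ _ h⟩
  asymm := by
    rintro _ _ _ ⟨x, y, z, rfl, rfl, rfl, h⟩ ⟨x', y', z', hx, hy, hz, h'⟩
    obtain rfl := Units.ext hx
    obtain rfl := Units.ext hy
    obtain rfl := Units.ext hz
    exact hS.asymm _ _ _ h h'
  trans := by
    rintro _ _ _ _ ⟨x, y, z, rfl, rfl, rfl, h⟩ ⟨x', y', z', hx, hy, rfl, h'⟩
    obtain rfl := Units.ext hx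
    obtain rfl := Units.ext hy
    exact ⟨_, _, _, rfl, rfl, rfl, hS.trans _ _ _ _ h h'⟩
  total := by
    intro a b c ha hb hc h1 h2 h3
    rcases hS.total (Units.mk0 a ha) (Units.mk0 b hb) (Units.mk0 c hc) (by simpa using h1)
      (by simpa using h2) (by simpa using h3) with h | h
    · left; exact ⟨_, _, _, rfl, rfl, rfl, h⟩
    · right; exact ⟨_, _, _, rfl, rfl, rfl, h⟩
  mul := by
    rintro _ _ _ d hd ⟨x, y, z, rfl, rfl, rfl, h⟩
    exact ⟨Units.mk0 d hd * x, Units.mk0 d hd * y, Units.mk0 d hd * z, by simp, by simp, by simp,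
      hS.mul _ _ _ _ h⟩

/-- The rotation number on the units of a field with a ternary relation. -/
noncomputable def frot {K : Type*} [Field K] (R : K → K → K → Prop) (x : Kˣ) : ℝ :=
  rot (unitRel R) x

theorem frot_map {K L : Type*} [Field K] [Field L] {R : K → K → K → Prop} {S : L → L → L → Prop}
    (f : K →+* L) (hf : ∀ a b c, S (f a) (f b) (f c) ↔ R a b c) (x : Kˣ) :
    frot S (Units.map (f : K →* L) x) = frot R x :=
  rot_map (Units.map (f : K →* L)) (Units.map_injective f.injective) (fun a b c => hf a b c) x

theorem IsCircField.isRotation {K : Type*} [Field K] {R : K → K → K → Prop}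
    (hR : IsCircField R) : IsRotation (frot R) := hR.isCircGroup.isRotation

theorem IsCircField.rotRel_iff {K : Type*} [Field K] {R : K → K → K → Prop}
    (hR : IsCircField R) (a b c : Kˣ) : rotRel (frot R) a b c ↔ R a b c :=
  hR.isCircGroup.rotRel_rot a b c

theorem mem_range_of_eval₂_eq_zero {k L : Type*} [Field k] [IsAlgClosed k] [Field L] (f : k →+* L)
    {p : Polynomial k} (hp : p ≠ 0) {z : L} (hz : p.eval₂ f z = 0) : ∃ x, f x = z := by
  have h := (IsAlgClosed.splits p).mem_range_of_isRoot hp (i := f) (x := z)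
    (by rw [Polynomial.IsRoot, Polynomial.eval_map]; exact hz)
  simpa using h

theorem isCircField_of_rotation_iff {K L : Type*} [Field K] [Field L] {S : K → K → K → Prop}
    (hS : IsCircField S) {r : Lˣ → ℝ} (f : K →+* L)
    (he : ∀ x, r (Units.map (f : K →* L) x) = frot S x) (a b c : K) :
    (∃ x y z : Lˣ, (x : L) = f a ∧ (y : L) = f b ∧ (z : L) = f c ∧ rotRel r x y z) ↔
      S a b c := by
  have aux : ∀ a b c : Kˣ, rotRel r (Units.map (f : K →* L) a) (Units.map (f : K →* L) b)
      (Units.map (f : K →* L) c) ↔ S a b c := by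
    intro a b c
    have hi := Units.map_injective (f := (f : K →* L)) f.injective
    rw [← hS.rotRel_iff, rotRel, rotRel, hi.ne_iff, hi.ne_iff, hi.ne_iff, ← map_div, ← map_div,
      ← map_div, he, he, he]
  constructor
  · rintro ⟨x, y, z, hx, hy, hz, h⟩
    have e : ∀ (a : K) (x : Lˣ), (x : L) = f a → ∃ u : Kˣ, (u : K) = a ∧
        Units.map (f : K →* L) u = x := by
      intro a x h
      have : a ≠ 0 := by
        rintro rfl
        rw [map_zero] at h
        exact x.ne_zero h
      exact ⟨Units.mk0 a this, rfl, Units.ext h.symm⟩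
    obtain ⟨u, rfl, rfl⟩ := e a x hx
    obtain ⟨v, rfl, rfl⟩ := e b y hy
    obtain ⟨w, rfl, rfl⟩ := e c z hz
    exact (aux u v w).1 h
  · intro h
    obtain ⟨ha, hb, hc⟩ := hS.ne_zero _ _ _ h
    exact ⟨_, _, _, rfl, rfl, rfl,
      (aux (Units.mk0 a ha) (Units.mk0 b hb) (Units.mk0 c hc)).2 h⟩

theorem exists_circField_extension {K₀ K₁ K₂ L : Type*} [Field K₀] [Field K₁] [Field K₂] [Field L]
    [IsAlgClosed K₀] {R₀ : K₀ → K₀ → K₀ → Prop} {R₁ : K₁ → K₁ → K₁ → Prop}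
    {R₂ : K₂ → K₂ → K₂ → Prop} (h₀ : IsCircField R₀) (h₁ : IsCircField R₁) (h₂ : IsCircField R₂)
    (f₀ : K₀ →+* L) (f₁ : K₁ →+* L) (f₂ : K₂ →+* L)
    (hglue : ∀ (x : K₀ˣ) (y : K₁ˣ) (z : K₂ˣ), f₀ x * f₁ y * f₂ z = 1 →
      ∃ k : ℤ, frot R₀ x + frot R₁ y + frot R₂ z = k)
    (hcone : ∀ (x : K₀ˣ) (y : K₁ˣ) (z : K₂ˣ), f₀ x * f₁ y * f₂ z = 1 → frot R₀ x = 0 →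
      frot R₁ y = 0 → frot R₂ z = 0 → x = 1 ∧ y = 1 ∧ z = 1) :
    ∃ R : L → L → L → Prop, IsCircField R ∧ (∀ a b c, R (f₀ a) (f₀ b) (f₀ c) ↔ R₀ a b c) ∧
      (∀ a b c, R (f₁ a) (f₁ b) (f₁ c) ↔ R₁ a b c) ∧
      (∀ a b c, R (f₂ a) (f₂ b) (f₂ c) ↔ R₂ a b c) := by
  obtain ⟨r, hr, e₀, e₁, e₂⟩ := exists_rotation_extension h₀.isRotation h₁.isRotation
    h₂.isRotation (Units.map (f₀ : K₀ →* L)) (Units.map (f₁ : K₁ →* L)) (Units.map (f₂ : K₂ →* L))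
    (fun x y z h => hglue x y z (by simpa using congrArg Units.val h))
    (fun x y z h => hcone x y z (by simpa using congrArg Units.val h))
    (by
      intro g n hn hgn
      obtain ⟨x, hx⟩ := mem_range_of_eval₂_eq_zero f₀ (p := Polynomial.X ^ n - 1) (z := (g : L))
        (Polynomial.X_pow_sub_C_ne_zero hn 1) (by
          have : (g : L) ^ n = 1 := by rw [← Units.val_pow_eq_pow_val, hgn, Units.val_one]
          simp [this])
      have hx0 : x ≠ 0 := by
        rintro rfl
        rw [map_zero] at hx
        exact g.ne_zero hx.symm
      exact ⟨Units.mk0 x hx0, Units.ext hx⟩)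
  refine ⟨_, hr.isCircGroup.isCircField, ?_⟩
  exact ⟨isCircField_of_rotation_iff h₀ f₀ e₀, isCircField_of_rotation_iff h₁ f₁ e₁,
    isCircField_of_rotation_iff h₂ f₂ e₂⟩
end CircField

section Amalgam

theorem IsRotation.exists_int_of_mul_eq_one {G : Type*} [CommGroup G] {r : G → ℝ}
    (hr : IsRotation r) {x y z : G} (h : x * y * z = 1) : ∃ k : ℤ, r x + r y + r z = k := by
  have h1 := hr.mul x y
  have h2 := hr.mul (x * y) z
  rw [h, hr.one] at h2
  rcases h1 with h1 | h1 <;> rcases h2 with h2 | h2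
  · exact ⟨0, by push_cast; linarith⟩
  · exact ⟨1, by push_cast; linarith⟩
  · exact ⟨1, by push_cast; linarith⟩
  · exact ⟨2, by push_cast; linarith⟩

theorem exists_ringHom_lift {R K Ω : Type*} [CommRing R] [Field K] [Field Ω]
    [IsAlgClosed Ω] (f : R →+* K) (q : R →+* Ω) (hf : Function.Injective f)
    (hq : Function.Injective q)
    (halg : ∀ a : K, ∃ p : Polynomial R, p ≠ 0 ∧ p.eval₂ f a = 0) :
    ∃ g : K →+* Ω, ∀ r, g (f r) = q r := by
  have := hf.isDomain f
  let _ := f.toAlgebra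
  let _ := q.toAlgebra
  have : FaithfulSMul R K := (faithfulSMul_iff_algebraMap_injective _ _).2 hf
  have : FaithfulSMul R Ω := (faithfulSMul_iff_algebraMap_injective _ _).2 hq
  have : Algebra.IsAlgebraic R K := ⟨fun a => halg a⟩
  let g : K →ₐ[R] Ω := IsAlgClosed.lift
  exact ⟨g, g.commutes⟩

theorem exists_algClosed_embedding (R : Type u) [CommRing R] [IsDomain R] :
    ∃ (Ω : Type u) (_ : Field Ω) (_ : IsAlgClosed Ω) (q : R →+* Ω), Function.Injective q :=
  ⟨AlgebraicClosure (FractionRing R), inferInstance, inferInstance,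
    (algebraMap (FractionRing R) _).comp (algebraMap R _),
    (algebraMap (FractionRing R) _).injective.comp (IsFractionRing.injective R _)⟩

theorem exists_field_amalgam {E K N : Type u} [Field E] [Field K] [Field N] [IsAlgClosed E]
    (i : E →+* K) (e : E →+* N) :
    ∃ (Ω : Type u) (_ : Field Ω) (_ : IsAlgClosed Ω) (g : K →+* Ω) (h : N →+* Ω),
      (∀ z, g (i z) = h (e z)) ∧ ∀ x y, g x = h y → ∃ z, i z = x ∧ e z = y := by
  let _ := i.toAlgebra
  obtain ⟨s, hs⟩ := exists_isTranscendenceBasis E K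
  let x : s → K := Subtype.val
  obtain ⟨Ω, _, _, q, hq⟩ := exists_algClosed_embedding (MvPolynomial s N)
  let q' : MvPolynomial s E →+* Ω := q.comp (MvPolynomial.map e)
  have hq' : Function.Injective q' := hq.comp (MvPolynomial.map_injective e e.injective)
  let f : MvPolynomial s E →+* K := (MvPolynomial.aeval x : MvPolynomial s E →ₐ[E] K)
  have hf : Function.Injective f := hs.1
  have halg : ∀ a : K, ∃ p : Polynomial (MvPolynomial s E), p ≠ 0 ∧ p.eval₂ f a = 0 := by
    intro a
    obtain ⟨p, hp0, hp⟩ := hs.isAlgebraic.isAlgebraic a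
    let ε := hs.1.aevalEquiv
    refine ⟨p.map (ε.symm : _ →+* MvPolynomial s E), ?_, ?_⟩
    · rwa [ne_eq, Polynomial.map_eq_zero_iff]
      exact ε.symm.injective
    · rw [Polynomial.eval₂_map, ← hp, Polynomial.aeval_def]
      congr 1
      ext1 z
      obtain ⟨w, rfl⟩ := ε.surjective z
      simp only [RingHom.comp_apply, RingHom.coe_coe, AlgEquiv.symm_apply_apply]
      exact (hs.1.algebraMap_aevalEquiv w).symm
  obtain ⟨g, hg⟩ := exists_ringHom_lift f q' hf hq' halg
  let h : N →+* Ω := q.comp MvPolynomial.C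
  have hgh : ∀ z, g (i z) = h (e z) := by
    intro z
    have h1 : i z = f (MvPolynomial.C z) := (MvPolynomial.aeval_C x z).symm
    rw [h1, hg]
    change q (MvPolynomial.map e (MvPolynomial.C z)) = _
    rw [MvPolynomial.map_C]
    rfl
  refine ⟨Ω, inferInstance, inferInstance, g, h, hgh, fun a y hay => ?_⟩
  obtain ⟨p, hp0, hp⟩ := halg a
  have h1 : p.eval₂ q' (h y) = 0 := by
    have := congrArg g hp
    rw [map_zero, Polynomial.hom_eval₂] at this
    rw [← this, ← hay]
    congr 1
    exact RingHom.ext fun r => (hg r).symm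
  have h2 : (p.map (MvPolynomial.map e)).eval (MvPolynomial.C y) = 0 := by
    apply hq
    rw [map_zero, ← h1, Polynomial.eval_map, Polynomial.hom_eval₂]
    rfl
  obtain ⟨k, hk⟩ : ∃ k, p.coeff k ≠ 0 := by
    by_contra hno
    push Not at hno
    exact hp0 (Polynomial.ext hno)
  obtain ⟨m, hm⟩ := MvPolynomial.ne_zero_iff.1 hk
  let pm : Polynomial E := ∑ k ∈ p.support, Polynomial.monomial k ((p.coeff k).coeff m)
  have hpm : ∀ k, pm.coeff k = (p.coeff k).coeff m := by
    intro k
    simp only [pm, Polynomial.finsetSum_coeff, Polynomial.coeff_monomial]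
    rw [Finset.sum_ite_eq']
    split_ifs with hk'
    · rfl
    · rw [Polynomial.notMem_support_iff.1 hk', MvPolynomial.coeff_zero]
  have hpm0 : pm ≠ 0 := fun h0 => hm (by rw [← hpm, h0, Polynomial.coeff_zero])
  have hpy : pm.eval₂ e y = 0 := by
    have h3 := congrArg (MvPolynomial.coeff m) h2
    rw [Polynomial.eval_map, Polynomial.eval₂_eq_sum, Polynomial.sum, MvPolynomial.coeff_sum] at h3
    simp only [pm, Polynomial.eval₂_finsetSum, Polynomial.eval₂_monomial]
    rw [MvPolynomial.coeff_zero] at h3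
    rw [← h3]
    refine Finset.sum_congr rfl fun k _ => ?_
    rw [← map_pow, mul_comm, mul_comm _ (MvPolynomial.C _), MvPolynomial.coeff_C_mul, MvPolynomial.coeff_map]
  obtain ⟨z, hz⟩ := mem_range_of_eval₂_eq_zero e hpm0 hpy
  refine ⟨z, g.injective ?_, hz⟩
  rw [hay, hgh, hz]

theorem exists_circField_amalgam {E K N : Type u} [Field E] [Field K] [Field N] [IsAlgClosed E]
    [IsAlgClosed K]
    {RE : E → E → E → Prop} {RK : K → K → K → Prop} {RN : N → N → N → Prop}
    (hE : IsCircField RE) (hK : IsCircField RK) (hN : IsCircField RN)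
    (i : E →+* K) (e : E →+* N) (hi : ∀ a b c, RK (i a) (i b) (i c) ↔ RE a b c)
    (he : ∀ a b c, RN (e a) (e b) (e c) ↔ RE a b c) :
    ∃ (Ω : Type u) (_ : Field Ω) (_ : IsAlgClosed Ω) (R : Ω → Ω → Ω → Prop)
      (g : K →+* Ω) (h : N →+* Ω), IsCircField R ∧
      (∀ a b c, R (g a) (g b) (g c) ↔ RK a b c) ∧ (∀ a b c, R (h a) (h b) (h c) ↔ RN a b c) ∧
      ∀ z, g (i z) = h (e z) := by
  obtain ⟨Ω, _, _, g, h, hgh, hdis⟩ := exists_field_amalgam i e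
  have key : ∀ (x : Kˣ) (y : Nˣ) (z : Eˣ), g x * h y * (h.comp e) z = 1 → ∃ u v : Eˣ,
      u * v * z = 1 ∧ x = Units.map (i : E →* K) u ∧ y = Units.map (e : E →* N) v := by
    intro x y z hxyz
    obtain ⟨w, hw1, hw2⟩ := hdis x (↑(y * Units.map (e : E →* N) z)⁻¹) (by
      rw [Units.val_inv_eq_inv_val, map_inv₀]
      refine eq_inv_of_mul_eq_one_left ?_
      rw [← hxyz]
      simp [mul_assoc])
    have hw0 : w ≠ 0 := by
      rintro rfl
      rw [map_zero] at hw1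
      exact x.ne_zero hw1.symm
    let u : Eˣ := Units.mk0 w hw0
    refine ⟨u, u⁻¹ * z⁻¹, by simp, Units.ext hw1.symm, ?_⟩
    have : Units.map (e : E →* N) u = (y * Units.map (e : E →* N) z)⁻¹ := Units.ext hw2
    rw [map_mul, map_inv, map_inv, this]
    simp
  obtain ⟨R, hR, e1, e2, -⟩ := exists_circField_extension hK hN hE g h (h.comp e)
    (by
      intro x y z hxyz
      obtain ⟨u, v, huv, rfl, rfl⟩ := key x y z hxyz
      rw [frot_map i hi, frot_map e he]
      exact hE.isRotation.exists_int_of_mul_eq_one huv)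
    (by
      intro x y z hxyz hx hy hz
      obtain ⟨u, v, huv, rfl, rfl⟩ := key x y z hxyz
      rw [frot_map i hi] at hx
      rw [frot_map e he] at hy
      have hr := hE.isRotation
      have h1 : z = 1 := hr.eq_one_of_mul_eq_one hz (hr.mul_eq_zero hx hy) (by rw [mul_comm, huv])
      rw [h1, mul_one] at huv
      have h2 : u = 1 := hr.eq_one_of_mul_eq_one hx hy huv
      have h3 : v = 1 := by rwa [h2, one_mul] at huv
      simp [h1, h2, h3])
  exact ⟨Ω, _, ‹_›, R, g, h, hR, e1, e2, hgh⟩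
end Amalgam

section GermField

/-- The diagonal embedding of a ring into an ultrapower. -/
def gconst {ι : Type*} (U : Ultrafilter ι) (K : Type*) [CommRing K] :
    K →+* Germ (U : Filter ι) K :=
  (Germ.coeRingHom (U : Filter ι)).comp (Pi.constRingHom ι K)

/-- The map of ultrapowers induced by a ring homomorphism. -/
def germMap {ι : Type*} (U : Ultrafilter ι) {A K : Type*} [CommRing A] [CommRing K] (f : A →+* K) :
    Germ (U : Filter ι) A →+* Germ (U : Filter ι) K where
  toFun := Germ.map f
  map_zero' := congrArg Germ.ofFun (funext fun _ => map_zero f)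
  map_one' := congrArg Germ.ofFun (funext fun _ => map_one f)
  map_add' x y := Germ.inductionOn₂ x y fun _ _ =>
    congrArg Germ.ofFun (funext fun _ => map_add f _ _)
  map_mul' x y := Germ.inductionOn₂ x y fun _ _ =>
    congrArg Germ.ofFun (funext fun _ => map_mul f _ _)

/-- The ultrapower of a ternary relation. -/
def germRel {ι : Type*} (U : Ultrafilter ι) {K : Type*} (R : K → K → K → Prop)
    (a b c : Germ (U : Filter ι) K) : Prop :=
  ∃ f g h : ι → K, a = f ∧ b = g ∧ c = h ∧ ∀ᶠ t in U, R (f t) (g t) (h t)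

variable {ι : Type*} (U : Ultrafilter ι)

theorem gconst_apply {K : Type*} [CommRing K] (x : K) :
    gconst U K x = ((fun _ => x : ι → K) : Germ (U : Filter ι) K) := rfl

theorem germMap_coe {A K : Type*} [CommRing A] [CommRing K] (f : A →+* K) (x : ι → A) :
    germMap U f (x : Germ (U : Filter ι) A) =
      ((fun t => f (x t) : ι → K) : Germ (U : Filter ι) K) := rfl

theorem germ_coe_eq {K : Type*} {f g : ι → K} :
    (f : Germ (U : Filter ι) K) = g ↔ ∀ᶠ t in U, f t = g t := Germ.coe_eq

theorem germRel_coe {K : Type*} {R : K → K → K → Prop} {f g h : ι → K} :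
    germRel U R (f : Germ (U : Filter ι) K) g h ↔ ∀ᶠ t in U, R (f t) (g t) (h t) := by
  constructor
  · rintro ⟨f', g', h', hf, hg, hh, H⟩
    filter_upwards [(germ_coe_eq U).1 hf, (germ_coe_eq U).1 hg, (germ_coe_eq U).1 hh, H]
      with t h1 h2 h3 h4
    rwa [h1, h2, h3]
  · exact fun H => ⟨f, g, h, rfl, rfl, rfl, H⟩

theorem IsCircField.germ {K : Type*} [Field K] {R : K → K → K → Prop} (hR : IsCircField R) :
    IsCircField (germRel U R) := by
  have ne0 : ∀ f : ι → K, (f : Germ (U : Filter ι) K) ≠ 0 ↔ ∀ᶠ t in U, f t ≠ 0 := by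
    intro f
    rw [Ultrafilter.eventually_not, not_iff_not]
    exact germ_coe_eq U (g := 0)
  have ne' : ∀ f g : ι → K, (f : Germ (U : Filter ι) K) ≠ g ↔ ∀ᶠ t in U, f t ≠ g t := by
    intro f g
    rw [Ultrafilter.eventually_not, not_iff_not]
    exact germ_coe_eq U
  constructor
  · intro a b c
    refine Germ.inductionOn₃ a b c fun f g h => ?_
    rw [germRel_coe, ne0, ne0, ne0]
    intro H
    exact ⟨H.mono fun t ht => (hR.ne_zero _ _ _ ht).1, H.mono fun t ht => (hR.ne_zero _ _ _ ht).2.1,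
      H.mono fun t ht => (hR.ne_zero _ _ _ ht).2.2⟩
  · intro a b c
    refine Germ.inductionOn₃ a b c fun f g h => ?_
    rw [germRel_coe, germRel_coe]
    exact fun H => H.mono fun t => hR.cyc _ _ _
  · intro a b c
    refine Germ.inductionOn₃ a b c fun f g h => ?_
    rw [germRel_coe, germRel_coe, ← Ultrafilter.eventually_not]
    exact fun H => H.mono fun t => hR.asymm _ _ _
  · intro a b c d
    induction d using Germ.inductionOn
    refine Germ.inductionOn₃ a b c fun f g h => ?_
    rw [germRel_coe, germRel_coe, germRel_coe]
    exact fun H H' => by filter_upwards [H, H'] with t h1 h2 using hR.trans _ _ _ _ h1 h2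
  · intro a b c
    refine Germ.inductionOn₃ a b c fun f g h => ?_
    rw [germRel_coe, germRel_coe, ne0, ne0, ne0, ne', ne', ne', ← Ultrafilter.eventually_or]
    exact fun h1 h2 h3 h4 h5 h6 => by
      filter_upwards [h1, h2, h3, h4, h5, h6] with t using hR.total _ _ _
  · intro a b c d
    induction d using Germ.inductionOn with | _ d => ?_
    refine Germ.inductionOn₃ a b c fun f g h => ?_
    rw [ne0]
    intro hd H
    have := (germRel_coe U).1 H
    refine (germRel_coe U (f := d * f) (g := d * g) (h := d * h)).2 ?_
    filter_upwards [hd, this] with t using hR.mul _ _ _ _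

theorem isAlgClosed_germ (K : Type*) [Field K] [IsAlgClosed K] :
    IsAlgClosed (Germ (U : Filter ι) K) := by
  refine IsAlgClosed.of_exists_root _ fun p hp hirr => ?_
  let q := Germ.coeRingHom (R := K) (U : Filter ι)
  have hq : Function.Surjective q := fun x => Germ.inductionOn x fun f => ⟨f, rfl⟩
  obtain ⟨P, hP, hdeg, hmon⟩ := Polynomial.lifts_and_natDegree_eq_and_monic
    ((Polynomial.mem_lifts p).2 (Polynomial.map_surjective q hq p)) hp
  have hroot : ∀ t, ∃ x : K, (P.map (Pi.evalRingHom (fun _ : ι => K) t)).eval x = 0 := by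
    intro t
    refine IsAlgClosed.exists_root _ ?_
    rw [Polynomial.degree_eq_natDegree (hmon.map _).ne_zero, hmon.natDegree_map, hdeg]
    exact_mod_cast (hirr.natDegree_pos).ne'
  choose x hx using hroot
  refine ⟨q x, ?_⟩
  rw [← hP, Polynomial.eval_map, Polynomial.eval₂_hom]
  have : P.eval x = 0 := by
    funext t
    have h1 := hx t
    rw [Polynomial.eval_map] at h1
    have h2 := Polynomial.eval₂_hom (p := P) (Pi.evalRingHom (fun _ : ι => K) t) x
    exact (h2.symm.trans h1)
  rw [this, map_zero]

end GermField

section TensorGerm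

variable {ι : Type*} (U : Ultrafilter ι)

theorem germ_linearIndependent {C A L : Type*} [Field C] [Field A] [Algebra C A] {v : L → A}
    (hv : LinearIndependent C v) (s : Finset L) (g : L → Germ (U : Filter ι) C)
    (h : ∑ l ∈ s, germMap U (algebraMap C A) (g l) * gconst U A (v l) = 0) :
    ∀ l ∈ s, g l = 0 := by
  choose f hf using fun l => Quotient.exists_rep (g l)
  have h1 : Germ.coeRingHom (U : Filter ι)
      (∑ l ∈ s, (fun t => algebraMap C A (f l t) * v l : ι → A)) = 0 := by
    rw [map_sum, ← h]
    refine Finset.sum_congr rfl fun l _ => ?_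
    rw [← hf l]
    rfl
  have h2 := (germ_coe_eq U (g := (0 : ι → A))).1 h1
  intro l hl
  rw [← hf l]
  refine (germ_coe_eq U (g := (0 : ι → C))).2 (h2.mono fun t ht => ?_)
  rw [Finset.sum_apply] at ht
  refine linearIndependent_iff'.1 hv s (fun l => f l t) ?_ l hl
  simpa [Algebra.smul_def] using ht

theorem exists_tensor_germ {C A B : Type*} [Field C] [Field A] [Field B] [Algebra C A]
    [Algebra C B] (b : B →+* Germ (U : Filter ι) C)
    (hb : ∀ c, b (algebraMap C B c) = gconst U C c) :
    ∃ ψ : B ⊗[C] A →+* Germ (U : Filter ι) A,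
      ∀ β a, ψ (β ⊗ₜ a) = germMap U (algebraMap C A) (b β) * gconst U A a := by
  let inst : Algebra C (Germ (U : Filter ι) A) := ((gconst U A).comp (algebraMap C A)).toAlgebra
  let f : B →ₐ[C] Germ (U : Filter ι) A :=
    { (germMap U (algebraMap C A)).comp b with
      commutes' := fun c => by
        change germMap U (algebraMap C A) (b (algebraMap C B c)) = _
        rw [hb]; rfl }
  let g : A →ₐ[C] Germ (U : Filter ι) A :=
    { gconst U A with commutes' := fun c => rfl }
  exact ⟨(Algebra.TensorProduct.productMap f g).toRingHom, fun β a =>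
    Algebra.TensorProduct.productMap_apply_tmul f g β a⟩

theorem tensor_germ_expand {C A B L : Type*} [Field C] [Field A] [Field B] [Algebra C A]
    [Algebra C B] (b : B →+* Germ (U : Filter ι) C) (ψ : B ⊗[C] A →+* Germ (U : Filter ι) A)
    (hψ : ∀ β a, ψ (β ⊗ₜ a) = germMap U (algebraMap C A) (b β) * gconst U A a)
    (v : Module.Basis L C A) (x : B ⊗[C] A) (s : Finset L)
    (hs : ((Algebra.TensorProduct.basis B v).repr x).support ⊆ s) :
    ψ x = ∑ l ∈ s, germMap U (algebraMap C A) (b ((Algebra.TensorProduct.basis B v).repr x l)) *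
      gconst U A (v l) := by
  conv_lhs => rw [← (Algebra.TensorProduct.basis B v).linearCombination_repr x]
  rw [Finsupp.linearCombination_apply, Finsupp.sum_of_support_subset _ hs _ (by simp), map_sum]
  refine Finset.sum_congr rfl fun l _ => ?_
  rw [Algebra.TensorProduct.basis_apply, TensorProduct.smul_tmul', smul_eq_mul, mul_one, hψ]

theorem tensor_germ_injective {C A B : Type*} [Field C] [Field A] [Field B] [Algebra C A]
    [Algebra C B] (b : B →+* Germ (U : Filter ι) C) (ψ : B ⊗[C] A →+* Germ (U : Filter ι) A)
    (hψ : ∀ β a, ψ (β ⊗ₜ a) = germMap U (algebraMap C A) (b β) * gconst U A a) :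
    Function.Injective ψ := by
  rw [injective_iff_map_eq_zero]
  intro x hx
  let v := Module.Basis.ofVectorSpace C A
  rw [tensor_germ_expand U b ψ hψ v x _ subset_rfl] at hx
  have h := germ_linearIndependent U v.linearIndependent _ _ hx
  apply (Algebra.TensorProduct.basis B v).repr.injective
  rw [map_zero]
  ext l
  by_cases hl : l ∈ ((Algebra.TensorProduct.basis B v).repr x).support
  · exact b.injective (by rw [h l hl, Finsupp.zero_apply, map_zero])
  · rw [Finsupp.notMem_support_iff.1 hl]; rfl

theorem tensor_germ_descent {C A B : Type*} [Field C] [Field A] [Field B] [IsAlgClosed B]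
    [Algebra C A] [Algebra C B] (b : B →+* Germ (U : Filter ι) C)
    (ψ : B ⊗[C] A →+* Germ (U : Filter ι) A)
    (hψ : ∀ β a, ψ (β ⊗ₜ a) = germMap U (algebraMap C A) (b β) * gconst U A a)
    {p : Polynomial (B ⊗[C] A)} (hp : p ≠ 0) {k : Germ (U : Filter ι) C}
    (hk : p.eval₂ ψ (germMap U (algebraMap C A) k) = 0) : ∃ β, b β = k := by
  classical
  let v := Module.Basis.ofVectorSpace C A
  let w := Algebra.TensorProduct.basis B v
  let s := p.support.biUnion fun n => (w.repr (p.coeff n)).support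
  have h1 : ∑ l ∈ s, germMap U (algebraMap C A)
      (∑ n ∈ p.support, b (w.repr (p.coeff n) l) * k ^ n) * gconst U A (v l) = 0 := by
    rw [← hk, Polynomial.eval₂_eq_sum, Polynomial.sum]
    simp_rw [map_sum, Finset.sum_mul]
    rw [Finset.sum_comm]
    refine Finset.sum_congr rfl fun n hn => ?_
    rw [tensor_germ_expand U b ψ hψ v (p.coeff n) s
      (Finset.subset_biUnion_of_mem (fun n => (w.repr (p.coeff n)).support) hn), Finset.sum_mul]
    refine Finset.sum_congr rfl fun l _ => ?_
    rw [map_mul, map_pow]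
    ring
  have h2 := germ_linearIndependent U v.linearIndependent _ _ h1
  obtain ⟨n, hn⟩ : ∃ n, p.coeff n ≠ 0 := by
    by_contra hno
    push Not at hno
    exact hp (Polynomial.ext hno)
  obtain ⟨l, hl⟩ : ∃ l, w.repr (p.coeff n) l ≠ 0 := by
    by_contra hno
    push Not at hno
    refine hn (w.repr.injective ?_)
    rw [map_zero]
    exact Finsupp.ext hno
  have hls : l ∈ s := Finset.mem_biUnion.2
    ⟨n, Polynomial.mem_support_iff.2 hn, Finsupp.mem_support_iff.2 hl⟩
  let q : Polynomial B := ∑ n ∈ p.support, Polynomial.monomial n (w.repr (p.coeff n) l)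
  have hq : q.coeff n = w.repr (p.coeff n) l := by
    simp only [q, Polynomial.finsetSum_coeff, Polynomial.coeff_monomial]
    rw [Finset.sum_ite_eq', if_pos (Polynomial.mem_support_iff.2 hn)]
  refine mem_range_of_eval₂_eq_zero b (p := q) (fun h0 => hl ?_) ?_
  · rw [← hq, h0, Polynomial.coeff_zero]
  · simp only [q, Polynomial.eval₂_finsetSum, Polynomial.eval₂_monomial]
    exact h2 l hls

theorem isDomain_tensor_of_germ {C A B : Type*} [Field C] [Field A] [Field B] [Algebra C A]
    [Algebra C B] (b : B →+* Germ (U : Filter ι) C)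
    (hb : ∀ c, b (algebraMap C B c) = gconst U C c) : IsDomain (B ⊗[C] A) := by
  obtain ⟨ψ, hψ⟩ := exists_tensor_germ (A := A) U b hb
  exact (tensor_germ_injective U b ψ hψ).isDomain ψ

end TensorGerm

theorem productMap_injective_of_algebraic {C A B E : Type u} [Field C] [Field A] [Field B]
    [Field E] [Algebra C A] [Algebra C B] [Algebra C E] [IsDomain (B ⊗[C] A)]
    (jA : A →ₐ[C] E) (jB : B →ₐ[C] E) (S : Subalgebra C A) (hS : ∀ a : A, IsAlgebraic S a)
    (hld : ∀ (L : Type u) (s : Finset L) (v : L → A), (∀ l, v l ∈ S) → LinearIndependent C v →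
      ∀ β : L → B, ∑ l ∈ s, jB (β l) * jA (v l) = 0 → ∀ l ∈ s, β l = 0) :
    Function.Injective (Algebra.TensorProduct.productMap jB jA) := by
  set m := Algebra.TensorProduct.productMap jB jA with hm
  have hmt : ∀ b a, m (b ⊗ₜ a) = jB b * jA a := fun b a =>
    Algebra.TensorProduct.productMap_apply_tmul jB jA b a
  let τ : B ⊗[C] S →ₐ[C] B ⊗[C] A := Algebra.TensorProduct.map (AlgHom.id C B) S.val
  have hτ : ∀ b s, τ (b ⊗ₜ s) = b ⊗ₜ (s : A) := fun b s => rfl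
  let D := τ.range
  have hinj : ∀ y : B ⊗[C] S, m (τ y) = 0 → y = 0 := by
    intro y hy
    let v := Module.Basis.ofVectorSpace C S
    let w := Algebra.TensorProduct.basis B v
    have h1 : ∑ l ∈ (w.repr y).support, jB (w.repr y l) * jA (v l) = 0 := by
      rw [← hy]
      conv_rhs => rw [← w.linearCombination_repr y]
      rw [Finsupp.linearCombination_apply, Finsupp.sum, map_sum, map_sum]
      refine Finset.sum_congr rfl fun l _ => ?_
      rw [Algebra.TensorProduct.basis_apply, TensorProduct.smul_tmul', smul_eq_mul, mul_one, hτ, hmt]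
    have h2 := hld _ _ (fun l => (v l : A)) (fun l => (v l).2)
      (v.linearIndependent.map' S.val.toLinearMap (LinearMap.ker_eq_bot.2 Subtype.val_injective))
      _ h1
    apply w.repr.injective
    rw [map_zero]
    ext l
    by_cases hl : l ∈ (w.repr y).support
    · exact h2 l hl
    · rw [Finsupp.notMem_support_iff.1 hl]; rfl
  have halg : ∀ x : B ⊗[C] A, IsAlgebraic D x := by
    intro x
    induction x using TensorProduct.induction_on with
    | zero => exact isAlgebraic_zero
    | add x y hx hy => exact hx.add hy
    | tmul b a =>
      have h1 : (b ⊗ₜ[C] a : B ⊗[C] A) = (b ⊗ₜ 1) * (1 ⊗ₜ a) := by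
        rw [Algebra.TensorProduct.tmul_mul_tmul, mul_one, one_mul]
      rw [h1]
      refine IsAlgebraic.mul ?_ ?_
      · exact isAlgebraic_algebraMap (⟨b ⊗ₜ 1, ⟨b ⊗ₜ 1, rfl⟩⟩ : D)
      · obtain ⟨p, hp0, hp⟩ := hS a
        let r : A →ₐ[C] B ⊗[C] A := Algebra.TensorProduct.includeRight
        have hr : Function.Injective r := Algebra.TensorProduct.includeRight_injective
          (algebraMap C B).injective
        let κ : S →+* D := ((r.comp S.val).codRestrict D (fun s => ⟨1 ⊗ₜ s, rfl⟩)).toRingHom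
        have hκ : Function.Injective κ := by
          intro s s' h
          exact Subtype.ext (hr (congrArg Subtype.val h))
        refine ⟨p.map κ, ?_, ?_⟩
        · rwa [ne_eq, Polynomial.map_eq_zero_iff hκ]
        · rw [Polynomial.aeval_def, Polynomial.eval₂_map]
          have := congrArg r hp
          rw [map_zero, Polynomial.aeval_def] at this
          rw [← this]
          exact (Polynomial.hom_eval₂ p (algebraMap S A) r.toRingHom a).symm
  rw [injective_iff_map_eq_zero]
  intro x hx
  by_contra hx0
  refine Ideal.comap_ne_bot_of_algebraic_mem (R := D) (I := RingHom.ker m.toRingHom) hx0 hx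
    (halg x) ?_
  rw [eq_bot_iff]
  rintro ⟨_, y, rfl⟩ hy
  have : y = 0 := hinj y hy
  rw [Ideal.mem_bot]
  refine Subtype.ext ?_
  change τ y = 0
  rw [this, map_zero]

section ThreeAmalgam

theorem IsRotation.not_rotRel_of_cone {G : Type*} [CommGroup G] {r : G → ℝ} (hr : IsRotation r)
    {z x y w c : G} (hx : r (x / z) = 0) (hy : r (w / y) = 0) (hz : r (z / w) = 0)
    (h0 : r (c / z) ≠ 0) (h1 : r (c / z) ≠ 1) (hxz : x ≠ z)
    (hcut : rotRel r z x c → rotRel r z y c) : False := by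
  have hcz : c ≠ z := by rintro rfl; exact h0 (by rw [div_self', hr.one])
  have hcx : c ≠ x := by rintro rfl; exact h0 hx
  have hi : ∀ a b : G, a ≠ b → r (a / b) + r (b / a) = 1 := by
    intro a b h
    have := hr.inv (a / b) (by rwa [ne_eq, div_eq_one])
    rwa [inv_div] at this
  have e1 := hi c z hcz
  have e2 : rotRel r z x c := by
    refine ⟨hxz.symm, hcx.symm, hcz.symm, ?_⟩
    have h2 := hr.mul (x / z) (c / x)
    rw [mul_comm (x / z), div_mul_div_cancel] at h2
    have := hr.le_one (c / x)
    have := hr.nonneg (c / z)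
    rcases h2 with h2 | h2
    · linarith
    · exact absurd (by linarith) h0
  obtain ⟨d1, d2, d3, e3⟩ := hcut e2
  have e4 : r (z / y) = 0 := by
    have := hr.mul_eq_zero hz hy
    rwa [div_mul_div_cancel] at this
  have e5 := hi z y d1
  have := hr.nonneg (c / y)
  have := hr.nonneg (z / c)
  exact h1 (by linarith)

theorem exists_pow_eq_one_ne_one (C : Type*) [Field C] [IsAlgClosed C] :
    ∃ (ζ : Cˣ) (n : ℕ), 0 < n ∧ ζ ^ n = 1 ∧ ζ ≠ 1 := by
  by_cases h2 : (2 : C) = 0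
  · obtain ⟨ζ, hζ⟩ := IsAlgClosed.exists_root (Polynomial.X ^ 2 + Polynomial.X + 1 : Polynomial C) (by
      have : (Polynomial.X ^ 2 + Polynomial.X + 1 : Polynomial C).degree = 2 := by compute_degree!
      rw [this]; decide)
    have hζ' : ζ ^ 2 + ζ + 1 = 0 := by simpa using hζ
    have h3 : ζ ^ 3 = 1 := by linear_combination (ζ - 1) * hζ'
    have hζ0 : ζ ≠ 0 := by rintro rfl; simp at h3
    refine ⟨Units.mk0 ζ hζ0, 3, by norm_num, Units.ext (by simpa using h3), fun h => ?_⟩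
    have h1 : ζ = 1 := congrArg Units.val h
    rw [h1] at hζ'
    exact one_ne_zero (by linear_combination hζ' - h2 : (1 : C) = 0)
  · refine ⟨-1, 2, by norm_num, by simp, fun h => h2 ?_⟩
    have h1 : (-1 : C) = 1 := by simpa using congrArg Units.val h
    linear_combination -h1

theorem exists_unit_rotation_generic {C K : Type*} [Field C] [IsAlgClosed C] [Field K] {r : Kˣ → ℝ}
    (hr : IsRotation r) (f : C →+* K) (z : Kˣ) :
    ∃ c : Cˣ, r (Units.map (f : C →* K) c / z) ≠ 0 ∧ r (Units.map (f : C →* K) c / z) ≠ 1 := by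
  obtain ⟨ζ, n, hn, hζn, hζ⟩ := exists_pow_eq_one_ne_one C
  by_contra! hno
  have key : ∀ c : Cˣ, r (Units.map (f : C →* K) c / z) = 0 ∨
      r (Units.map (f : C →* K) c / z) = 1 := fun c => by
    by_cases h : r (Units.map (f : C →* K) c / z) = 0
    · exact Or.inl h
    · exact Or.inr (hno c h)
  set g := Units.map (f : C →* K) ζ with hg
  have hg1 : g ≠ 1 := fun h => hζ (Units.map_injective f.injective (by rw [map_one]; exact h))
  have hgn : g ^ n = 1 := by rw [hg, ← map_pow, hζn, map_one]
  have h0 : r g ≠ 0 := fun h => hg1 (hr.eq_one_of_pow_eq_one h hn hgn)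
  have h1 : r g ≠ 1 := fun h => by
    have h2 : r g⁻¹ = 0 := by linarith [hr.inv g hg1]
    exact hg1 (inv_eq_one.1 (hr.eq_one_of_pow_eq_one h2 hn (by rw [inv_pow, hgn, inv_one])))
  have e1 := key 1
  rw [map_one] at e1
  have e2 := key ζ
  rw [← hg] at e2
  have e3 := hr.mul g (1 / z)
  rw [mul_one_div] at e3
  have := hr.nonneg g
  have := hr.le_one g
  rcases e1 with e1 | e1 <;> rcases e2 with e2 | e2 <;> rcases e3 with e3 | e3 <;>
    first
    | exact h0 (by linarith)
    | exact h1 (by linarith)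

theorem exists_germ_lift {ι : Type*} (U : Ultrafilter ι) {C A B E : Type*} [Field C] [Field A]
    [Field B] [Field E] [IsAlgClosed A] [IsAlgClosed B] [Algebra C A] [Algebra C B] [Algebra C E]
    (jA : A →ₐ[C] E) (jB : B →ₐ[C] E)
    (hinj : Function.Injective (Algebra.TensorProduct.productMap jB jA))
    (halg : ∀ e : E, IsAlgebraic (Algebra.TensorProduct.productMap jB jA).range e)
    (b : B →+* Germ (U : Filter ι) C) (hb : ∀ c, b (algebraMap C B c) = gconst U C c) :
    ∃ θ : E →+* Germ (U : Filter ι) A, (∀ a, θ (jA a) = gconst U A a) ∧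
      (∀ β, θ (jB β) = germMap U (algebraMap C A) (b β)) ∧
      ∀ e k, θ e = germMap U (algebraMap C A) k → ∃ β, jB β = e ∧ b β = k := by
  obtain ⟨ψ, hψ⟩ := exists_tensor_germ (A := A) U b hb
  have hψi := tensor_germ_injective U b ψ hψ
  have := isAlgClosed_germ U A
  set m := Algebra.TensorProduct.productMap jB jA with hm
  have hmt : ∀ b a, m (b ⊗ₜ a) = jB b * jA a := fun b a =>
    Algebra.TensorProduct.productMap_apply_tmul jB jA b a
  have halg' : ∀ e : E, ∃ p : Polynomial (B ⊗[C] A), p ≠ 0 ∧ p.eval₂ (m : B ⊗[C] A →+* E) e = 0 := by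
    intro e
    obtain ⟨p, hp0, hp⟩ := halg e
    let ε := AlgEquiv.ofInjective m hinj
    refine ⟨p.map (ε.symm : m.range →+* B ⊗[C] A), ?_, ?_⟩
    · rwa [ne_eq, Polynomial.map_eq_zero_iff]
      exact ε.symm.injective
    · rw [Polynomial.eval₂_map, ← hp, Polynomial.aeval_def]
      congr 1
      ext1 z
      obtain ⟨w, rfl⟩ := ε.surjective z
      simp only [RingHom.comp_apply, RingHom.coe_coe, AlgEquiv.symm_apply_apply]
      rfl
  obtain ⟨θ, hθ⟩ := exists_ringHom_lift (m : B ⊗[C] A →+* E) ψ hinj hψi halg'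
  have hθA : ∀ a, θ (jA a) = gconst U A a := by
    intro a
    have h := hθ (1 ⊗ₜ a)
    rw [hψ, map_one, map_one, one_mul] at h
    rw [← h]
    change _ = θ (m _)
    rw [hmt, map_one, one_mul]
  have hθB : ∀ β, θ (jB β) = germMap U (algebraMap C A) (b β) := by
    intro β
    have h := hθ (β ⊗ₜ 1)
    rw [hψ, map_one, mul_one] at h
    rw [← h]
    change _ = θ (m _)
    rw [hmt, map_one, mul_one]
  refine ⟨θ, hθA, hθB, fun e k hek => ?_⟩
  obtain ⟨p, hp0, hp⟩ := halg' e
  have h1 : p.eval₂ ψ (germMap U (algebraMap C A) k) = 0 := by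
    have := congrArg θ hp
    rw [map_zero, Polynomial.hom_eval₂] at this
    rw [← this, ← hek]
    congr 1
    exact RingHom.ext fun r => (hθ r).symm
  obtain ⟨β, hβ⟩ := tensor_germ_descent U b ψ hψ hp0 h1
  exact ⟨β, θ.injective (by rw [hθB, hβ, hek]), hβ⟩

end ThreeAmalgam

section ThreeAmalgamOrder

theorem exists_germ_factorization {ι : Type*} (U : Ultrafilter ι) {C A B E : Type*} [Field C]
    [Field A] [Field B] [Field E] [Algebra C A] [Algebra C B] [Algebra C E]
    (jA : A →ₐ[C] E) (jB : B →ₐ[C] E) (i₁ i₂ : E →+* Germ (U : Filter ι) C)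
    (h₁ : ∀ c, i₁ (algebraMap C E c) = gconst U C c)
    (h₂ : ∀ c, i₂ (algebraMap C E c) = gconst U C c)
    (hglue : ∀ a a', i₁ (jA a) = i₂ (jA a') → ∃ c, a = algebraMap C A c)
    (b : B →+* Germ (U : Filter ι) C)
    (θ : E →+* Germ (U : Filter ι) A) (hθA : ∀ a, θ (jA a) = gconst U A a)
    (hθd : ∀ e k, θ e = germMap U (algebraMap C A) k → ∃ β, jB β = e ∧ b β = k)
    (k : Germ (U : Filter ι) C) (e e' : E)
    (h : gconst U _ k * germMap U (i₁.comp jA) (θ e) * germMap U (i₂.comp jA) (θ e') = 1) :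
    ∃ s σ β, e = jA s * jB β ∧ e' * jB β = jA σ ∧ k * i₁ (jA s) * i₂ (jA σ) = 1 ∧ β ≠ 0 := by
  obtain ⟨u, hu⟩ := Quotient.exists_rep (θ e)
  obtain ⟨v, hv⟩ := Quotient.exists_rep (θ e')
  replace hu : θ e = (u : Germ (U : Filter ι) A) := hu.symm
  replace hv : θ e' = (v : Germ (U : Filter ι) A) := hv.symm
  rw [hu, hv, germMap_coe, germMap_coe, gconst_apply] at h
  have h1 : ∀ᶠ t in U, k * i₁ (jA (u t)) * i₂ (jA (v t)) = 1 :=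
    (germ_coe_eq U (f := fun t => k * i₁ (jA (u t)) * i₂ (jA (v t))) (g := fun _ => 1)).1 h
  obtain ⟨t₀, ht₀⟩ := h1.exists
  have hne : ∀ t, k * i₁ (jA (u t)) * i₂ (jA (v t)) = 1 → k ≠ 0 ∧ u t ≠ 0 ∧ v t ≠ 0 := by
    intro t ht
    refine ⟨?_, ?_, ?_⟩
    · rintro rfl; simp at ht
    · intro h0; simp [h0] at ht
    · intro h0; simp [h0] at ht
  obtain ⟨hk, hs, hσ⟩ := hne t₀ ht₀
  have h2 : ∀ t, k * i₁ (jA (u t)) * i₂ (jA (v t)) = 1 →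
      ∃ c, u t / u t₀ = algebraMap C A c ∧ v t₀ / v t = algebraMap C A c := by
    intro t ht
    obtain ⟨-, hut, hvt⟩ := hne t ht
    have n1 : i₁ (jA (u t₀)) ≠ 0 := by simpa using hs
    have n2 : i₂ (jA (v t)) ≠ 0 := by simpa using hvt
    have e1 : i₁ (jA (u t / u t₀)) = i₂ (jA (v t₀ / v t)) := by
      rw [map_div₀, map_div₀, map_div₀, map_div₀, div_eq_div_iff n1 n2]
      refine mul_left_cancel₀ hk ?_
      linear_combination ht - ht₀
    obtain ⟨c, hc⟩ := hglue _ _ e1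
    refine ⟨c, hc, (i₂.comp (jA : A →+* E)).injective ?_⟩
    change i₂ (jA _) = i₂ (jA _)
    rw [← e1, hc, jA.commutes, h₁, h₂]
  have h3 : ∀ t, ∃ c, k * i₁ (jA (u t)) * i₂ (jA (v t)) = 1 →
      u t / u t₀ = algebraMap C A c ∧ v t₀ / v t = algebraMap C A c := by
    intro t
    by_cases ht : k * i₁ (jA (u t)) * i₂ (jA (v t)) = 1
    · obtain ⟨c, hc⟩ := h2 t ht
      exact ⟨c, fun _ => hc⟩
    · exact ⟨0, fun h => absurd h ht⟩
  choose c hc using h3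
  have he0 : θ e' ≠ 0 := by
    intro h0
    have := (germ_coe_eq U (g := (0 : ι → A))).1 (hv.symm.trans h0)
    obtain ⟨t, ht1, ht2⟩ := (this.and h1).exists
    exact (hne t ht2).2.2 ht1
  have q1 : θ (e / jA (u t₀)) = germMap U (algebraMap C A) (c : Germ (U : Filter ι) C) := by
    rw [map_div₀, hθA, hu, germMap_coe, gconst_apply]
    exact (germ_coe_eq U (f := fun t => u t / u t₀)).2 (h1.mono fun t ht => (hc t ht).1)
  have q2 : θ (jA (v t₀) / e') = germMap U (algebraMap C A) (c : Germ (U : Filter ι) C) := by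
    rw [map_div₀, hθA, hv, germMap_coe, gconst_apply]
    exact (germ_coe_eq U (f := fun t => v t₀ / v t)).2 (h1.mono fun t ht => (hc t ht).2)
  obtain ⟨β, hβ, -⟩ := hθd _ _ q1
  have hs' : jA (u t₀) ≠ 0 := by simpa using hs
  have hσ' : jA (v t₀) ≠ 0 := by simpa using hσ
  have he' : e' ≠ 0 := fun h0 => he0 (by rw [h0, map_zero])
  have hβ2 : jB β = jA (v t₀) / e' := by rw [hβ]; exact θ.injective (q1.trans q2.symm)
  refine ⟨u t₀, v t₀, β, ?_, ?_, ht₀, ?_⟩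
  · rw [hβ]; field_simp
  · rw [hβ2]; field_simp
  · rintro rfl
    rw [map_zero] at hβ2
    exact div_ne_zero hσ' he' hβ2.symm

theorem exists_circField_three_amalgam {ι : Type*} (U : Ultrafilter ι) {C A B E : Type*} [Field C]
    [Field A] [Field B] [Field E] [IsAlgClosed A] [IsAlgClosed B] [IsAlgClosed C] [Algebra C A]
    [Algebra C B] [Algebra C E] (jA : A →ₐ[C] E) (jB : B →ₐ[C] E)
    (hinj : Function.Injective (Algebra.TensorProduct.productMap jB jA))
    (halg : ∀ e : E, IsAlgebraic (Algebra.TensorProduct.productMap jB jA).range e)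
    (i₁ i₂ : E →+* Germ (U : Filter ι) C)
    (h₁ : ∀ c, i₁ (algebraMap C E c) = gconst U C c)
    (h₂ : ∀ c, i₂ (algebraMap C E c) = gconst U C c)
    {RK : Germ (U : Filter ι) C → Germ (U : Filter ι) C → Germ (U : Filter ι) C → Prop}
    {RE : E → E → E → Prop} (hRK : IsCircField RK) (hRE : IsCircField RE)
    (hi₁ : ∀ a b c, RK (i₁ a) (i₁ b) (i₁ c) ↔ RE a b c)
    (hi₂ : ∀ a b c, RK (i₂ a) (i₂ b) (i₂ c) ↔ RE a b c)
    (hglue : ∀ a a', i₁ (jA a) = i₂ (jA a') → ∃ c, a = algebraMap C A c)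
    (hcut : ∀ a β a', RK (i₁ (jA a)) (i₁ (jB β)) (i₁ (jA a')) ↔
      RK (i₁ (jA a)) (i₂ (jB β)) (i₁ (jA a'))) :
    ∃ (R : Germ (U : Filter ι) (Germ (U : Filter ι) C) → Germ (U : Filter ι) (Germ (U : Filter ι) C) →
        Germ (U : Filter ι) (Germ (U : Filter ι) C) → Prop)
      (θ₁ θ₂ : E →+* Germ (U : Filter ι) (Germ (U : Filter ι) C)), IsCircField R ∧
      (∀ a b c, R (gconst U _ a) (gconst U _ b) (gconst U _ c) ↔ RK a b c) ∧
      (∀ a b c, R (θ₁ a) (θ₁ b) (θ₁ c) ↔ RE a b c) ∧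
      (∀ a b c, R (θ₂ a) (θ₂ b) (θ₂ c) ↔ RE a b c) ∧
      (∀ a, θ₁ (jA a) = gconst U _ (i₁ (jA a))) ∧ (∀ a, θ₂ (jA a) = gconst U _ (i₂ (jA a))) ∧
      ∀ β, θ₁ (jB β) = θ₂ (jB β) := by
  let b : B →+* Germ (U : Filter ι) C := i₁.comp jB
  have hb : ∀ c, b (algebraMap C B c) = gconst U C c := by
    intro c
    change i₁ (jB _) = _
    rw [jB.commutes, h₁]
  obtain ⟨θ, hθA, hθB, hθd⟩ := exists_germ_lift U jA jB hinj halg b hb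
  have := isAlgClosed_germ U C
  let θ₁ := (germMap U (i₁.comp (jA : A →+* E))).comp θ
  let θ₂ := (germMap U (i₂.comp (jA : A →+* E))).comp θ
  have hfac := fun k e e' => exists_germ_factorization U jA jB i₁ i₂ h₁ h₂ hglue b θ hθA hθd k e e'
  have hr := hRK.isRotation
  have hunit : ∀ (x : (Germ (U : Filter ι) C)ˣ) (y z : Eˣ), gconst U _ (x : Germ (U : Filter ι) C) *
      θ₁ y * θ₂ z = 1 → ∃ (s σ : Aˣ) (β : Bˣ),
      y = Units.map (jA : A →* E) s * Units.map (jB : B →* E) β ∧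
      z = Units.map (jA : A →* E) σ / Units.map (jB : B →* E) β ∧
      x * Units.map (i₁ : E →* Germ (U : Filter ι) C) (Units.map (jA : A →* E) s) *
        Units.map (i₂ : E →* Germ (U : Filter ι) C) (Units.map (jA : A →* E) σ) = 1 := by
    intro x y z h
    obtain ⟨s, σ, β, e1, e2, e3, hβ⟩ := hfac x y z h
    have hs : s ≠ 0 := by rintro rfl; simp at e3
    have hσ : σ ≠ 0 := by rintro rfl; simp at e3
    refine ⟨Units.mk0 s hs, Units.mk0 σ hσ, Units.mk0 β hβ, Units.ext e1, ?_, Units.ext e3⟩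
    rw [eq_div_iff_mul_eq']
    exact Units.ext (by simpa [mul_comm] using e2)
  obtain ⟨R, hR, e0, e1, e2⟩ := exists_circField_extension hRK hRE hRE
    (gconst U (Germ (U : Filter ι) C)) θ₁ θ₂
    (by
      intro x y z h
      obtain ⟨s, σ, β, rfl, rfl, hx⟩ := hunit x y z h
      set y := Units.map (jA : A →* E) s
      set z := Units.map (jA : A →* E) σ
      set w := Units.map (jB : B →* E) β
      have hrE := hRE.isRotation
      have t1 := congrArg (fun g => hr.toCircle (Additive.ofMul g)) hx
      have t2 : hrE.toCircle (Additive.ofMul (y * w)) + hrE.toCircle (Additive.ofMul (z / w)) =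
          hrE.toCircle (Additive.ofMul y) + hrE.toCircle (Additive.ofMul z) := by
        rw [ofMul_mul, ofMul_div, map_add, map_sub]; abel
      simp only [ofMul_mul, map_add, ofMul_one, map_zero] at t1
      have t3 : ∀ g : Eˣ, hr.toCircle (Additive.ofMul (Units.map (i₁ : E →* Germ (U : Filter ι) C) g)) =
          hrE.toCircle (Additive.ofMul g) := fun g =>
        congrArg (fun x : ℝ => (x : AddCircle (1 : ℝ))) (frot_map i₁ hi₁ g)
      have t4 : ∀ g : Eˣ, hr.toCircle (Additive.ofMul (Units.map (i₂ : E →* Germ (U : Filter ι) C) g)) =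
          hrE.toCircle (Additive.ofMul g) := fun g =>
        congrArg (fun x : ℝ => (x : AddCircle (1 : ℝ))) (frot_map i₂ hi₂ g)
      rw [t3, t4, add_assoc, ← t2] at t1
      have t5 : ((frot RK x + frot RE (y * w) + frot RE (z / w) : ℝ) : AddCircle (1 : ℝ)) =
          (0 : ℝ) := by
        rw [AddCircle.coe_add, AddCircle.coe_add, add_assoc, AddCircle.coe_zero]
        exact t1
      obtain ⟨k, hk⟩ := AddCircle_coe_eq_coe_iff.1 t5
      exact ⟨k, by rw [hk, zero_add]⟩)
    (by
      intro x y z h hx0 hy0 hz0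
      obtain ⟨s, σ, β, rfl, rfl, hx⟩ := hunit x y z h
      rw [← frot_map i₁ hi₁, map_mul] at hy0
      rw [← frot_map i₂ hi₂, map_div] at hz0
      set S := Units.map (i₁ : E →* Germ (U : Filter ι) C) (Units.map (jA : A →* E) s) with hS
      set X := Units.map (i₁ : E →* Germ (U : Filter ι) C) (Units.map (jB : B →* E) β) with hX
      set W := Units.map (i₂ : E →* Germ (U : Filter ι) C) (Units.map (jA : A →* E) σ) with hW
      set Y := Units.map (i₂ : E →* Germ (U : Filter ι) C) (Units.map (jB : B →* E) β) with hY
      have hxe : x = S⁻¹ / W := by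
        rw [eq_div_iff_mul_eq', eq_inv_iff_mul_eq_one, ← hx]
        exact mul_right_comm _ _ _
      have hXS : frot RK (X / S⁻¹) = 0 := by rwa [div_inv_eq_mul, mul_comm]
      by_cases hXz : X = S⁻¹
      · have f1 : Units.map (jA : A →* E) s * Units.map (jB : B →* E) β = 1 := by
          refine Units.map_injective (f := (i₁ : E →* Germ (U : Filter ι) C)) i₁.injective ?_
          rw [map_mul, ← hS, ← hX, hXz, mul_inv_cancel, map_one]
        have f2 : jB β = jA (s⁻¹ : Aˣ) := by
          have : Units.map (jB : B →* E) β = Units.map (jA : A →* E) s⁻¹ := by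
            rw [map_inv, eq_inv_iff_mul_eq_one, mul_comm, f1]
          exact congrArg Units.val this
        have f3 : ∃ c, ((s⁻¹ : Aˣ) : A) = algebraMap C A c := by
          have h4 := hθB β
          rw [f2, hθA] at h4
          obtain ⟨k, hk⟩ := Quotient.exists_rep (b β)
          rw [← hk] at h4
          obtain ⟨t, ht⟩ := ((germ_coe_eq U (f := fun _ => ((s⁻¹ : Aˣ) : A))
            (g := fun t => algebraMap C A (k t))).1 h4).exists
          exact ⟨k t, ht⟩
        obtain ⟨c, hc⟩ := f3
        have hYS : Y = S⁻¹ := by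
          rw [← hXz]
          refine Units.ext ?_
          change i₂ (jB β) = i₁ (jB β)
          rw [f2, hc, jA.commutes, h₁, h₂]
        rw [hYS] at hz0
        rw [hxe] at hx0
        have hxe' : x = 1 := by
          rw [hxe]
          exact hr.eq_one_of_mul_eq_one hx0 hz0 (by rw [div_mul_div_cancel, div_self'])
        refine ⟨hxe', f1, ?_⟩
        refine Units.map_injective (f := (i₂ : E →* Germ (U : Filter ι) C)) i₂.injective ?_
        rw [map_div, ← hW, ← hY, hYS, map_one, div_eq_one]
        rw [hxe, div_eq_one] at hxe'
        exact hxe'.symm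
      · exfalso
        obtain ⟨c, hc0, hc1⟩ := exists_unit_rotation_generic hr (gconst U C) S⁻¹
        refine hr.not_rotRel_of_cone hXS hz0 (hxe ▸ hx0) hc0 hc1 hXz ?_
        have e1 : (S⁻¹ : (Germ (U : Filter ι) C)ˣ) = i₁ (jA (s⁻¹ : Aˣ)) := by
          rw [hS, ← map_inv, ← map_inv]; rfl
        have e2 : ((Units.map (gconst U C : C →* Germ (U : Filter ι) C) c : (Germ (U : Filter ι) C)ˣ) :
            Germ (U : Filter ι) C) = i₁ (jA (algebraMap C A c)) := by
          rw [jA.commutes, h₁]; rfl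
        rw [hRK.rotRel_iff, hRK.rotRel_iff, e1, e2]
        exact (hcut _ _ _).1)
  exact ⟨R, θ₁, θ₂, hR, e0, e1, e2, fun a => by change germMap U _ (θ _) = _; rw [hθA]; rfl,
    fun a => by change germMap U _ (θ _) = _; rw [hθA]; rfl, fun β => by
      change germMap U _ (θ _) = germMap U _ (θ _)
      rw [hθB]
      induction b β using Germ.inductionOn with | _ k => ?_
      rw [germMap_coe, germMap_coe, germMap_coe]
      refine congrArg Germ.ofFun (funext fun t => ?_)
      change i₁ (jA _) = i₂ (jA _)
      rw [jA.commutes, h₁, h₂]⟩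

end ThreeAmalgamOrder

section Structures

/-- The structure of the language of circularly ordered fields given by a field and a ternary
relation. -/
@[reducible] def ltOf (K : Type*) [Field K] (R : K → K → K → Prop) : Lt.Structure K where
  funMap {n} f w :=
    match n, f, w with
    | 0, f, _ => cond (show Bool from f) 1 0
    | 1, f, w => cond (show Bool from f) (w 0)⁻¹ (- w 0)
    | 2, f, w => cond (show Bool from f) (w 0 * w 1) (w 0 + w 1)
    | _ + 3, f, _ => (show PEmpty from f).elim
  RelMap {n} r w := R (w ⟨0, by have := r.down; omega⟩) (w ⟨1, by have := r.down; omega⟩)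
    (w ⟨2, by have := r.down; omega⟩)

theorem ltCompat_ltOf (K : Type*) [Field K] (R : K → K → K → Prop) :
    @LtCompat K (ltOf K R) _ := by
  refine ⟨rfl, rfl, fun _ => rfl, fun _ => rfl, fun _ _ => rfl, fun _ _ => rfl⟩

theorem eq_ltOf (K : Type*) [Field K] [S : Lt.Structure K] (h : LtCompat K) :
    S = ltOf K (circRel K) := by
  obtain ⟨h0, h1, h2, h3, h4, h5⟩ := h
  refine Structure.ext ?_ ?_
  · funext n f w
    match n, f, w with
    | 0, false, w => rw [Subsingleton.elim w (![] : Fin 0 → K)]; exact h0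
    | 0, true, w => rw [Subsingleton.elim w (![] : Fin 0 → K)]; exact h1
    | 1, false, w =>
      rw [show w = ![w 0] by funext i; fin_cases i; rfl]; exact h2 (w 0)
    | 1, true, w =>
      rw [show w = ![w 0] by funext i; fin_cases i; rfl]; exact h3 (w 0)
    | 2, false, w =>
      rw [show w = ![w 0, w 1] by funext i; fin_cases i <;> rfl]; exact h4 (w 0) (w 1)
    | 2, true, w =>
      rw [show w = ![w 0, w 1] by funext i; fin_cases i <;> rfl]; exact h5 (w 0) (w 1)
    | _ + 3, f, _ => exact (show PEmpty from f).elim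
  · funext n r w
    obtain ⟨rfl⟩ := r
    refine congrArg (Structure.RelMap circSym) ?_
    funext i
    fin_cases i <;> rfl

theorem IsACFOminusWith.isCircField {K : Type*} [Field K] [Lt.Structure K]
    (h : IsACFOminusWith K) : IsCircField (circRel K) := by
  obtain ⟨-, -, h1, h2, h3, h4, h5, h6⟩ := h
  exact ⟨h1, h2, h3, h4, h5, h6⟩

theorem IsCircField.isACFOminus {K : Type*} [Field K] [IsAlgClosed K] {R : K → K → K → Prop}
    (h : IsCircField R) : IsACFOminus K (ltOf K R) :=
  ⟨inferInstance, ltCompat_ltOf K R, inferInstance, h.ne_zero, h.cyc, h.asymm, h.trans, h.total,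
    h.mul⟩

/-- A ring homomorphism preserving the ternary relations is an embedding of structures. -/
def ltEmbedding {K N : Type*} [Field K] [Field N] {R : K → K → K → Prop} {S : N → N → N → Prop}
    (f : K →+* N) (hf : ∀ a b c, S (f a) (f b) (f c) ↔ R a b c) :
    @Language.Embedding Lt K N (ltOf K R) (ltOf N S) :=
  letI := ltOf K R
  letI := ltOf N S
  { toFun := f
    inj' := f.injective
    map_fun' := by
      intro n g w
      match n, g, w with
      | 0, false, w => exact map_zero f
      | 0, true, w => exact map_one f
      | 1, false, w => exact map_neg f _
      | 1, true, w => exact map_inv₀ f _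
      | 2, false, w => exact map_add f _ _
      | 2, true, w => exact map_mul f _ _
      | _ + 3, g, _ => exact (show PEmpty from g).elim
    map_rel' := by
      intro n r w
      obtain ⟨rfl⟩ := r
      exact hf _ _ _ }

/-- Realization of a formula in a field with a ternary relation. -/
def RealizeIn {K : Type*} [Field K] (R : K → K → K → Prop) {α : Type*} (φ : Lt.Formula α)
    (v : α → K) : Prop :=
  letI := ltOf K R
  φ.Realize v

theorem germ_structure_eq {ι : Type*} (U : Ultrafilter ι) {K : Type*} [Field K]
    (R : K → K → K → Prop) :
    ltOf (Germ (U : Filter ι) K) (germRel U R) =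
      @Ultraproduct.structure ι (fun _ => K) U Lt (fun _ => ltOf K R) := by
  let _ := ltOf K R
  refine Structure.ext ?_ ?_
  · funext n f w
    choose v hv using fun i => Quotient.exists_rep (w i)
    obtain rfl : (fun i => Quotient.mk _ (v i)) = w := funext hv
    refine Eq.trans ?_ (Ultraproduct.funMap_cast (M := fun _ => K) (u := U) f v).symm
    match n, f, v with
    | 0, false, w => rfl
    | 0, true, w => rfl
    | 1, false, w => rfl
    | 1, true, w => rfl
    | 2, false, w => rfl
    | 2, true, w => rfl
    | _ + 3, g, _ => exact (show PEmpty from g).elim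
  · funext n r w
    choose v hv using fun i => Quotient.exists_rep (w i)
    obtain rfl : (fun i => Quotient.mk _ (v i)) = w := funext hv
    obtain ⟨rfl⟩ := r
    refine propext ((germRel_coe U).trans ?_)
    exact (relMap_quotient_mk' (L := Lt) (s := (U : Filter ι).productSetoid fun _ => K) circSym v).symm

/-- Los's theorem for ultrapowers of circularly ordered fields. -/
theorem realizeIn_germ {ι : Type*} (U : Ultrafilter ι) {K : Type*} [Field K]
    (R : K → K → K → Prop) {α : Type*} (φ : Lt.Formula α) (v : α → ι → K) :
    RealizeIn (germRel U R) φ (fun i => (v i : Germ (U : Filter ι) K)) ↔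
      ∀ᶠ t in U, RealizeIn R φ fun i => v i t := by
  let _ := ltOf K R
  unfold RealizeIn
  rw [germ_structure_eq]
  exact Ultraproduct.realize_formula_cast (M := fun _ => K) (u := U) φ v

theorem model_germ {ι : Type*} (U : Ultrafilter ι) {K : Type*} [Field K]
    (R : K → K → K → Prop) (T : Lt.Theory) (h : @Theory.Model Lt K (ltOf K R) T) :
    @Theory.Model Lt (Germ (U : Filter ι) K) (ltOf _ (germRel U R)) T := by
  let _ := ltOf K R
  rw [germ_structure_eq]
  refine @Theory.Model.mk _ _ (_) _ fun φ hφ => ?_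
  exact (Ultraproduct.sentence_realize (M := fun _ => K) (u := U) φ).2
    (Eventually.of_forall fun _ => h.realize_of_mem φ hφ)


end Structures

section Transfer

/-- The formula `∃ x, φ(x, y) ∧ φ(x, y')`. -/
noncomputable def commonSol {n m : ℕ} (φ : Lt.Formula (Fin n ⊕ Fin m)) :
    Lt.Formula (Fin m ⊕ Fin m) :=
  Formula.iExs (α := Fin m ⊕ Fin m) (Fin n)
    (φ.relabel (Sum.elim Sum.inr (Sum.inl ∘ Sum.inl)) ⊓
      φ.relabel (Sum.elim Sum.inr (Sum.inl ∘ Sum.inr)))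

theorem realize_commonSol {N : Type*} [Lt.Structure N] {n m : ℕ} (φ : Lt.Formula (Fin n ⊕ Fin m))
    (v : Fin m ⊕ Fin m → N) : (commonSol φ).Realize v ↔
      ∃ x : Fin n → N, φ.Realize (Sum.elim x (v ∘ Sum.inl)) ∧ φ.Realize (Sum.elim x (v ∘ Sum.inr)) := by
  rw [commonSol, Formula.realize_iExs]
  simp only [Formula.realize_inf, Formula.realize_relabel]
  refine exists_congr fun x => and_congr ?_ ?_ <;>
  · apply iff_of_eq
    congr 1
    funext i
    cases i <;> rfl

theorem IsModelComplete.realize_embedding {TA : Lt.Theory} (hTA : IsModelComplete.{u} TA)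
    {K N : Type u} [Lt.Structure K] [Lt.Structure N] (hK : K ⊨ TA) (hN : N ⊨ TA)
    (f : K ↪[Lt] N) {n m : ℕ} (φ : Lt.Formula (Fin n ⊕ Fin m)) (v : Fin n ⊕ Fin m → K) :
    φ.Realize (f ∘ v) ↔ φ.Realize v := by
  have := hTA K N hK hN f (n + m) (φ.relabel finSumFinEquiv) (v ∘ finSumFinEquiv.symm)
  rw [Formula.realize_relabel, Formula.realize_relabel] at this
  simpa [Function.comp_def] using this

/-- If three copies of a model can be put together over a common circularly ordered field in such a
way that two realizations get identified, then the two instances of the formula are consistent. -/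
theorem exists_common_realization {TA : Lt.Theory}
    (hTA : IsModelCompanionOfClass.{u} TA (fun F SF => IsACFOminus F SF))
    {E K K₂ : Type u} [Field E] [IsAlgClosed E] [Field K] [IsAlgClosed K] [Field K₂]
    {RE : E → E → E → Prop} {RK : K → K → K → Prop} {R₂ : K₂ → K₂ → K₂ → Prop}
    (hRE : IsCircField RE) (hRK : IsCircField RK) (hR₂ : IsCircField R₂)
    (hmod : @Theory.Model Lt K (ltOf K RK) TA)
    (c : K →+* K₂) (hc : ∀ x y z, R₂ (c x) (c y) (c z) ↔ RK x y z)
    (i₁ i₂ : E →+* K) (hi₁ : ∀ x y z, RK (i₁ x) (i₁ y) (i₁ z) ↔ RE x y z)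
    (hi₂ : ∀ x y z, RK (i₂ x) (i₂ y) (i₂ z) ↔ RE x y z)
    (θ₁ θ₂ : E →+* K₂) (hθ₁ : ∀ x y z, R₂ (θ₁ x) (θ₁ y) (θ₁ z) ↔ RE x y z)
    (hθ₂ : ∀ x y z, R₂ (θ₂ x) (θ₂ y) (θ₂ z) ↔ RE x y z)
    {n m : ℕ} (φ : Lt.Formula (Fin n ⊕ Fin m)) (x : Fin n → E) (y : Fin m → E)
    (hy₁ : ∀ k, θ₁ (y k) = c (i₁ (y k))) (hy₂ : ∀ k, θ₂ (y k) = c (i₂ (y k)))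
    (hx : ∀ j, θ₁ (x j) = θ₂ (x j))
    (h₁ : RealizeIn RK φ (Sum.elim (i₁ ∘ x) (i₁ ∘ y)))
    (h₂ : RealizeIn RK φ (Sum.elim (i₂ ∘ x) (i₂ ∘ y))) :
    ∃ z : Fin n → K, RealizeIn RK φ (Sum.elim z (i₁ ∘ y)) ∧
      RealizeIn RK φ (Sum.elim z (i₂ ∘ y)) := by
  obtain ⟨Ω₁, _, _, S₁, g₁, f₁, hS₁, hg₁, hf₁, hgf₁⟩ :=
    exists_circField_amalgam hRE hRK hR₂ i₁ θ₁ hi₁ hθ₁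
  obtain ⟨Ω₂, _, _, S₂, g₂, f₂, hS₂, hg₂, hf₂, hgf₂⟩ :=
    exists_circField_amalgam hRE hRK hS₁ i₂ (f₁.comp θ₂) hi₂ (fun a b d => by
      simp [hf₁, hθ₂])
  obtain ⟨N, SN, hN, ⟨e⟩⟩ := hTA.2.1 Ω₂ (ltOf Ω₂ S₂) hS₂.isACFOminus
  let _ := ltOf K RK
  let _ := ltOf Ω₂ S₂
  let κ₀ : K ↪[Lt] N := e.comp (ltEmbedding (f₂.comp (f₁.comp c)) (fun a b d => by
    simp [hf₁, hf₂, hc]))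
  let κ₁ : K ↪[Lt] N := e.comp (ltEmbedding (f₂.comp g₁) (fun a b d => by simp [hf₂, hg₁]))
  let κ₂ : K ↪[Lt] N := e.comp (ltEmbedding g₂ hg₂)
  have e₁ : ∀ z, κ₁ (i₁ z) = e (f₂ (f₁ (θ₁ z))) := fun z => congrArg (fun t => e (f₂ t)) (hgf₁ z)
  have e₂ : ∀ z, κ₂ (i₂ z) = e (f₂ (f₁ (θ₂ z))) := fun z => congrArg (fun t => e t) (hgf₂ z)
  have e₀ : ∀ z, κ₀ z = e (f₂ (f₁ (c z))) := fun z => rfl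
  have key := (hTA.1.realize_embedding hmod hN κ₀ (commonSol φ)
    (Sum.elim (i₁ ∘ y) (i₂ ∘ y))).1 ?_
  · exact (realize_commonSol φ _).1 key
  refine (realize_commonSol φ _).2 ⟨fun j => κ₁ (i₁ (x j)), ?_, ?_⟩
  · have := (hTA.1.realize_embedding hmod hN κ₁ φ _).2 h₁
    convert this using 1
    funext k
    rcases k with k | k
    · rfl
    · exact (e₀ _).trans ((congrArg (fun t => e (f₂ (f₁ t))) (hy₁ k).symm).trans (e₁ _).symm)
  · have := (hTA.1.realize_embedding hmod hN κ₂ φ _).2 h₂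
    convert this using 1
    funext k
    rcases k with k | k
    · exact (e₁ _).trans ((congrArg (fun t => e (f₂ (f₁ t))) (hx k)).trans (e₂ _).symm)
    · exact (e₀ _).trans ((congrArg (fun t => e (f₂ (f₁ t))) (hy₂ k).symm).trans (e₂ _).symm)

end Transfer

section Acl

variable {C L : Type*} [Field C] [Field L] [Algebra C L]

/-- The relative algebraic closure of the subfield generated by a set. -/
noncomputable def aclOf (C : Type*) {L : Type*} [Field C] [Field L] [Algebra C L] (X : Set L) :
    IntermediateField C L :=
  (algebraicClosure (IntermediateField.adjoin C X) L).restrictScalars C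

theorem mem_aclOf {X : Set L} {z : L} :
    z ∈ aclOf C X ↔ IsAlgebraic (IntermediateField.adjoin C X) z := by
  rw [aclOf, IntermediateField.mem_restrictScalars, mem_algebraicClosure_iff]

theorem subset_aclOf (X : Set L) : X ⊆ aclOf C X := fun z hz =>
  mem_aclOf.2 (isAlgebraic_algebraMap
    (⟨z, IntermediateField.subset_adjoin C X hz⟩ : IntermediateField.adjoin C X))

theorem isAlgClosed_algebraicClosure (F L : Type*) [Field F] [Field L] [Algebra F L]
    [IsAlgClosed L] : IsAlgClosed (algebraicClosure F L) :=
  IsAlgClosure.isAlgClosed F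

theorem isAlgClosed_aclOf [IsAlgClosed L] (X : Set L) : IsAlgClosed (aclOf C X) :=
  isAlgClosed_algebraicClosure (IntermediateField.adjoin C X) L

theorem aclOf_le {X : Set L} {M : IntermediateField C L} (hM : IsAlgClosed M) (h : X ⊆ M) :
    aclOf C X ≤ M := by
  intro z hz
  have hle : IntermediateField.adjoin C X ≤ M := IntermediateField.adjoin_le_iff.2 h
  obtain ⟨p, hp, hpz⟩ := mem_aclOf.1 hz
  obtain ⟨x, hx⟩ := mem_range_of_eval₂_eq_zero (algebraMap M L)
    (p := p.map (IntermediateField.inclusion hle : _ →+* M)) (z := z)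
    ((Polynomial.map_ne_zero_iff (RingHom.injective _)).2 hp) (by
      rw [Polynomial.eval₂_map]
      exact hpz)
  rw [← hx]
  exact x.2

open scoped IntermediateField.algebraAdjoinAdjoin in
theorem isAlgebraic_adjoin_of_mem_aclOf {X : Set L} {z : L} (hz : z ∈ aclOf C X) :
    IsAlgebraic (Algebra.adjoin C X) z := by
  exact (IsFractionRing.isAlgebraic_iff (Algebra.adjoin C X) (IntermediateField.adjoin C X) L).2
    (mem_aclOf.1 hz)

/-- Algebraicity over a subalgebra can be tested after an injective map. -/
theorem isAlgebraic_of_map {E : Type*} [Field E] [Algebra C E] (f : E →ₐ[C] L)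
    (T : Subalgebra C E) {S : Subalgebra C L} (hS : S ≤ T.map f) {e : E}
    (he : IsAlgebraic S (f e)) : IsAlgebraic T e := by
  obtain ⟨p, hp, hpz⟩ := he
  let g : T →+* L := (f : E →+* L).comp (algebraMap T E)
  have hg : Function.Injective g := f.injective.comp Subtype.val_injective
  have hlift : p.map (algebraMap S L) ∈ Polynomial.lifts g := by
    rw [Polynomial.lifts_iff_coeff_lifts]
    intro k
    obtain ⟨t, ht, htk⟩ := hS (p.coeff k).2
    exact ⟨⟨t, ht⟩, by rw [Polynomial.coeff_map]; exact htk⟩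
  obtain ⟨q, hq⟩ := (Polynomial.mem_lifts _).1 hlift
  refine ⟨q, ?_, ?_⟩
  · rintro rfl
    rw [Polynomial.map_zero, eq_comm, Polynomial.map_eq_zero_iff Subtype.val_injective] at hq
    exact hp hq
  · have h1 : (q.map g).eval (f e) = 0 := by
      rw [hq, Polynomial.eval_map]; exact hpz
    rw [Polynomial.eval_map] at h1
    apply f.injective
    rw [map_zero, ← h1, Polynomial.aeval_def]
    exact Polynomial.hom_eval₂ q (algebraMap T E) (f : E →+* L) e

end Acl

section Pull

variable {ι κ : Type*} {U : Ultrafilter ι} {V : Ultrafilter κ}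

/-- The map of ultrapowers induced by a map of index sets. -/
def germPull (C : Type*) [CommRing C] (π : ι → κ) (h : Tendsto π U V) :
    Germ (V : Filter κ) C →+* Germ (U : Filter ι) C where
  toFun x := x.compTendsto π h
  map_zero' := rfl
  map_one' := rfl
  map_add' x y := Germ.inductionOn₂ x y fun _ _ => rfl
  map_mul' x y := Germ.inductionOn₂ x y fun _ _ => rfl

theorem germPull_coe {C : Type*} [CommRing C] (π : ι → κ) (h : Tendsto π U V) (f : κ → C) :
    germPull C π h (f : Germ (V : Filter κ) C) = ((f ∘ π : ι → C) : Germ (U : Filter ι) C) := rfl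

theorem germPull_gconst {C : Type*} [CommRing C] (π : ι → κ) (h : Tendsto π U V) (c : C) :
    germPull C π h (gconst V C c) = gconst U C c := rfl

theorem germRel_germPull {C : Type*} [CommRing C] (R : C → C → C → Prop) (π : ι → κ)
    (h : Tendsto π U V) (x y z : Germ (V : Filter κ) C) :
    germRel U R (germPull C π h x) (germPull C π h y) (germPull C π h z) ↔ germRel V R x y z := by
  have hV : V = U.map π := (Ultrafilter.coe_le_coe.1 (show (U.map π : Filter κ) ≤ V from h)).symm
  subst hV
  refine Germ.inductionOn₃ x y z fun f g k => ?_
  rw [germPull_coe, germPull_coe, germPull_coe, germRel_coe, germRel_coe]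
  rfl

end Pull

section Abstract

theorem exists_acl_field {C L : Type u} [Field C] [Field L] [Algebra C L] [IsAlgClosed L]
    (X : Set L) : ∃ (A : Type u) (_ : Field A) (_ : Algebra C A) (f : A →ₐ[C] L),
      IsAlgClosed A ∧ ∀ z, z ∈ aclOf C X ↔ ∃ a, f a = z :=
  ⟨aclOf C X, inferInstance, inferInstance, (aclOf C X).val, isAlgClosed_aclOf X,
    fun z => ⟨fun h => ⟨⟨z, h⟩, rfl⟩, by rintro ⟨a, rfl⟩; exact a.2⟩⟩

theorem exists_algHom_factor {C A E L : Type*} [Field C] [Field A] [Field E] [Field L]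
    [Algebra C A] [Algebra C E] [Algebra C L] (f : A →ₐ[C] L) (g : E →ₐ[C] L)
    (h : ∀ a, ∃ e, g e = f a) : ∃ j : A →ₐ[C] E, ∀ a, g (j a) = f a := by
  choose j hj using h
  refine ⟨{
    toFun := j
    map_one' := ?_
    map_mul' := ?_
    map_zero' := ?_
    map_add' := ?_
    commutes' := ?_ }, hj⟩
  all_goals intros; apply g.injective
  all_goals simp [hj]

theorem productMap_injective_acl {C L A B E : Type u} [Field C] [Field L] [Algebra C L]
    [Field A] [Field B] [Field E] [Algebra C A] [Algebra C B] [Algebra C E]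
    {ι : Type*} (U : Ultrafilter ι) (ev : L →+* Germ (U : Filter ι) C)
    (hev : ∀ c, ev (algebraMap C L c) = gconst U C c) {n m : ℕ} (x : Fin n → L) (y : Fin m → L)
    (hld : ∀ (J : Type u) (s : Finset J) (g : J → MvPolynomial (Fin m) C) (β : J → L),
      (∀ l, β l ∈ aclOf C (Set.range x)) →
      LinearIndependent C (fun l => MvPolynomial.aeval y (g l)) →
      ∑ l ∈ s, β l * MvPolynomial.aeval y (g l) = 0 → ∀ l ∈ s, β l = 0)
    (fA : A →ₐ[C] L) (fB : B →ₐ[C] L) (fE : E →ₐ[C] L)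
    (hA : ∀ z, z ∈ aclOf C (Set.range y) ↔ ∃ a, fA a = z)
    (hB : ∀ z, z ∈ aclOf C (Set.range x) ↔ ∃ a, fB a = z)
    (jA : A →ₐ[C] E) (jB : B →ₐ[C] E) (hjA : ∀ a, fE (jA a) = fA a)
    (hjB : ∀ a, fE (jB a) = fB a) :
    Function.Injective (Algebra.TensorProduct.productMap jB jA) := by
  have := isDomain_tensor_of_germ (A := A) U (ev.comp (fB : B →+* L)) (fun c => by simp [hev])
  refine productMap_injective_of_algebraic _ _ ((Algebra.adjoin C (Set.range y)).comap fA) ?_ ?_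
  · intro a
    refine isAlgebraic_of_map fA _ ?_ (isAlgebraic_adjoin_of_mem_aclOf ((hA _).2 ⟨a, rfl⟩))
    refine Algebra.adjoin_le ?_
    rintro _ ⟨k, rfl⟩
    obtain ⟨a, ha⟩ := (hA (y k)).1 (subset_aclOf _ ⟨k, rfl⟩)
    refine ⟨a, ?_, ha⟩
    change fA a ∈ Algebra.adjoin C (Set.range y)
    rw [ha]
    exact Algebra.subset_adjoin ⟨k, rfl⟩
  · intro J s v hv hli β hsum l hl
    have hv' : ∀ l, ∃ g : MvPolynomial (Fin m) C, MvPolynomial.aeval y g = fA (v l) := by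
      intro l
      have := hv l
      rw [Subalgebra.mem_comap, Algebra.adjoin_range_eq_range_aeval] at this
      exact this
    choose g hg using hv'
    refine (map_eq_zero fB).1
      (hld J s g (fun l => fB (β l)) (fun l => (hB _).2 ⟨_, rfl⟩) ?_ ?_ l hl)
    · simp only [hg]
      exact hli.map' fA.toLinearMap (LinearMap.ker_eq_bot.2 fA.injective)
    · have := congrArg fE hsum
      rw [map_sum, map_zero] at this
      simp only [hg]
      simpa only [map_mul, hjA, hjB] using this

theorem isAlgebraic_productMap_range {C L A B E : Type u} [Field C] [Field L] [Algebra C L]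
    [Field A] [Field B] [Field E] [Algebra C A] [Algebra C B] [Algebra C E]
    {n m : ℕ} (x : Fin n → L) (y : Fin m → L)
    (fA : A →ₐ[C] L) (fB : B →ₐ[C] L) (fE : E →ₐ[C] L)
    (hA : ∀ z, z ∈ aclOf C (Set.range y) ↔ ∃ a, fA a = z)
    (hB : ∀ z, z ∈ aclOf C (Set.range x) ↔ ∃ a, fB a = z)
    (hE : ∀ z, z ∈ aclOf C (Set.range x ∪ Set.range y) ↔ ∃ a, fE a = z)
    (jA : A →ₐ[C] E) (jB : B →ₐ[C] E) (hjA : ∀ a, fE (jA a) = fA a)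
    (hjB : ∀ a, fE (jB a) = fB a) (e : E) :
    IsAlgebraic (Algebra.TensorProduct.productMap jB jA).range e := by
  refine isAlgebraic_of_map fE _ ?_ (isAlgebraic_adjoin_of_mem_aclOf ((hE _).2 ⟨e, rfl⟩))
  refine Algebra.adjoin_le ?_
  rintro _ (⟨k, rfl⟩ | ⟨k, rfl⟩)
  · obtain ⟨b, hb⟩ := (hB (x k)).1 (subset_aclOf _ ⟨k, rfl⟩)
    refine ⟨_, ⟨b ⊗ₜ 1, rfl⟩, ?_⟩
    change fE (Algebra.TensorProduct.productMap _ _ (_ ⊗ₜ 1)) = _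
    rw [Algebra.TensorProduct.productMap_apply_tmul, map_one, mul_one, hjB, hb]
  · obtain ⟨a, ha⟩ := (hA (y k)).1 (subset_aclOf _ ⟨k, rfl⟩)
    refine ⟨_, ⟨1 ⊗ₜ a, rfl⟩, ?_⟩
    change fE (Algebra.TensorProduct.productMap _ _ (1 ⊗ₜ _)) = _
    rw [Algebra.TensorProduct.productMap_apply_tmul, map_one, one_mul, hjA, ha]

theorem IsCircField.comap {E L : Type*} [Field E] [Field L] {R : L → L → L → Prop}
    (hR : IsCircField R) (f : E →+* L) : IsCircField (fun a b c : E => R (f a) (f b) (f c)) where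
  ne_zero a b c h := by simpa using hR.ne_zero _ _ _ h
  cyc a b c h := hR.cyc _ _ _ h
  asymm a b c h := hR.asymm _ _ _ h
  trans a b c d h h' := hR.trans _ _ _ _ h h'
  total a b c h1 h2 h3 h4 h5 h6 := hR.total _ _ _ (by simpa using h1) (by simpa using h2)
    (by simpa using h3) (f.injective.ne h4) (f.injective.ne h5) (f.injective.ne h6)
  mul a b c d hd h := by
    simpa only [map_mul] using hR.mul _ _ _ (f d) (by simpa using hd) h

theorem exists_solution_of_amalgam {TA : Lt.Theory}
    (hTA : IsModelCompanionOfClass.{u} TA (fun F SF => IsACFOminus F SF))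
    {C A B E ι : Type u} (U : Ultrafilter ι) [Field C]
    [Field A] [Field B] [Field E] [IsAlgClosed A] [IsAlgClosed B] [IsAlgClosed C] [IsAlgClosed E]
    [Algebra C A] [Algebra C B] [Algebra C E] (jA : A →ₐ[C] E) (jB : B →ₐ[C] E)
    (hinj : Function.Injective (Algebra.TensorProduct.productMap jB jA))
    (halg : ∀ e : E, IsAlgebraic (Algebra.TensorProduct.productMap jB jA).range e)
    (i₁ i₂ : E →+* Germ (U : Filter ι) C)
    (h₁ : ∀ c, i₁ (algebraMap C E c) = gconst U C c)
    (h₂ : ∀ c, i₂ (algebraMap C E c) = gconst U C c)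
    {RC : C → C → C → Prop} (hRC : IsCircField RC) (hmod : @Theory.Model Lt C (ltOf C RC) TA)
    {RE : E → E → E → Prop} (hRE : IsCircField RE)
    (hi₁ : ∀ a b c, germRel U RC (i₁ a) (i₁ b) (i₁ c) ↔ RE a b c)
    (hi₂ : ∀ a b c, germRel U RC (i₂ a) (i₂ b) (i₂ c) ↔ RE a b c)
    (hglue : ∀ a a', i₁ (jA a) = i₂ (jA a') → ∃ c, a = algebraMap C A c)
    (hcut : ∀ a β a', germRel U RC (i₁ (jA a)) (i₁ (jB β)) (i₁ (jA a')) ↔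
      germRel U RC (i₁ (jA a)) (i₂ (jB β)) (i₁ (jA a')))
    {n m : ℕ} (x : Fin n → B) (y : Fin m → A) (φ : Lt.Formula (Fin n ⊕ Fin m))
    (hφ₁ : RealizeIn (germRel U RC) φ
      (Sum.elim (fun j => i₁ (jB (x j))) (fun k => i₁ (jA (y k)))))
    (hφ₂ : RealizeIn (germRel U RC) φ
      (Sum.elim (fun j => i₂ (jB (x j))) (fun k => i₂ (jA (y k))))) :
    ∃ z : Fin n → Germ (U : Filter ι) C,
      RealizeIn (germRel U RC) φ (Sum.elim z (fun k => i₁ (jA (y k)))) ∧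
      RealizeIn (germRel U RC) φ (Sum.elim z (fun k => i₂ (jA (y k)))) := by
  have cK := isAlgClosed_germ U C
  obtain ⟨R, θ₁, θ₂, hR, hc, hθ₁, hθ₂, hA₁, hA₂, hBB⟩ :=
    exists_circField_three_amalgam U jA jB hinj halg i₁ i₂ h₁ h₂ (hRC.germ U) hRE hi₁ hi₂ hglue hcut
  exact exists_common_realization hTA hRE (hRC.germ U) hR (model_germ U RC TA hmod)
    (gconst U _) hc i₁ i₂ hi₁ hi₂ θ₁ θ₂ hθ₁ hθ₂ φ (fun j => jB (x j)) (fun k => jA (y k))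
    (fun k => hA₁ _) (fun k => hA₂ _) (fun j => hBB _) hφ₁ hφ₂

theorem exists_solution_of_independent {TA : Lt.Theory}
    (hTA : IsModelCompanionOfClass.{u} TA (fun F SF => IsACFOminus F SF))
    {C L ι : Type u} [Field C] [Field L] [IsAlgClosed C] [IsAlgClosed L] [Algebra C L]
    (U : Ultrafilter ι) {RC : C → C → C → Prop} (hRC : IsCircField RC)
    (hmod : @Theory.Model Lt C (ltOf C RC) TA)
    {RL : L → L → L → Prop} (hRL : IsCircField RL) (ev ev' : L →+* Germ (U : Filter ι) C)
    (hev : ∀ c, ev (algebraMap C L c) = gconst U C c)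
    (hev' : ∀ c, ev' (algebraMap C L c) = gconst U C c)
    (hevR : ∀ a b c, germRel U RC (ev a) (ev b) (ev c) ↔ RL a b c)
    (hevR' : ∀ a b c, germRel U RC (ev' a) (ev' b) (ev' c) ↔ RL a b c)
    {n m : ℕ} (x : Fin n → L) (y : Fin m → L)
    (hld : ∀ (J : Type u) (s : Finset J) (g : J → MvPolynomial (Fin m) C) (β : J → L),
      (∀ l, β l ∈ aclOf C (Set.range x)) →
      LinearIndependent C (fun l => MvPolynomial.aeval y (g l)) →
      ∑ l ∈ s, β l * MvPolynomial.aeval y (g l) = 0 → ∀ l ∈ s, β l = 0)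
    (hglue : ∀ z ∈ aclOf C (Set.range y), ∀ z' ∈ aclOf C (Set.range y), ev z = ev' z' →
      ∃ c, z = algebraMap C L c)
    (hcut : ∀ z ∈ aclOf C (Set.range y), ∀ β ∈ aclOf C (Set.range x),
      ∀ z' ∈ aclOf C (Set.range y),
      (germRel U RC (ev z) (ev β) (ev z') ↔ germRel U RC (ev z) (ev' β) (ev z')))
    (φ : Lt.Formula (Fin n ⊕ Fin m))
    (h₁ : RealizeIn (germRel U RC) φ (Sum.elim (ev ∘ x) (ev ∘ y)))
    (h₂ : RealizeIn (germRel U RC) φ (Sum.elim (ev' ∘ x) (ev' ∘ y))) :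
    ∃ z : Fin n → Germ (U : Filter ι) C, RealizeIn (germRel U RC) φ (Sum.elim z (ev ∘ y)) ∧
      RealizeIn (germRel U RC) φ (Sum.elim z (ev' ∘ y)) := by
  have cE : IsAlgClosed (aclOf C (Set.range x ∪ Set.range y)) := isAlgClosed_aclOf _
  have hAE : aclOf C (Set.range y) ≤ aclOf C (Set.range x ∪ Set.range y) :=
    aclOf_le cE (Set.subset_union_right.trans (subset_aclOf _))
  have hBE : aclOf C (Set.range x) ≤ aclOf C (Set.range x ∪ Set.range y) :=
    aclOf_le cE (Set.subset_union_left.trans (subset_aclOf _))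
  obtain ⟨A, _, _, fA, _, hA⟩ := exists_acl_field (C := C) (Set.range y)
  obtain ⟨B, _, _, fB, _, hB⟩ := exists_acl_field (C := C) (Set.range x)
  obtain ⟨E, _, _, fE, _, hE⟩ := exists_acl_field (C := C) (Set.range x ∪ Set.range y)
  obtain ⟨jA, hjA⟩ := exists_algHom_factor fA fE
    (fun a => (hE _).1 (hAE ((hA _).2 ⟨a, rfl⟩)))
  obtain ⟨jB, hjB⟩ := exists_algHom_factor fB fE
    (fun a => (hE _).1 (hBE ((hB _).2 ⟨a, rfl⟩)))
  choose x' hx' using fun j => (hB (x j)).1 (subset_aclOf _ ⟨j, rfl⟩)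
  choose y' hy' using fun j => (hA (y j)).1 (subset_aclOf _ ⟨j, rfl⟩)
  have e₁ : (fun k => (ev.comp (fE : E →+* L)) (jA (y' k))) = ev ∘ y := by
    funext k; simp [hjA, hy']
  have e₂ : (fun k => (ev'.comp (fE : E →+* L)) (jA (y' k))) = ev' ∘ y := by
    funext k; simp [hjA, hy']
  have e₃ : (fun k => (ev.comp (fE : E →+* L)) (jB (x' k))) = ev ∘ x := by
    funext k; simp [hjB, hx']
  have e₄ : (fun k => (ev'.comp (fE : E →+* L)) (jB (x' k))) = ev' ∘ x := by
    funext k; simp [hjB, hx']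
  have key := exists_solution_of_amalgam hTA U jA jB
    (productMap_injective_acl U ev hev x y hld fA fB fE hA hB jA jB hjA hjB)
    (isAlgebraic_productMap_range x y fA fB fE hA hB hE jA jB hjA hjB)
    (ev.comp (fE : E →+* L)) (ev'.comp (fE : E →+* L)) (fun c => by simp [hev])
    (fun c => by simp [hev'])
    hRC hmod (hRL.comap (fE : E →+* L)) (fun a b c => hevR _ _ _) (fun a b c => hevR' _ _ _)
    (fun a a' h => by
      simp only [RingHom.comp_apply, RingHom.coe_coe, hjA] at h
      obtain ⟨c, hc⟩ := hglue _ ((hA _).2 ⟨a, rfl⟩) _ ((hA _).2 ⟨a', rfl⟩) h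
      exact ⟨c, fA.injective (hc.trans (fA.commutes c).symm)⟩)
    (fun a β a' => by
      simp only [RingHom.comp_apply, RingHom.coe_coe, hjA, hjB]
      exact hcut _ ((hA _).2 ⟨a, rfl⟩) _ ((hB _).2 ⟨β, rfl⟩) _ ((hA _).2 ⟨a', rfl⟩))
    x' y' φ
  rw [e₁, e₂, e₃, e₄] at key
  exact key h₁ h₂

end Abstract

section Limit

theorem germ_eval₂ {κ : Type*} (V : Ultrafilter κ) {C : Type*} [Field C] {m : ℕ}
    (w : Fin m → κ → C) (g : MvPolynomial (Fin m) C) :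
    MvPolynomial.eval₂ (gconst V C) (fun k => (w k : Germ (V : Filter κ) C)) g =
      ((fun t => MvPolynomial.eval (fun k => w k t) g : κ → C) : Germ (V : Filter κ) C) := by
  induction g using MvPolynomial.induction_on with
  | C a => simp [gconst_apply]
  | add p q hp hq => rw [MvPolynomial.eval₂_add, hp, hq]; simp only [map_add]; rfl
  | mul_X p k hp =>
    rw [MvPolynomial.eval₂_mul, hp, MvPolynomial.eval₂_X]
    simp only [map_mul, MvPolynomial.eval_X]; rfl

/-- Specialization of the coefficients of a polynomial over a function ring. -/
noncomputable def polyAt {C D : Type*} [Field C] {m : ℕ} (Q : MvPolynomial (Fin m) (D → C))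
    (b : D) : MvPolynomial (Fin m) C :=
  MvPolynomial.map (Pi.evalRingHom (fun _ : D => C) b) Q

/-- The polynomial `∑ σ_l g_l` over a function ring. -/
noncomputable def polySum {C D J : Type*} [Field C] {m : ℕ} (s : Finset J) (σ : J → D → C)
    (g : J → MvPolynomial (Fin m) C) : MvPolynomial (Fin m) (D → C) :=
  ∑ l ∈ s, MvPolynomial.C (σ l) * MvPolynomial.map (Pi.constRingHom D C) (g l)

theorem polyAt_polySum {C D J : Type*} [Field C] {m : ℕ} (s : Finset J) (σ : J → D → C)
    (g : J → MvPolynomial (Fin m) C) (b : D) :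
    polyAt (polySum s σ g) b = ∑ l ∈ s, σ l b • g l := by
  unfold polyAt polySum
  rw [map_sum]
  refine Finset.sum_congr rfl fun l _ => ?_
  rw [map_mul, MvPolynomial.map_C, MvPolynomial.map_map]
  have : (Pi.evalRingHom (fun _ : D => C) b).comp (Pi.constRingHom D C) = RingHom.id C := rfl
  rw [this, MvPolynomial.map_id, MvPolynomial.smul_eq_C_mul]
  rfl

/-- Elements algebraic over some coordinates are represented by functions of these coordinates. -/
theorem exists_rep_of_mem_aclOf {κ D : Type u} (V : Ultrafilter κ) {C : Type u} [Field C]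
    [IsAlgClosed C] [Algebra C (Germ (V : Filter κ) C)]
    (halg : ∀ c, algebraMap C (Germ (V : Filter κ) C) c = gconst V C c) (π : κ → D)
    {X : Set (Germ (V : Filter κ) C)} (hX : ∀ x ∈ X, ∃ σ : D → C, x = ((σ ∘ π : κ → C) : Germ _ C))
    {z : Germ (V : Filter κ) C} (hz : z ∈ aclOf C X) :
    ∃ σ : D → C, z = ((σ ∘ π : κ → C) : Germ (V : Filter κ) C) := by
  have ht : Tendsto π V (V.map π) := le_rfl
  let _ : Algebra C (Germ ((V.map π : Ultrafilter D) : Filter D) C) := (gconst (V.map π) C).toAlgebra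
  let f : Germ ((V.map π : Ultrafilter D) : Filter D) C →ₐ[C] Germ (V : Filter κ) C :=
    { germPull C π ht with
      commutes' := fun c => (germPull_gconst π ht c).trans (halg c).symm }
  have hf : ∀ σ : D → C, f (σ : Germ ((V.map π : Ultrafilter D) : Filter D) C) =
    ((σ ∘ π : κ → C) : Germ (V : Filter κ) C) := fun σ => rfl
  have hcl := isAlgClosed_germ (V.map π) C
  have hcl' : IsAlgClosed f.fieldRange :=
    IsAlgClosed.of_ringEquiv _ _ (AlgEquiv.ofInjectiveField f).toRingEquiv
  have := aclOf_le hcl' (X := X) (by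
    intro x hx
    obtain ⟨σ, rfl⟩ := hX x hx
    exact ⟨_, hf σ⟩) hz
  obtain ⟨y, hy⟩ := this
  revert hy
  refine Germ.inductionOn y fun σ hy => ⟨σ, ?_⟩
  rw [← hf σ]
  exact hy.symm

end Limit

section Limit

theorem eq_zero_of_linearIndependent {C L J : Type*} [Field C] [Field L] [Algebra C L] {v : J → L}
    (h : LinearIndependent C v) (s : Finset J) (c : J → C)
    (hc : ∑ l ∈ s, algebraMap C L (c l) * v l = 0) : ∀ l ∈ s, c l = 0 := by
  refine linearIndependent_iff'.1 h s c ?_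
  simpa only [Algebra.smul_def] using hc

variable {ι C : Type u} [Field C] {n m : ℕ}

theorem limit_linearDisjoint {U : Ultrafilter ι} {V : Ultrafilter ((Fin n → C) × (Fin m → C))}
    [IsAlgClosed C] [Algebra C (Germ (V : Filter ((Fin n → C) × (Fin m → C))) C)]
    (halg : ∀ c, algebraMap C (Germ (V : Filter ((Fin n → C) × (Fin m → C))) C) c = gconst V C c)
    (a : ι → Fin m → C) (b : ι → Fin n → C)
    (hπ : Tendsto (fun t => (b t, a t)) U V)
    (I : Ideal (MvPolynomial (Fin m) C)) (hI : ∀ g ∈ I, ∀ᶠ t in U, MvPolynomial.eval (a t) g = 0)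
    (h3 : ∀ Q : MvPolynomial (Fin m) ((Fin n → C) → C), ∀ᶠ t in U,
      MvPolynomial.eval (a t) (polyAt Q (b t)) = 0 → polyAt Q (b t) ∈ I)
    (x : Fin n → Germ (V : Filter ((Fin n → C) × (Fin m → C))) C)
    (hx : ∀ j, x j = ((fun p => p.1 j : (Fin n → C) × (Fin m → C) → C) : Germ _ C))
    (y : Fin m → Germ (V : Filter ((Fin n → C) × (Fin m → C))) C)
    (hy : ∀ k, y k = ((fun p => p.2 k : (Fin n → C) × (Fin m → C) → C) : Germ _ C))
    (J : Type u) (s : Finset J) (g : J → MvPolynomial (Fin m) C)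
    (β : J → Germ (V : Filter ((Fin n → C) × (Fin m → C))) C)
    (hβ : ∀ l, β l ∈ aclOf C (Set.range x))
    (hli : ∀ c : J → C, ∑ l ∈ s, algebraMap C _ (c l) * MvPolynomial.aeval y (g l) = 0 →
      ∀ l ∈ s, c l = 0)
    (hsum : ∑ l ∈ s, β l * MvPolynomial.aeval y (g l) = 0) : ∀ l ∈ s, β l = 0 := by
  have hU : U.map (fun t => (b t, a t)) = V :=
    (Ultrafilter.coe_le_coe (f := U.map (fun t => (b t, a t))) (g := V)).1 hπ
  have hrepx : ∀ z ∈ aclOf C (Set.range x), ∃ σ : (Fin n → C) → C,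
      z = ((σ ∘ Prod.fst : (Fin n → C) × (Fin m → C) → C) :
        Germ (V : Filter ((Fin n → C) × (Fin m → C))) C) :=
    fun z hz => exists_rep_of_mem_aclOf V halg Prod.fst (by
      rintro _ ⟨j, rfl⟩
      exact ⟨fun b => b j, hx j⟩) hz
  choose σ hσ using fun l => hrepx _ (hβ l)
  have hev : ∀ p : MvPolynomial (Fin m) C, MvPolynomial.aeval y p =
      ((fun q => MvPolynomial.eval q.2 p : (Fin n → C) × (Fin m → C) → C) :
        Germ (V : Filter ((Fin n → C) × (Fin m → C))) C) := by
    intro p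
    rw [MvPolynomial.aeval_def, show algebraMap C (Germ (V : Filter ((Fin n → C) × (Fin m → C))) C) =
      gconst V C from RingHom.ext halg, funext hy]
    exact germ_eval₂ V (fun k q => q.2 k) p
  have hsum' : ∀ᶠ t in U, ∑ l ∈ s, σ l (b t) * MvPolynomial.eval (a t) (g l) = 0 := by
    have h0 : ((fun q => ∑ l ∈ s, σ l q.1 * MvPolynomial.eval q.2 (g l) :
        (Fin n → C) × (Fin m → C) → C) : Germ (V : Filter ((Fin n → C) × (Fin m → C))) C) = 0 := by
      rw [← hsum]
      simp only [hev, hσ]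
      have : ∀ s' : Finset J, ((fun q => ∑ l ∈ s', σ l q.1 * MvPolynomial.eval q.2 (g l) :
        (Fin n → C) × (Fin m → C) → C) : Germ (V : Filter ((Fin n → C) × (Fin m → C))) C) =
          ∑ l ∈ s', ((σ l ∘ Prod.fst : (Fin n → C) × (Fin m → C) → C) :
            Germ (V : Filter ((Fin n → C) × (Fin m → C))) C) *
          ((fun q => MvPolynomial.eval q.2 (g l) : (Fin n → C) × (Fin m → C) → C) :
            Germ (V : Filter ((Fin n → C) × (Fin m → C))) C) := by
        classical
        intro s'
        induction s' using Finset.induction_on with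
        | empty => simp only [Finset.sum_empty]; rfl
        | insert l s' hl ih =>
          simp only [Finset.sum_insert hl]
          rw [← ih]
          rfl
      exact this s
    have := (germ_coe_eq V (g := fun _ => (0 : C))).1 h0
    rw [← hU] at this
    exact this
  have hzero : ∀ᶠ t in U, ∀ l ∈ s, σ l (b t) = 0 := by
    filter_upwards [hsum', h3 (polySum s σ g)] with t ht1 ht2 l hl
    rw [polyAt_polySum] at ht2
    have hmem := ht2 (by
      rw [map_sum, ← ht1]
      exact Finset.sum_congr rfl fun l _ => MvPolynomial.smul_eval _ _ _)
    refine hli (fun l => σ l (b t)) ?_ l hl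
    have hc : ∑ l ∈ s, algebraMap C _ (σ l (b t)) * MvPolynomial.aeval y (g l) =
        MvPolynomial.aeval y (∑ l ∈ s, σ l (b t) • g l) := by
      rw [map_sum]
      refine Finset.sum_congr rfl fun l _ => ?_
      rw [MvPolynomial.smul_eq_C_mul, map_mul, MvPolynomial.aeval_C]
    rw [hc, hev]
    refine (germ_coe_eq V (g := fun _ => (0 : C))).2 ?_
    rw [← hU]
    exact hI _ hmem
  intro l hl
  rw [hσ l]
  refine (germ_coe_eq V (g := fun _ => (0 : C))).2 ?_
  rw [← hU]
  exact hzero.mono fun t ht => ht l hl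

theorem mem_range_of_algebraic {κ : Type u} {U : Ultrafilter ι} {V : Ultrafilter κ}
    [IsAlgClosed C] [Algebra C (Germ (V : Filter κ) C)]
    (halg : ∀ c, algebraMap C (Germ (V : Filter κ) C) c = gconst V C c)
    (a a' : ι → Fin m → C) (ev' : Germ (V : Filter κ) C →+* Germ (U : Filter ι) C)
    (hev' : ∀ c, ev' (gconst V C c) = gconst U C c)
    (I : Ideal (MvPolynomial (Fin m) C)) (hI : ∀ g ∈ I, ∀ᶠ t in U, MvPolynomial.eval (a' t) g = 0)
    (h4 : ∀ Q : MvPolynomial (Fin m) ((Fin m → C) → C), ∀ᶠ t in U,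
      MvPolynomial.eval (a' t) (polyAt Q (a t)) = 0 → polyAt Q (a t) ∈ I)
    (y : Fin m → Germ (V : Filter κ) C)
    (hy : ∀ k, ev' (y k) = ((fun t => a' t k : ι → C) : Germ _ C))
    (z' : Germ (V : Filter κ) C) (hz' : z' ∈ aclOf C (Set.range y))
    (σ : (Fin m → C) → C) (hz : ev' z' = ((fun t => σ (a t) : ι → C) : Germ (U : Filter ι) C)) :
    ∃ c, gconst U C c = ev' z' := by
  have hev : ∀ p : MvPolynomial (Fin m) C, ev' (MvPolynomial.aeval y p) =
      ((fun t => MvPolynomial.eval (a' t) p : ι → C) : Germ (U : Filter ι) C) := by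
    intro p
    rw [MvPolynomial.aeval_def, show algebraMap C (Germ (V : Filter κ) C) =
      gconst V C from RingHom.ext halg, MvPolynomial.hom_eval₂,
      show ev'.comp (gconst V C) = gconst U C from RingHom.ext hev',
      show (fun k => ev' (y k)) = fun k => ((fun t => a' t k : ι → C) : Germ (U : Filter ι) C) from funext hy]
    exact germ_eval₂ U (fun k t => a' t k) p
  obtain ⟨P, hP, hPz⟩ := isAlgebraic_adjoin_of_mem_aclOf hz'
  have hg : ∀ k, ∃ g : MvPolynomial (Fin m) C, MvPolynomial.aeval y g = (P.coeff k : Germ (V : Filter κ) C) := by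
    intro k
    have := (Algebra.adjoin_range_eq_range_aeval C y).le (P.coeff k).2
    exact this
  choose g hg using hg
  let d := P.natDegree
  have hsum : ∀ᶠ t in U, ∑ k ∈ Finset.range (d + 1),
      MvPolynomial.eval (a' t) (g k) * σ (a t) ^ k = 0 := by
    have h0 : ∑ k ∈ Finset.range (d + 1), (P.coeff k : Germ (V : Filter κ) C) * z' ^ k = 0 := by
      rw [← hPz, Polynomial.aeval_def, Polynomial.eval₂_eq_sum_range]
      rfl
    have h1 := congrArg ev' h0
    rw [map_sum, map_zero] at h1
    simp only [map_mul, map_pow, ← hg, hev, hz] at h1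
    have : ∀ N : ℕ, ((fun t => ∑ k ∈ Finset.range N,
      MvPolynomial.eval (a' t) (g k) * σ (a t) ^ k : ι → C) : Germ (U : Filter ι) C) =
        ∑ k ∈ Finset.range N, ((fun t => MvPolynomial.eval (a' t) (g k) : ι → C) :
          Germ (U : Filter ι) C) * ((fun t => σ (a t) : ι → C) : Germ (U : Filter ι) C) ^ k := by
      intro N
      induction N with
      | zero => rfl
      | succ N ih =>
        rw [Finset.sum_range_succ, ← ih]
        simp only [Finset.sum_range_succ]
        rfl
    rw [← this] at h1
    exact (germ_coe_eq U (g := fun _ => (0 : C))).1 h1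
  have hd : ∀ᶠ t in U, MvPolynomial.eval (a' t) (g d) ≠ 0 := by
    rw [Ultrafilter.eventually_not]
    intro h
    have h1 : ev' (MvPolynomial.aeval y (g d)) = 0 := by
      rw [hev]; exact (germ_coe_eq U (g := fun _ => (0 : C))).2 h
    have h2 := (map_eq_zero ev').1 h1
    rw [hg] at h2
    exact hP (Polynomial.leadingCoeff_eq_zero.1 (Subtype.ext h2))
  have hdI : g d ∉ I := fun h => by
    obtain ⟨t, h1, h2⟩ := ((hI _ h).and hd).exists
    exact h2 h1
  obtain ⟨ℓ, hℓ, hker⟩ := Submodule.exists_le_ker_of_notMem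
    (p := I.restrictScalars C) (v := g d) hdI
  let p : Polynomial C := ∑ k ∈ Finset.range (d + 1), Polynomial.C (ℓ (g k)) * Polynomial.X ^ k
  have hp : p ≠ 0 := by
    intro h
    have := congrArg (fun q => q.coeff d) h
    simp only [p, Polynomial.finsetSum_coeff, Polynomial.coeff_C_mul, Polynomial.coeff_X_pow,
      mul_ite, mul_one, mul_zero, Polynomial.coeff_zero] at this
    rw [Finset.sum_ite_eq] at this
    simp at this
    exact hℓ this
  refine mem_range_of_eval₂_eq_zero (gconst U C) hp ?_
  have hroot : ∀ᶠ t in U, p.eval (σ (a t)) = 0 := by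
    filter_upwards [hsum, h4 (polySum (Finset.range (d + 1)) (fun k => σ ^ k) g)] with t ht1 ht2
    rw [polyAt_polySum] at ht2
    have hmem := ht2 (by
      rw [map_sum, ← ht1]
      refine Finset.sum_congr rfl fun l _ => ?_
      rw [MvPolynomial.smul_eval, mul_comm]
      rfl)
    have := hker hmem
    rw [LinearMap.mem_ker, map_sum] at this
    rw [← this, Polynomial.eval_finsetSum]
    refine Finset.sum_congr rfl fun l _ => ?_
    rw [map_smul, smul_eq_mul]
    simp only [Polynomial.eval_mul, Polynomial.eval_C, Polynomial.eval_pow, Polynomial.eval_X,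
      Pi.pow_apply]
    exact mul_comm _ _
  rw [hz]
  have key : ∀ q : Polynomial C, q.eval₂ (gconst U C)
      ((fun t => σ (a t) : ι → C) : Germ (U : Filter ι) C) =
      ((fun t => q.eval (σ (a t)) : ι → C) : Germ (U : Filter ι) C) := by
    intro q
    induction q using Polynomial.induction_on' with
    | add p q hp hq => simp only [Polynomial.eval₂_add, hp, hq, Polynomial.eval_add]; rfl
    | monomial k c => simp only [Polynomial.eval₂_monomial, Polynomial.eval_monomial]; rfl
  rw [key]
  exact (germ_coe_eq U (g := fun _ => (0 : C))).2 hroot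

end Limit

section Limit

variable {ι C : Type u} [Field C] {n m : ℕ}

/-- There is no sequence of pairs of instances of a formula which gets more and more independent
while the instances remain inconsistent. -/
theorem not_independent_limit {TA : Lt.Theory}
    (hTA : IsModelCompanionOfClass.{u} TA (fun F SF => IsACFOminus F SF))
    [IsAlgClosed C] {RC : C → C → C → Prop} (hRC : IsCircField RC)
    (hmod : @Theory.Model Lt C (ltOf C RC) TA) (φ : Lt.Formula (Fin n ⊕ Fin m))
    (U : Ultrafilter ι) (a a' : ι → Fin m → C) (b b' : ι → Fin n → C)
    (I : Ideal (MvPolynomial (Fin m) C))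
    (h1 : ∀ t, RealizeIn RC φ (Sum.elim (b t) (a t)))
    (h1' : ∀ t, RealizeIn RC φ (Sum.elim (b' t) (a' t)))
    (h1'' : ∀ t, ¬ ∃ x, RealizeIn RC φ (Sum.elim x (a t)) ∧ RealizeIn RC φ (Sum.elim x (a' t)))
    (h2 : ∀ S : Set ((Fin n → C) × (Fin m → C)), ∀ᶠ t in U, (b t, a t) ∈ S ↔ (b' t, a' t) ∈ S)
    (h3 : ∀ Q : MvPolynomial (Fin m) ((Fin n → C) → C), ∀ᶠ t in U,
      MvPolynomial.eval (a t) (polyAt Q (b t)) = 0 → polyAt Q (b t) ∈ I)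
    (h4 : ∀ Q : MvPolynomial (Fin m) ((Fin m → C) → C), ∀ᶠ t in U,
      MvPolynomial.eval (a' t) (polyAt Q (a t)) = 0 → polyAt Q (a t) ∈ I)
    (h5 : ∀ (s s' : (Fin m → C) → C) (τ : (Fin n → C) → C), ∀ᶠ t in U,
      (RC (s (a t)) (τ (b t)) (s' (a t)) ↔ RC (s (a t)) (τ (b' t)) (s' (a t))))
    (h6 : ∀ t, ∀ g ∈ I, MvPolynomial.eval (a t) g = 0)
    (h6' : ∀ t, ∀ g ∈ I, MvPolynomial.eval (a' t) g = 0) : False := by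
  let V : Ultrafilter ((Fin n → C) × (Fin m → C)) := U.map fun t => (b t, a t)
  have hπ : Tendsto (fun t => (b t, a t)) U V := le_rfl
  have hπ' : Tendsto (fun t => (b' t, a' t)) U V := by
    intro S hS
    have hS' : ∀ᶠ t in U, (b t, a t) ∈ S := hS
    have : ∀ᶠ t in U, (b' t, a' t) ∈ S := by
      filter_upwards [hS', h2 S] with t ht1 ht2 using ht2.1 ht1
    exact this
  let _ : Algebra C (Germ (V : Filter ((Fin n → C) × (Fin m → C))) C) := (gconst V C).toAlgebra
  have halg : ∀ c, algebraMap C (Germ (V : Filter ((Fin n → C) × (Fin m → C))) C) c =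
    gconst V C c := fun c => rfl
  have hcl := isAlgClosed_germ V C
  let x : Fin n → Germ (V : Filter ((Fin n → C) × (Fin m → C))) C := fun j =>
    ((fun p => p.1 j : (Fin n → C) × (Fin m → C) → C) : Germ _ C)
  let y : Fin m → Germ (V : Filter ((Fin n → C) × (Fin m → C))) C := fun k =>
    ((fun p => p.2 k : (Fin n → C) × (Fin m → C) → C) : Germ _ C)
  let ev := germPull C _ hπ
  let ev' := germPull C _ hπ'
  have hrepx : ∀ z ∈ aclOf C (Set.range x), ∃ σ : (Fin n → C) → C,
      z = ((σ ∘ Prod.fst : (Fin n → C) × (Fin m → C) → C) :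
        Germ (V : Filter ((Fin n → C) × (Fin m → C))) C) :=
    fun z hz => exists_rep_of_mem_aclOf V halg Prod.fst (by
      rintro _ ⟨j, rfl⟩
      exact ⟨fun b => b j, rfl⟩) hz
  have hrepy : ∀ z ∈ aclOf C (Set.range y), ∃ σ : (Fin m → C) → C,
      z = ((σ ∘ Prod.snd : (Fin n → C) × (Fin m → C) → C) :
        Germ (V : Filter ((Fin n → C) × (Fin m → C))) C) :=
    fun z hz => exists_rep_of_mem_aclOf V halg Prod.snd (by
      rintro _ ⟨j, rfl⟩
      exact ⟨fun b => b j, rfl⟩) hz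
  have r1 : RealizeIn (germRel U RC) φ (Sum.elim (ev ∘ x) (ev ∘ y)) := by
    have := (realizeIn_germ U RC φ (fun i t => Sum.elim (b t) (a t) i)).2
      (Eventually.of_forall h1)
    convert this using 1
    funext i
    rcases i with i | i <;> rfl
  have r2 : RealizeIn (germRel U RC) φ (Sum.elim (ev' ∘ x) (ev' ∘ y)) := by
    have := (realizeIn_germ U RC φ (fun i t => Sum.elim (b' t) (a' t) i)).2
      (Eventually.of_forall h1')
    convert this using 1
    funext i
    rcases i with i | i <;> rfl
  obtain ⟨z, hz1, hz2⟩ := exists_solution_of_independent hTA U hRC hmod (hRC.germ V) ev ev'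
    (fun c => rfl) (fun c => rfl) (germRel_germPull RC _ hπ) (germRel_germPull RC _ hπ') x y
    (fun J s g β hβ hli hsum => limit_linearDisjoint halg a b hπ I
      (fun g hg => Eventually.of_forall fun t => h6 t g hg) h3 x (fun _ => rfl) y (fun _ => rfl)
      J s g β hβ (eq_zero_of_linearIndependent hli s) hsum)
    (by
      intro z hz z' hz' h
      obtain ⟨σ, hσ⟩ := hrepy z hz
      have hzσ : ev z = ((fun t => σ (a t) : ι → C) : Germ (U : Filter ι) C) := by
        rw [hσ]; rfl
      obtain ⟨c, hc⟩ := mem_range_of_algebraic halg a a' ev' (fun c => rfl) I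
        (fun g hg => Eventually.of_forall fun t => h6' t g hg) h4 y (fun k => rfl) z' hz' σ
        (h.symm.trans hzσ)
      exact ⟨c, ev.injective (h.trans hc.symm)⟩)
    (by
      intro z hz β hβ z' hz'
      obtain ⟨σ, rfl⟩ := hrepy z hz
      obtain ⟨σ', rfl⟩ := hrepy z' hz'
      obtain ⟨τ, rfl⟩ := hrepx β hβ
      refine (germRel_coe U).trans (Iff.trans ?_ (germRel_coe U).symm)
      have := h5 σ σ' τ
      constructor
      · intro H; filter_upwards [H, this] with t h h' using h'.1 h
      · intro H; filter_upwards [H, this] with t h h' using h'.2 h)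
    φ r1 r2
  choose w hw using fun j => Quotient.exists_rep (z j)
  have q1 : ∀ᶠ t in U, RealizeIn RC φ (Sum.elim (fun j => w j t) (a t)) := by
    have := (realizeIn_germ U RC φ (Sum.elim w (fun k t => a t k))).1 (by
      convert hz1 using 1
      funext i
      rcases i with i | i
      · exact hw i
      · rfl)
    refine this.mono fun t ht => ?_
    convert ht using 1
    funext i
    rcases i with i | i <;> rfl
  have q2 : ∀ᶠ t in U, RealizeIn RC φ (Sum.elim (fun j => w j t) (a' t)) := by
    have := (realizeIn_germ U RC φ (Sum.elim w (fun k t => a' t k))).1 (by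
      convert hz2 using 1
      funext i
      rcases i with i | i
      · exact hw i
      · rfl)
    refine this.mono fun t ht => ?_
    convert ht using 1
    funext i
    rcases i with i | i <;> rfl
  obtain ⟨t, ht1, ht2⟩ := (q1.and q2).exists
  exact h1'' t ⟨_, ht1, ht2⟩

end Limit

section Tree

variable {C : Type*} [Field C] {m : ℕ}

theorem exists_generic_ideal (a : List Bool → Fin m → C) :
    ∃ (I : Ideal (MvPolynomial (Fin m) C)) (ρ₀ : List Bool),
      ∀ (G : Finset (MvPolynomial (Fin m) C)), (∀ g ∈ G, g ∉ I) → ∀ ρ, ρ₀ <+: ρ →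
        ∃ ν, ρ <+: ν ∧ (∀ g ∈ I, MvPolynomial.eval (a ν) g = 0) ∧
          ∀ g ∈ G, MvPolynomial.eval (a ν) g ≠ 0 := by
  classical
  let dense : Ideal (MvPolynomial (Fin m) C) → List Bool → Prop := fun I ρ₀ =>
    ∀ ρ, ρ₀ <+: ρ → ∃ ν, ρ <+: ν ∧ ∀ g ∈ I, MvPolynomial.eval (a ν) g = 0
  obtain ⟨I, ⟨ρ₀, hI⟩, hmax⟩ := set_has_maximal_iff_noetherian.2
    (inferInstance : IsNoetherianRing (MvPolynomial (Fin m) C))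
    {I | ∃ ρ₀, dense I ρ₀}
    ⟨⊥, [], fun ρ _ => ⟨ρ, List.prefix_refl _, fun g hg => by
      rw [(Submodule.mem_bot _).1 hg, map_zero]⟩⟩
  refine ⟨I, ρ₀, fun G hG => ?_⟩
  have key : ∀ ρ, ρ₀ <+: ρ → ∃ ρ', ρ <+: ρ' ∧ ∀ ν, ρ' <+: ν →
      (∀ g ∈ I, MvPolynomial.eval (a ν) g = 0) → ∀ g ∈ G, MvPolynomial.eval (a ν) g ≠ 0 := by
    induction G using Finset.induction_on with
    | empty => exact fun ρ _ => ⟨ρ, List.prefix_refl _, by simp⟩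
    | insert g G _ ih =>
      intro ρ hρ
      obtain ⟨ρ₁, hρ₁, h₁⟩ := ih (fun g hg => hG g (Finset.mem_insert_of_mem hg)) ρ hρ
      have hgI := hG g (Finset.mem_insert_self _ _)
      have hlt : I < I ⊔ Ideal.span {g} := lt_of_le_of_ne le_sup_left fun h =>
        hgI (h ▸ Ideal.mem_sup_right (Ideal.mem_span_singleton_self g))
      have hnd : ¬ dense (I ⊔ Ideal.span {g}) ρ₁ := fun h => hmax _ ⟨ρ₁, h⟩ hlt
      simp only [dense] at hnd
      push Not at hnd
      obtain ⟨ρ₂, hρ₂, h₂⟩ := hnd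
      refine ⟨ρ₂, hρ₁.trans hρ₂, fun ν hν hνI g' hg' => ?_⟩
      rcases Finset.mem_insert.1 hg' with rfl | hg'
      · intro h0
        obtain ⟨q, hq, hq0⟩ := h₂ ν hν
        obtain ⟨u, hu, v, hv, rfl⟩ := Submodule.mem_sup.1 hq
        obtain ⟨w, rfl⟩ := Ideal.mem_span_singleton'.1 hv
        exact hq0 (by rw [map_add, map_mul, h0, hνI u hu, mul_zero, add_zero])
      · exact h₁ ν (hρ₂.trans hν) hνI g' hg'
  intro ρ hρ
  obtain ⟨ρ', hρ', h'⟩ := key ρ hρ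
  obtain ⟨ν, hν, hνI⟩ := hI ρ' (hρ.trans hρ')
  exact ⟨ν, hρ'.trans hν, hνI, h' ν hν hνI⟩

theorem exists_seq_of_forall_fin {X : Type*} (P : ∀ l : ℕ, (Fin l → X) → X → Prop)
    (h : ∀ l f, ∃ x, P l f x) : ∃ s : ℕ → X, ∀ l, P l (fun i => s i) (s l) := by
  choose g hg using h
  let s : ℕ → X := fun l => Nat.strongRec (motive := fun _ => X)
    (fun l ih => g l fun i => ih i i.2) l
  refine ⟨s, fun l => ?_⟩
  have : s l = g l fun i => s i := by
    simp only [s]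
    rw [Nat.strongRec_eq]
  rw [this]
  exact hg _ _

/-- A polynomial of a finite-dimensional space `W` which is not in `I` has few roots in a sequence
in general position. -/
theorem card_roots_le (W : Submodule C (MvPolynomial (Fin m) C)) [FiniteDimensional C W]
    (I : Ideal (MvPolynomial (Fin m) C)) (x : ℕ → Fin m → C)
    (hx : ∀ (l : ℕ) (s : Finset ℕ), (∀ k ∈ s, k < l) →
      (∃ g ∈ W, g ∉ I ∧ ∀ k ∈ s, MvPolynomial.eval (x k) g = 0) →
      ∃ g ∈ W, (∀ k ∈ s, MvPolynomial.eval (x k) g = 0) ∧ MvPolynomial.eval (x l) g ≠ 0)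
    (g : MvPolynomial (Fin m) C) (hgW : g ∈ W) (hgI : g ∉ I) (s : Finset ℕ)
    (hs : ∀ l ∈ s, MvPolynomial.eval (x l) g = 0) : s.card ≤ Module.finrank C W := by
  classical
  let K : Finset ℕ → Submodule C (MvPolynomial (Fin m) C) := fun s =>
    { carrier := {g | g ∈ W ∧ ∀ k ∈ s, MvPolynomial.eval (x k) g = 0}
      add_mem' := fun ha hb => ⟨W.add_mem ha.1 hb.1, fun k hk => by
        rw [map_add, ha.2 k hk, hb.2 k hk, add_zero]⟩
      zero_mem' := ⟨W.zero_mem, fun k _ => map_zero _⟩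
      smul_mem' := fun c _ ha => ⟨W.smul_mem c ha.1, fun k hk => by
        rw [MvPolynomial.smul_eval, ha.2 k hk, mul_zero]⟩ }
  have hKW : ∀ s, K s ≤ W := fun s g hg => hg.1
  have hfin : ∀ s, FiniteDimensional C (K s) := fun s =>
    Submodule.finiteDimensional_of_le (hKW s)
  have key : ∀ s : Finset ℕ, (∃ g ∈ K s, g ∉ I) →
      Module.finrank C (K s) + s.card ≤ Module.finrank C W := by
    intro s
    induction s using Finset.induction_on_max with
    | empty =>
      intro _
      simpa using Submodule.finrank_mono (hKW ∅)
    | insert l s hl ih =>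
      rintro ⟨g, hg, hgI⟩
      have hle : K (insert l s) ≤ K s := fun g hg =>
        ⟨hg.1, fun k hk => hg.2 k (Finset.mem_insert_of_mem hk)⟩
      have h1 := ih ⟨g, hle hg, hgI⟩
      obtain ⟨g', hg'W, hg's, hg'l⟩ := hx l s hl ⟨g, hg.1, hgI, (hle hg).2⟩
      have hlt : K (insert l s) < K s := lt_of_le_of_ne hle fun h => by
        have : g' ∈ K (insert l s) := h ▸ (⟨hg'W, hg's⟩ : g' ∈ K s)
        exact hg'l (this.2 l (Finset.mem_insert_self _ _))
      have h2 := Submodule.finrank_lt_finrank_of_lt hlt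
      rw [Finset.card_insert_of_notMem fun h => lt_irrefl _ (hl l h)]
      omega
  exact le_trans (Nat.le_add_left _ _) (key s ⟨g, ⟨hgW, hs⟩, hgI⟩)

theorem exists_generic_array (a : List Bool → Fin m → C)
    {I : Ideal (MvPolynomial (Fin m) C)} {ρ₀ : List Bool}
    (hI : ∀ (G : Finset (MvPolynomial (Fin m) C)), (∀ g ∈ G, g ∉ I) → ∀ ρ, ρ₀ <+: ρ →
        ∃ ν, ρ <+: ν ∧ (∀ g ∈ I, MvPolynomial.eval (a ν) g = 0) ∧
          ∀ g ∈ G, MvPolynomial.eval (a ν) g ≠ 0)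
    (Qy : Finset (MvPolynomial (Fin m) ((Fin m → C) → C)))
    (W : Submodule C (MvPolynomial (Fin m) C)) [FiniteDimensional C W]
    (R : ℕ) (start : ℕ → List Bool) (hstart : ∀ j, ρ₀ <+: start j) :
    ∃ ν : ℕ → List Bool,
      (∀ j i, i < R → start j <+: ν (j * R + i)) ∧
      (∀ j i i', i < i' → i' < R →
        ν (j * R + i) <+: ν (j * R + i') ∧ ν (j * R + i) ≠ ν (j * R + i')) ∧
      (∀ l, ∀ g ∈ I, MvPolynomial.eval (a (ν l)) g = 0) ∧
      (∀ k l, k < l → ∀ Q ∈ Qy, polyAt Q (a (ν k)) ∉ I →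
        MvPolynomial.eval (a (ν l)) (polyAt Q (a (ν k))) ≠ 0) ∧
      (∀ g ∈ W, g ∉ I → ∀ s : Finset ℕ, (∀ l ∈ s, MvPolynomial.eval (a (ν l)) g = 0) →
        s.card ≤ Module.finrank C W) := by
  classical
  let root : ∀ l : ℕ, (Fin l → List Bool) → List Bool := fun l f =>
    if h : l % R = 0 then start (l / R) else
      f ⟨l - 1, Nat.sub_lt (Nat.pos_of_ne_zero fun h0 => h (by rw [h0, Nat.zero_mod])) one_pos⟩ ++
        [true]
  obtain ⟨ν, hν⟩ := exists_seq_of_forall_fin (X := List Bool) (fun l f ν =>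
    (ρ₀ <+: root l f → root l f <+: ν ∧ (∀ g ∈ I, MvPolynomial.eval (a ν) g = 0) ∧
    (∀ k, ∀ Q ∈ Qy, polyAt Q (a (f k)) ∉ I →
        MvPolynomial.eval (a ν) (polyAt Q (a (f k))) ≠ 0) ∧
    (∀ s : Finset (Fin l),
      (∃ g ∈ W, g ∉ I ∧ ∀ k ∈ s, MvPolynomial.eval (a (f k)) g = 0) →
      ∃ g ∈ W, (∀ k ∈ s, MvPolynomial.eval (a (f k)) g = 0) ∧
        MvPolynomial.eval (a ν) g ≠ 0))) (by
    intro l f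
    by_cases hr : ρ₀ <+: root l f
    swap
    · exact ⟨[], fun h => absurd h hr⟩
    let S : Set (Finset (Fin l)) :=
      {s | ∃ g ∈ W, g ∉ I ∧ ∀ k ∈ s, MvPolynomial.eval (a (f k)) g = 0}
    choose! γ hγW hγI hγ using fun (s : Finset (Fin l)) (hs : s ∈ S) => hs
    obtain ⟨ν, h1, h2, h3⟩ := hI
      ((Finset.univ.filter (· ∈ S)).image γ ∪
        ((Finset.univ ×ˢ Qy).image fun q : Fin l × _ => polyAt q.2 (a (f q.1))).filter (· ∉ I))
      (by
        intro g hg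
        rcases Finset.mem_union.1 hg with hg | hg
        · obtain ⟨s, hs, rfl⟩ := Finset.mem_image.1 hg
          exact hγI s (Finset.mem_filter.1 hs).2
        · exact (Finset.mem_filter.1 hg).2) _ hr
    refine ⟨ν, fun _ => ⟨h1, h2, fun k Q hQ hk => h3 _ ?_, fun s hs => ⟨γ s, hγW s hs, hγ s hs,
      h3 _ ?_⟩⟩⟩
    · refine Finset.mem_union_right _ (Finset.mem_filter.2 ⟨Finset.mem_image.2 ⟨(k, Q), ?_, rfl⟩, hk⟩)
      exact Finset.mem_product.2 ⟨Finset.mem_univ _, hQ⟩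
    · exact Finset.mem_union_left _ (Finset.mem_image_of_mem _
        (Finset.mem_filter.2 ⟨Finset.mem_univ _, hs⟩)))
  have hroot : ∀ l, ρ₀ <+: root l (fun i => ν i) := by
    intro l
    induction l with
    | zero =>
      simp only [root, Nat.zero_mod]
      exact hstart _
    | succ l ih =>
      simp only [root]
      split_ifs with h
      · exact hstart _
      · exact (ih.trans (hν l ih).1).trans (List.prefix_append _ _)
  have hν' := fun l => hν l (hroot l)
  have hstep : ∀ j i, i + 1 < R → ν (j * R + i) ++ [true] <+: ν (j * R + (i + 1)) := by
    intro j i hi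
    have := (hν' (j * R + (i + 1))).1
    have hmod : (j * R + (i + 1)) % R ≠ 0 := by
      rw [Nat.mul_add_mod_self_right, Nat.mod_eq_of_lt hi]
      omega
    simp only [root, dif_neg hmod] at this
    exact this
  have hchain : ∀ j i d, i + d + 1 < R → ν (j * R + i) ++ [true] <+: ν (j * R + (i + d + 1)) := by
    intro j i d
    induction d with
    | zero => exact hstep j i
    | succ d ih =>
      intro h
      exact ((ih (by omega)).trans (List.prefix_append _ _)).trans (hstep j (i + d + 1) h)
  refine ⟨ν, ?_, ?_, fun l => (hν' l).2.1, ?_, ?_⟩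
  · intro j i hi
    have h0 : start j <+: ν (j * R + 0) := by
      have := (hν' (j * R)).1
      have hmod : (j * R) % R = 0 := Nat.mul_mod_left _ _
      simp only [root, dif_pos hmod] at this
      rwa [Nat.mul_div_cancel _ (by omega)] at this
    rcases i with _ | i
    · exact h0
    · have := hchain j 0 i (by omega)
      rw [zero_add] at this
      exact (h0.trans (List.prefix_append _ _)).trans this
  · intro j i i' h h'
    obtain ⟨d, rfl⟩ := Nat.exists_eq_add_of_lt h
    have := hchain j i d h'
    refine ⟨(List.prefix_append _ _).trans this, fun he => ?_⟩
    rw [← he] at this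
    have := this.length_le
    simp at this
  · intro k l hkl Q hQ
    exact (hν' l).2.2.1 ⟨k, hkl⟩ Q hQ
  · intro g hgW hgI s hs
    refine card_roots_le W I (fun l => a (ν l)) (fun l s hsl hg => ?_) g hgW hgI s hs
    obtain ⟨g, hgW, hgI, hg⟩ := hg
    obtain ⟨g', h1, h2, h3⟩ := (hν' l).2.2.2 (Finset.univ.filter fun k : Fin l => (k : ℕ) ∈ s)
      ⟨g, hgW, hgI, fun k hk => hg _ (Finset.mem_filter.1 hk).2⟩
    exact ⟨g', h1, fun k hk => h2 ⟨k, hsl k hk⟩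
      (Finset.mem_filter.2 ⟨Finset.mem_univ _, hk⟩), h3⟩

end Tree

section Counting

theorem exists_swap {P T : Type*} [Fintype P] {N R h : ℕ} (hR : 0 < R)
    (κ : (Fin N → Fin R) → Fin N → Option P) (cell : (Fin N → Fin R) → T) (S : Finset T)
    (hS : ∀ f, cell f ∈ S) (hbad : ∀ f, Nat.card {j // κ f j = none} ≤ h)
    (hlt : (Fintype.card P + 1) ^ N * S.card * R ^ h < R ^ N) :
    ∃ f f' j, κ f = κ f' ∧ cell f = cell f' ∧ κ f j ≠ none ∧ f j < f' j := by
  classical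
  obtain ⟨⟨k, c⟩, hkc, hfib⟩ := Finset.exists_lt_card_fiber_of_mul_lt_card_of_maps_to
    (s := (Finset.univ : Finset (Fin N → Fin R)))
    (t := (Finset.univ : Finset (Fin N → Option P)) ×ˢ S) (f := fun f => (κ f, cell f))
    (n := R ^ h) (fun f _ => Finset.mem_product.2 ⟨Finset.mem_univ _, hS f⟩) (by
      rw [Finset.card_product, Finset.card_univ, Finset.card_univ, Fintype.card_fun,
        Fintype.card_fun, Fintype.card_option, Fintype.card_fin, Fintype.card_fin]
      exact hlt)
  by_contra hcon
  push Not at hcon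
  have hagree : ∀ f ∈ Finset.univ.filter (fun f => (κ f, cell f) = (k, c)),
      ∀ f' ∈ Finset.univ.filter (fun f => (κ f, cell f) = (k, c)), ∀ j, k j ≠ none →
        f j = f' j := by
    intro f hf f' hf' j hj
    have e := (Finset.mem_filter.1 hf).2
    have e' := (Finset.mem_filter.1 hf').2
    simp only [Prod.mk.injEq] at e e'
    refine le_antisymm (hcon f' f j (e'.1.trans e.1.symm) (e'.2.trans e.2.symm) ?_)
      (hcon f f' j (e.1.trans e'.1.symm) (e.2.trans e'.2.symm) ?_)
    · rwa [e'.1]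
    · rwa [e.1]
  refine absurd hfib (not_lt.2 ?_)
  rcases Finset.eq_empty_or_nonempty (Finset.univ.filter (fun f => (κ f, cell f) = (k, c)))
    with he | ⟨f₀, hf₀⟩
  · rw [he]; simp
  have hk : κ f₀ = k := by
    have := (Finset.mem_filter.1 hf₀).2
    simp only [Prod.mk.injEq] at this
    exact this.1
  have h1 := Finset.card_le_card_of_injOn
    (s := Finset.univ.filter (fun f => (κ f, cell f) = (k, c)))
    (t := (Finset.univ : Finset ({j // k j = none} → Fin R)))
    (fun f j => f j) (fun _ _ => Finset.mem_coe.2 (Finset.mem_univ _)) (by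
      intro f hf f' hf' hff
      funext j
      by_cases hj : k j = none
      · exact congrFun hff ⟨j, hj⟩
      · exact hagree f hf f' hf' j hj)
  refine h1.trans ?_
  rw [Finset.card_univ, Fintype.card_fun, Fintype.card_fin]
  refine Nat.pow_le_pow_right hR ?_
  have := hbad f₀
  rwa [hk, Nat.card_eq_fintype_card] at this

theorem exists_pow_mul_lt (c d k A : ℕ) : ∃ N : ℕ, (c * N + d) ^ k * A < 2 ^ N := by
  have h := tendsto_pow_const_div_const_pow_of_one_lt k (r := (2 : ℝ)) one_lt_two
  have h' := h.const_mul (((c + d : ℕ) : ℝ) ^ k * A)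
  rw [mul_zero] at h'
  obtain ⟨N, hN, hN1⟩ := ((h'.eventually (gt_mem_nhds one_pos)).and (eventually_ge_atTop 1)).exists
  refine ⟨N, ?_⟩
  have h2 : (0 : ℝ) < 2 ^ N := by positivity
  rw [← mul_div_assoc, div_lt_one h2] at hN
  have h3 : (c * N + d) ^ k * A ≤ (c + d) ^ k * A * N ^ k := by
    have : c * N + d ≤ (c + d) * N := by nlinarith
    calc (c * N + d) ^ k * A ≤ ((c + d) * N) ^ k * A := by gcongr
      _ = _ := by rw [mul_pow]; ring
  refine lt_of_le_of_lt h3 ?_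
  exact_mod_cast hN

end Counting

section Cells

variable {C : Type*} [Field C] {R : C → C → C → Prop}

open Classical in
/-- The position of an element relative to a finite set of points of a circularly ordered field. -/
noncomputable def cellCode (R : C → C → C → Prop) (P : Finset C) (x : C) : Option C × ℕ :=
  (if x ∈ insert 0 (insert 1 P) then some x else none, (P.filter fun p => R 1 p x).card)

theorem cellCode_spec (hR : IsCircField R) (P : Finset C) {x y : C}
    (h : cellCode R P x = cellCode R P y) {z w : C} (hz : z ∈ P) (hw : w ∈ P) :
    R z x w ↔ R z y w := by
  classical
  obtain ⟨h1, h2⟩ := Prod.mk.inj h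
  by_cases hx : x ∈ insert 0 (insert 1 P)
  · rw [if_pos hx] at h1
    split_ifs at h1 with hy
    rw [Option.some.inj h1]
  rw [if_neg hx] at h1
  split_ifs at h1 with hy
  simp only [Finset.mem_insert, not_or] at hx hy
  have ht := fun {a b c} => hR.total a b c
  have hc := fun {a b c} => hR.cyc a b c
  have ha := fun {a b c} => hR.asymm a b c
  have htr := fun {a b c d} => hR.trans a b c d
  have hn := fun {a b c} => hR.ne_zero a b c
  by_cases hz0 : z = 0
  · exact ⟨fun h => absurd hz0 (hn h).1, fun h => absurd hz0 (hn h).1⟩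
  by_cases hw0 : w = 0
  · exact ⟨fun h => absurd hw0 (hn h).2.2, fun h => absurd hw0 (hn h).2.2⟩
  have hlin : ∀ x y : C, x ≠ 0 → y ≠ 0 → x ≠ 1 → y ≠ 1 → R 1 x y ∨ R 1 y x ∨ x = y := by
    intro x y hx hy hx1 hy1
    by_cases hxy : x = y
    · exact Or.inr (Or.inr hxy)
    · rcases ht one_ne_zero hx hy (Ne.symm hx1) hxy (Ne.symm hy1) with h | h
      · exact Or.inl h
      · exact Or.inr (Or.inl (hc (hc h)))
  have hbetween : ∀ p q r : C, R 1 p q → R 1 q r → R p q r := fun p q r h h' =>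
    hc (hc (htr (hc h') (hc (hc h))))
  have hasymm : ∀ p q : C, R 1 p q → ¬ R 1 q p := fun p q h h' => ha h (hc h')
  have key : ∀ p ∈ P, R 1 p x ↔ R 1 p y := by
    have hsub : ∀ x y : C, R 1 x y → ∀ p, R 1 p x → R 1 p y := fun x y hxy p hp => htr hp hxy
    rcases hlin x y hx.1 hy.1 hx.2.1 hy.2.1 with hxy | hxy | hxy
    · have := Finset.eq_of_subset_of_card_le
        (Finset.monotone_filter_right P (fun p _ => hsub x y hxy p)) h2.ge
      intro p hp
      have := Finset.ext_iff.1 this p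
      simpa [hp] using this
    · have := Finset.eq_of_subset_of_card_le
        (Finset.monotone_filter_right P (fun p _ => hsub y x hxy p)) h2.le
      intro p hp
      have := Finset.ext_iff.1 this p
      simpa [hp] using this.symm
    · rw [hxy]; exact fun _ _ => Iff.rfl
  have main : ∀ x y : C, x ≠ 0 → y ≠ 0 → x ≠ 1 → y ≠ 1 → x ∉ P → y ∉ P →
      (∀ p ∈ P, R 1 p x ↔ R 1 p y) → R z x w → R z y w := by
    intro x y hx0 hy0 hx1 hy1 hxP hyP key h
    have e1 := key z hz
    have e2 := key w hw
    have hyz : y ≠ z := fun h => hyP (h ▸ hz)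
    have hyw : y ≠ w := fun h => hyP (h ▸ hw)
    have hzw : z ≠ w := by rintro rfl; exact ha h h
    by_contra hcon
    by_cases hz1 : z = 1
    · subst hz1
      have : R 1 w y := hc (hc ((ht one_ne_zero hy0 hw0 (Ne.symm hy1) hyw hzw).resolve_left
        hcon))
      exact hasymm _ _ h (e2.2 this)
    by_cases hw1 : w = 1
    · subst hw1
      exact hcon (hc (e1.1 (hc (hc h))))
    have hxz : x ≠ z := fun h => hxP (h ▸ hz)
    have hxw : x ≠ w := fun h => hxP (h ▸ hw)
    have lzy := (hlin z y hz0 hy0 hz1 hy1)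
    have lwy := (hlin w y hw0 hy0 hw1 hy1)
    have lzx := (hlin z x hz0 hx0 hz1 hx1)
    have lwx := (hlin w x hw0 hx0 hw1 hx1)
    rcases hlin z w hz0 hw0 hz1 hw1 with hzw' | hwz | rfl
    · have i1 : R 1 z x := hc (hc (htr h (hc hzw')))
      have i2 : R 1 x w := hc (htr (hc (hc hzw')) (hc (hc h)))
      have i3 : ¬ R 1 w y := fun h => hasymm _ _ i2 (e2.2 h)
      have i4 : R 1 y w := (lwy.resolve_left i3).resolve_right (Ne.symm hyw)
      exact hcon (hbetween _ _ _ (e1.1 i1) i4)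
    · by_cases hzx : R 1 z x
      · exact hcon (hc (hbetween _ _ _ hwz (e1.1 hzx)))
      · have i1 : R 1 x z := (lzx.resolve_left hzx).resolve_right (Ne.symm hxz)
        have i2 : ¬ R 1 w x := fun h' => ha h (hbetween _ _ _ h' i1)
        have i3 : ¬ R 1 w y := fun h => i2 (e2.2 h)
        have i4 : R 1 y w := (lwy.resolve_left i3).resolve_right (Ne.symm hyw)
        exact hcon (hc (hc (hbetween _ _ _ i4 hwz)))
    · exact hzw rfl
  exact ⟨main x y hx.1 hy.1 hx.2.1 hy.2.1 hx.2.2 hy.2.2 key,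
    main y x hy.1 hx.1 hy.2.1 hx.2.1 hy.2.2 hx.2.2 fun p hp => (key p hp).symm⟩

open Classical in
theorem cellCode_mem (R : C → C → C → Prop) (P : Finset C) (x : C) :
    cellCode R P x ∈ Finset.insertNone (insert 0 (insert 1 P)) ×ˢ Finset.range (P.card + 1) := by
  unfold cellCode
  refine Finset.mem_product.2 ⟨?_, Finset.mem_range.2 (Nat.lt_succ_of_le (Finset.card_filter_le _ _))⟩
  by_cases hx : x ∈ insert 0 (insert 1 P)
  · simp only [if_pos hx]
    exact Finset.some_mem_insertNone.2 hx
  · simp only [if_neg hx]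
    exact Finset.none_mem_insertNone

end Cells

section Pairs

/-- The first branching nodes of the comb above `ρ₀`. -/
def combNode (ρ₀ : List Bool) (j : ℕ) : List Bool := ρ₀ ++ (List.replicate j false ++ [true])

theorem replicate_prefix_injective : ∀ {j j' : ℕ},
    List.replicate j false ++ [true] <+: List.replicate j' false ++ [true] → j = j'
  | 0, 0, _ => rfl
  | 0, j' + 1, h => by simp [List.replicate_succ] at h
  | j + 1, 0, h => by simp [List.replicate_succ] at h
  | j + 1, j' + 1, h => by
    simp only [List.replicate_succ, List.cons_append, List.cons_prefix_cons, true_and] at h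
    rw [replicate_prefix_injective h]

theorem combNode_prefix_injective {ρ₀ ν ν' : List Bool} {j j' : ℕ} (h : combNode ρ₀ j <+: ν)
    (h' : combNode ρ₀ j' <+: ν') (hν : TreeComparable ν ν') : j = j' := by
  wlog hle : ν <+: ν' generalizing j j' ν ν'
  · exact (this h' h (Or.symm hν) (hν.resolve_left hle)).symm
  have h1 := h.trans hle
  rcases le_total (combNode ρ₀ j).length (combNode ρ₀ j').length with hl | hl
  · exact replicate_prefix_injective
      ((List.prefix_append_right_inj _).1 (List.prefix_of_prefix_length_le h1 h' hl))
  · exact (replicate_prefix_injective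
      ((List.prefix_append_right_inj _).1 (List.prefix_of_prefix_length_le h' h1 hl))).symm

theorem polyAt_mem_span {C D : Type*} [Field C] {m : ℕ} (M : Set (Fin m →₀ ℕ))
    (Q : MvPolynomial (Fin m) (D → C)) (hQ : ↑Q.support ⊆ M) (b : D) :
    polyAt Q b ∈ Submodule.span C ((fun e => MvPolynomial.monomial e (1 : C)) '' M) := by
  rw [(polyAt Q b).as_sum]
  refine Submodule.sum_mem _ fun e he => ?_
  have he' : e ∈ M := hQ (MvPolynomial.support_map_subset _ _ he)
  have : MvPolynomial.monomial e (MvPolynomial.coeff e (polyAt Q b)) =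
      MvPolynomial.coeff e (polyAt Q b) • MvPolynomial.monomial e (1 : C) := by
    rw [MvPolynomial.smul_monomial, smul_eq_mul, mul_one]
  rw [this]
  exact Submodule.smul_mem _ _ (Submodule.subset_span ⟨e, he', rfl⟩)

variable {C : Type*} [Field C] {RC : C → C → C → Prop} {n m : ℕ}

theorem exists_independent_pair (hRC : IsCircField RC) (Φ : (Fin n → C) → (Fin m → C) → Prop)
    (a : List Bool → Fin m → C)
    (hanti : ∀ X : Finset (List Bool), IsTreeAntichain ↑X → ∃ b, ∀ η ∈ X, Φ b (a η))
    (hcomp : ∀ η ν, η ≠ ν → TreeComparable η ν → ¬ ∃ b, Φ b (a η) ∧ Φ b (a ν))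
    {I : Ideal (MvPolynomial (Fin m) C)} {ρ₀ : List Bool}
    (hI : ∀ (G : Finset (MvPolynomial (Fin m) C)), (∀ g ∈ G, g ∉ I) → ∀ ρ, ρ₀ <+: ρ →
        ∃ ν, ρ <+: ν ∧ (∀ g ∈ I, MvPolynomial.eval (a ν) g = 0) ∧
          ∀ g ∈ G, MvPolynomial.eval (a ν) g ≠ 0)
    (S : Finset (Set ((Fin n → C) × (Fin m → C))))
    (Qx : Finset (MvPolynomial (Fin m) ((Fin n → C) → C)))
    (Qy : Finset (MvPolynomial (Fin m) ((Fin m → C) → C)))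
    (Tx : Finset ((Fin n → C) → C)) (Ty : Finset ((Fin m → C) → C)) :
    ∃ (a a' : Fin m → C) (b b' : Fin n → C),
      Φ b a ∧ Φ b' a' ∧ (¬ ∃ x, Φ x a ∧ Φ x a') ∧
      (∀ s ∈ S, (b, a) ∈ s ↔ (b', a') ∈ s) ∧
      (∀ Q ∈ Qx, MvPolynomial.eval a (polyAt Q b) = 0 → polyAt Q b ∈ I) ∧
      (∀ Q ∈ Qy, MvPolynomial.eval a' (polyAt Q a) = 0 → polyAt Q a ∈ I) ∧
      (∀ s ∈ Ty, ∀ s' ∈ Ty, ∀ t ∈ Tx, (RC (s a) (t b) (s' a) ↔ RC (s a) (t b') (s' a))) ∧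
      (∀ g ∈ I, MvPolynomial.eval a g = 0) ∧ (∀ g ∈ I, MvPolynomial.eval a' g = 0) := by
  classical
  let M : Finset (Fin m →₀ ℕ) := Qx.biUnion fun Q => Q.support
  let W : Submodule C (MvPolynomial (Fin m) C) :=
    Submodule.span C ((fun e => MvPolynomial.monomial e (1 : C)) '' (M : Set _))
  have hWfin : FiniteDimensional C W := FiniteDimensional.span_of_finite C (M.finite_toSet.image _)
  have hW : ∀ Q ∈ Qx, ∀ b, polyAt Q b ∈ W := fun Q hQ b =>
    polyAt_mem_span _ Q (by
      intro e he
      exact Finset.mem_coe.2 (Finset.mem_biUnion.2 ⟨Q, hQ, he⟩)) b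
  let h := Qx.card * Module.finrank C W
  let q := Fintype.card (Set S)
  let R := 2 * (q + 1)
  have hR : 0 < R := by positivity
  obtain ⟨N, hN⟩ := exists_pow_mul_lt (Ty.card * R) 3 (2 * Tx.card) (R ^ h)
  obtain ⟨ν, hν1, hν2, hν3, hν4, hν5⟩ := exists_generic_array a hI Qy W R (combNode ρ₀)
    (fun j => List.prefix_append _ _)
  let node : Fin N → Fin R → Fin m → C := fun j i => a (ν (j * R + i))
  have hb : ∀ f : Fin N → Fin R, ∃ b, ∀ j, Φ b (node j (f j)) := by
    intro f
    obtain ⟨b, hb⟩ := hanti (Finset.univ.image fun j : Fin N => ν (j * R + f j)) (by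
      intro η hη η' hη' hne hc
      simp only [Finset.coe_image, Finset.coe_univ, Set.image_univ, Set.mem_range] at hη hη'
      obtain ⟨j, rfl⟩ := hη
      obtain ⟨j', rfl⟩ := hη'
      have := Fin.ext (combNode_prefix_injective (hν1 j (f j) (f j).2) (hν1 j' (f j') (f j').2) hc)
      exact hne (by rw [this]))
    exact ⟨b, fun j => hb _ (Finset.mem_image_of_mem _ (Finset.mem_univ j))⟩
  choose b hb using hb
  let Pts : Finset C := (Ty ×ˢ (Finset.univ ×ˢ Finset.univ)).image
    fun r : ((Fin m → C) → C) × Fin N × Fin R => r.1 (node r.2.1 r.2.2)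
  have hPts : Pts.card ≤ Ty.card * R * N := by
    refine Finset.card_image_le.trans ?_
    rw [Finset.card_product, Finset.card_product, Finset.card_univ, Finset.card_univ,
      Fintype.card_fin, Fintype.card_fin]
    exact le_of_eq (by ring)
  let good : (Fin N → Fin R) → Fin N → Prop := fun f j => ∀ Q ∈ Qx,
    MvPolynomial.eval (node j (f j)) (polyAt Q (b f)) = 0 → polyAt Q (b f) ∈ I
  let κ : (Fin N → Fin R) → Fin N → Option (Set S) := fun f j =>
    if good f j then some {s | (b f, node j (f j)) ∈ s.1} else none
  let cell : (Fin N → Fin R) → Tx → Option C × ℕ := fun f t => cellCode RC Pts (t.1 (b f))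
  have hinj : ∀ f : Fin N → Fin R, Function.Injective fun j : Fin N => (j : ℕ) * R + f j := by
    intro f j j' hjj
    have := congrArg (· / R) hjj
    simp only [mul_comm _ R] at this
    rw [Nat.mul_add_div hR, Nat.mul_add_div hR, Nat.div_eq_of_lt (f j).2,
      Nat.div_eq_of_lt (f j').2] at this
    exact Fin.ext (by simpa using this)
  have hbad : ∀ f, Nat.card {j // κ f j = none} ≤ h := by
    intro f
    rw [Nat.card_eq_fintype_card, Fintype.card_subtype]
    have hsub : (Finset.univ.filter fun j => κ f j = none) ⊆ Qx.biUnion fun Q =>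
        Finset.univ.filter fun j =>
          MvPolynomial.eval (node j (f j)) (polyAt Q (b f)) = 0 ∧ polyAt Q (b f) ∉ I := by
      intro j hj
      have hj' : ¬ good f j := fun hg => by simp [κ, hg] at hj
      simp only [good] at hj'
      push Not at hj'
      obtain ⟨Q, hQ, h1, h2⟩ := hj'
      exact Finset.mem_biUnion.2 ⟨Q, hQ, Finset.mem_filter.2 ⟨Finset.mem_univ _, h1, h2⟩⟩
    refine (Finset.card_le_card hsub).trans (Finset.card_biUnion_le_card_mul _ _ _ fun Q hQ => ?_)
    by_cases hQI : polyAt Q (b f) ∈ I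
    · simp [hQI]
    rw [← Finset.card_image_of_injective _ (hinj f)]
    refine hν5 (polyAt Q (b f)) (hW Q hQ _) hQI _ fun l hl => ?_
    obtain ⟨j, hj, rfl⟩ := Finset.mem_image.1 hl
    exact (Finset.mem_filter.1 hj).2.1
  let codes : Finset (Option C × ℕ) :=
    Finset.insertNone (insert 0 (insert 1 Pts)) ×ˢ Finset.range (Pts.card + 1)
  have hcodes : codes.card ≤ (Ty.card * R * N + 3) ^ 2 := by
    have h1 : (insert (0 : C) (insert 1 Pts)).card ≤ Pts.card + 2 :=
      (Finset.card_insert_le _ _).trans (Nat.succ_le_succ (Finset.card_insert_le _ _))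
    rw [Finset.card_product, Finset.card_insertNone, Finset.card_range, pow_two]
    exact Nat.mul_le_mul (by omega) (by omega)
  obtain ⟨f, f', j, hκ, hcell, hgood, hlt⟩ := exists_swap hR κ cell
    (Fintype.piFinset fun _ => codes)
    (fun f => Fintype.mem_piFinset.2 fun t => by
      convert cellCode_mem RC Pts (t.1 (b f))) hbad (by
      rw [Fintype.card_piFinset, Finset.prod_const, Finset.card_univ, Fintype.card_coe]
      have h1 : codes.card ^ Tx.card * R ^ h < 2 ^ N := by
        refine lt_of_le_of_lt (Nat.mul_le_mul_right _ (Nat.pow_le_pow_left hcodes _)) ?_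
        rw [← pow_mul]
        exact hN
      have h2 : R ^ N = (q + 1) ^ N * 2 ^ N := by rw [← mul_pow, mul_comm]
      rw [h2, mul_assoc]
      exact Nat.mul_lt_mul_of_pos_left h1 (by positivity))
  have hg : good f j := by
    by_contra hg
    exact hgood (by simp [κ, hg])
  have hg' : good f' j := by
    by_contra hg'
    exact hgood (by rw [hκ]; simp [κ, hg'])
  have hpat : ∀ s ∈ S, (b f, node j (f j)) ∈ s ↔ (b f', node j (f' j)) ∈ s := by
    intro s hs
    have := congrFun hκ j
    simp only [κ, if_pos hg, if_pos hg', Option.some.injEq] at this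
    exact Set.ext_iff.1 this ⟨s, hs⟩
  have hn := hν2 j (f j) (f' j) hlt (f' j).2
  refine ⟨node j (f j), node j (f' j), b f, b f', hb f j, hb f' j,
    hcomp _ _ hn.2 (Or.inl hn.1), hpat, hg, ?_, ?_, hν3 _, hν3 _⟩
  · intro Q hQ h0
    by_contra hQI
    exact hν4 _ _ (Nat.add_lt_add_left hlt _) Q hQ hQI h0
  · intro s hs s' hs' t ht
    have hmem : ∀ s ∈ Ty, s (node j (f j)) ∈ Pts := fun s hs =>
      Finset.mem_image.2 ⟨(s, j, f j), Finset.mem_product.2 ⟨hs, Finset.mem_univ _⟩, rfl⟩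
    exact cellCode_spec hRC Pts (congrFun hcell ⟨t, ht⟩) (hmem s hs) (hmem s' hs')

end Pairs

/-- No formula has an infinite tree of parameters witnessing the antichain tree property in a
model of the model companion. -/
theorem no_antichain_tree {TA : Lt.Theory}
    (hTA : IsModelCompanionOfClass.{u} TA (fun F SF => IsACFOminus F SF))
    {C : Type u} [Field C] [IsAlgClosed C] {n m : ℕ}
    {RC : C → C → C → Prop} (hRC : IsCircField RC)
    (hmod : @Theory.Model Lt C (ltOf C RC) TA) (φ : Lt.Formula (Fin n ⊕ Fin m))
    (a : List Bool → Fin m → C)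
    (hanti : ∀ X : Finset (List Bool), IsTreeAntichain ↑X →
      ∃ b, ∀ η ∈ X, RealizeIn RC φ (Sum.elim b (a η)))
    (hcomp : ∀ η ν, η ≠ ν → TreeComparable η ν →
      ¬ ∃ b, RealizeIn RC φ (Sum.elim b (a η)) ∧ RealizeIn RC φ (Sum.elim b (a ν))) : False := by
  classical
  obtain ⟨I, ρ₀, hI⟩ := exists_generic_ideal a
  let Δ : Type u := Finset (Set ((Fin n → C) × (Fin m → C))) ×
    Finset (MvPolynomial (Fin m) ((Fin n → C) → C)) ×
    Finset (MvPolynomial (Fin m) ((Fin m → C) → C)) ×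
    Finset ((Fin n → C) → C) × Finset ((Fin m → C) → C)
  choose x x' b b' h using fun d : Δ => exists_independent_pair hRC
    (fun b a => RealizeIn RC φ (Sum.elim b a)) a hanti hcomp hI d.1 d.2.1 d.2.2.1 d.2.2.2.1
    d.2.2.2.2
  let U : Ultrafilter Δ := Ultrafilter.of atTop
  have hU : ∀ {P : Δ → Prop} (d : Δ), (∀ e, d ≤ e → P e) → ∀ᶠ e in U, P e := fun d hd =>
    Ultrafilter.of_le atTop ((eventually_ge_atTop d).mono hd)
  refine not_independent_limit hTA hRC hmod φ U x x' b b' I (fun t => (h t).1)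
    (fun t => (h t).2.1) (fun t => (h t).2.2.1) ?_ ?_ ?_ ?_ (fun t => (h t).2.2.2.2.2.2.2.1)
    (fun t => (h t).2.2.2.2.2.2.2.2)
  · intro S
    exact hU ({S}, ∅, ∅, ∅, ∅) fun e he => (h e).2.2.2.1 S
      (he.1 (Finset.mem_singleton_self S))
  · intro Q
    exact hU (∅, {Q}, ∅, ∅, ∅) fun e he => (h e).2.2.2.2.1 Q
      (he.2.1 (Finset.mem_singleton_self Q))
  · intro Q
    exact hU (∅, ∅, {Q}, ∅, ∅) fun e he => (h e).2.2.2.2.2.1 Q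
      (he.2.2.1 (Finset.mem_singleton_self Q))
  · intro s s' τ
    exact hU (∅, ∅, ∅, {τ}, {s, s'}) fun e he => (h e).2.2.2.2.2.2.1 s
      (he.2.2.2.2 (by simp)) s' (he.2.2.2.2 (by simp)) τ (he.2.2.2.1 (Finset.mem_singleton_self τ))

/-- No formula has antichain trees of all finite depths in a model of the model companion. -/
theorem no_finite_antichain_trees {TA : Lt.Theory}
    (hTA : IsModelCompanionOfClass.{u} TA (fun F SF => IsACFOminus F SF))
    {C : Type u} [Field C] [IsAlgClosed C] {n m : ℕ}
    {RC : C → C → C → Prop} (hRC : IsCircField RC)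
    (hmod : @Theory.Model Lt C (ltOf C RC) TA) (φ : Lt.Formula (Fin n ⊕ Fin m))
    (a : ℕ → List Bool → Fin m → C)
    (hanti : ∀ d, ∀ X : Finset (List Bool), (∀ η ∈ X, η.length ≤ d) → IsTreeAntichain ↑X →
      ∃ b, ∀ η ∈ X, RealizeIn RC φ (Sum.elim b (a d η)))
    (hcomp : ∀ d η ν, η.length ≤ d → ν.length ≤ d → η ≠ ν → TreeComparable η ν →
      ¬ ∃ b, RealizeIn RC φ (Sum.elim b (a d η)) ∧ RealizeIn RC φ (Sum.elim b (a d ν))) :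
    False := by
  let U : Ultrafilter ℕ := hyperfilter ℕ
  have hge : ∀ N : ℕ, ∀ᶠ d in U, N ≤ d := fun N => by
    have : ∀ᶠ d in (hyperfilter ℕ : Filter ℕ), N ≤ d :=
      Nat.hyperfilter_le_atTop (eventually_ge_atTop N)
    exact this
  have hcl := isAlgClosed_germ U C
  have hgerm : ∀ (b : ℕ → Fin n → C) (η : List Bool),
      RealizeIn (germRel U RC) φ (Sum.elim
        (fun j => ((fun d => b d j : ℕ → C) : Germ (U : Filter ℕ) C))
        (fun k => ((fun d => a d η k : ℕ → C) : Germ (U : Filter ℕ) C))) ↔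
        ∀ᶠ d in U, RealizeIn RC φ (Sum.elim (b d) (a d η)) := by
    intro b η
    have := realizeIn_germ U RC φ (fun i d => Sum.elim (b d) (a d η) i)
    convert this using 1
    refine iff_of_eq (congrArg _ ?_)
    funext i
    rcases i with i | i <;> rfl
  refine no_antichain_tree hTA (hRC.germ U) (model_germ U RC TA hmod) φ
    (fun η k => ((fun d => a d η k : ℕ → C) : Germ (U : Filter ℕ) C)) ?_ ?_
  · intro X hX
    have hex : ∀ d, ∃ b, (∀ η ∈ X, η.length ≤ d) →
        ∀ η ∈ X, RealizeIn RC φ (Sum.elim b (a d η)) := by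
      intro d
      by_cases h : ∀ η ∈ X, η.length ≤ d
      · obtain ⟨b, hb⟩ := hanti d X h hX
        exact ⟨b, fun _ => hb⟩
      · exact ⟨fun _ => 0, fun h' => absurd h' h⟩
    choose b hb using hex
    refine ⟨fun j => ((fun d => b d j : ℕ → C) : Germ (U : Filter ℕ) C), fun η hη =>
      (hgerm b η).2 ?_⟩
    exact (hge (X.sup List.length)).mono fun d hd =>
      hb d (fun η hη => (Finset.le_sup (f := List.length) hη).trans hd) η hη
  · rintro η ν hne hc ⟨z, h1, h2⟩
    choose w hw using fun j => Quotient.exists_rep (z j)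
    obtain rfl : (fun j => ((fun d => w j d : ℕ → C) : Germ (U : Filter ℕ) C)) = z :=
      funext hw
    obtain ⟨d, ⟨⟨h1, h2⟩, h3⟩, h4⟩ := ((((hgerm (fun d j => w j d) η).1 h1).and
      ((hgerm (fun d j => w j d) ν).1 h2)).and (hge η.length) |>.and (hge ν.length)).exists
    exact hcomp d η ν h3 h4 hne hc ⟨_, h1, h2⟩

section Transfer

theorem exists_agreeing_tuple {L : FirstOrder.Language.{0, 0}} {M N : Type*} [L.Structure M]
    [L.Structure N] (h : ∀ σ : L.Sentence, M ⊨ σ → N ⊨ σ) {α κ : Type} [Finite α] [Finite κ]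
    (θ : κ → L.Formula α) (v : α → M) :
    ∃ w : α → N, ∀ k, (θ k).Realize w ↔ (θ k).Realize v := by
  classical
  let ψ : L.Formula α := Formula.iInf fun k => if (θ k).Realize v then θ k else (θ k).not
  have hM : M ⊨ (Formula.iExs α (ψ.relabel (Sum.inr : α → Empty ⊕ α)) : L.Formula Empty) := by
    refine Formula.realize_iExs.2 ⟨v, ?_⟩
    rw [Formula.realize_relabel]
    refine Formula.realize_iInf.2 fun k => ?_
    by_cases hk : (θ k).Realize v
    · rw [if_pos hk]; exact hk
    · rw [if_neg hk]; exact Formula.realize_not.2 hk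
  obtain ⟨w, hw⟩ := Formula.realize_iExs.1 (h _ hM)
  rw [Formula.realize_relabel] at hw
  refine ⟨w, fun k => ?_⟩
  have := Formula.realize_iInf.1 hw k
  by_cases hk : (θ k).Realize v
  · rw [if_pos hk] at this
    exact iff_of_true this hk
  · rw [if_neg hk] at this
    exact iff_of_false (Formula.realize_not.1 this) hk

/-- The formula expressing that the instances of `φ` indexed by a finite set are consistent. -/
noncomputable def consistencyFormula {L : FirstOrder.Language.{0, 0}} {n m : ℕ} {J : Type}
    (φ : L.Formula (Fin n ⊕ Fin m)) (X : Finset J) : L.Formula (J × Fin m) :=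
  Formula.iExs (Fin n) (Formula.iInf fun η : X =>
    φ.relabel (Sum.elim Sum.inr fun k => Sum.inl (η.1, k)))

theorem realize_consistencyFormula {L : FirstOrder.Language.{0, 0}} {n m : ℕ} {J : Type}
    (φ : L.Formula (Fin n ⊕ Fin m)) (X : Finset J) {K : Type*} [L.Structure K]
    (w : J × Fin m → K) : (consistencyFormula φ X).Realize w ↔
      ∃ b : Fin n → K, ∀ η ∈ X, φ.Realize (Sum.elim b fun k => w (η, k)) := by
  simp only [consistencyFormula, Formula.realize_iExs, Formula.realize_iInf,
    Formula.realize_relabel]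
  refine exists_congr fun b => ⟨fun H η hη => ?_, fun H η => ?_⟩
  · convert H ⟨η, hη⟩ using 1
    funext i
    rcases i with i | i <;> rfl
  · convert H η.1 η.2 using 1
    funext i
    rcases i with i | i <;> rfl

theorem exists_finite_antichain_tree {L : FirstOrder.Language.{0, 0}} {M N : Type*}
    [L.Structure M] [L.Structure N] (h : ∀ σ : L.Sentence, M ⊨ σ → N ⊨ σ) {n m : ℕ}
    {φ : L.Formula (Fin n ⊕ Fin m)} {a : List Bool → Fin m → M} (ha : ATPWitness φ a) (d : ℕ) :
    ∃ a' : List Bool → Fin m → N,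
      (∀ X : Finset (List Bool), (∀ η ∈ X, η.length ≤ d) → IsTreeAntichain ↑X →
        ∃ b : Fin n → N, ∀ η ∈ X, φ.Realize (Sum.elim b (a' η))) ∧
      (∀ η ν, η.length ≤ d → ν.length ≤ d → η ≠ ν → TreeComparable η ν →
        ¬ ∃ b : Fin n → N, φ.Realize (Sum.elim b (a' η)) ∧ φ.Realize (Sum.elim b (a' ν))) := by
  classical
  have hfin : Finite {η : List Bool // η.length ≤ d} := List.finite_length_le Bool d
  obtain ⟨w, hw⟩ := exists_agreeing_tuple h
    (consistencyFormula φ (J := {η : List Bool // η.length ≤ d})) (fun p => a p.1.1 p.2)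
  simp only [realize_consistencyFormula] at hw
  let a' : List Bool → Fin m → N := fun η k =>
    if hη : η.length ≤ d then w (⟨η, hη⟩, k) else w (⟨[], Nat.zero_le d⟩, k)
  have ha' : ∀ η (hη : η.length ≤ d), a' η = fun k => w (⟨η, hη⟩, k) := fun η hη =>
    funext fun k => dif_pos hη
  refine ⟨a', fun X hX hanti => ?_, fun η ν hη hν hne hc => ?_⟩
  · obtain ⟨b, hb⟩ := ha.1 X hanti
    obtain ⟨b', hb'⟩ := (hw (X.subtype fun η => η.length ≤ d)).2
      ⟨b, fun η hη => hb η (Finset.mem_subtype.1 hη)⟩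
    refine ⟨b', fun η hη => ?_⟩
    rw [ha' η (hX η hη)]
    exact hb' ⟨η, hX η hη⟩ (Finset.mem_subtype.2 hη)
  · rintro ⟨b, h1, h2⟩
    rw [ha' η hη] at h1
    rw [ha' ν hν] at h2
    obtain ⟨b', hb'⟩ := (hw {⟨η, hη⟩, ⟨ν, hν⟩}).1 ⟨b, fun ξ hξ => by
      rcases Finset.mem_insert.1 hξ with rfl | hξ
      · exact h1
      · rw [Finset.mem_singleton.1 hξ]; exact h2⟩
    exact ha.2 η ν hne hc ⟨b', hb' ⟨η, hη⟩ (by simp), hb' ⟨ν, hν⟩ (by simp)⟩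

end Transfer

section Translation

/-- The sum of a tuple of terms. -/
def sumTerm {α : Type*} : (k : ℕ) → (Fin k → Lt.Term α) → Lt.Term α
  | 0, _ => Term.func zeroSym (![] : Fin 0 → Lt.Term α)
  | k + 1, t => Term.func addSym ![sumTerm k fun i => t i.castSucc, t (Fin.last k)]

/-- The translation of terms of the punctured language. -/
def transTerm {α : Type*} : pmLang.{0}.Term α → Lt.Term α
  | .var i => .var i
  | @Term.func _ _ 0 _ _ => Term.func oneSym (![] : Fin 0 → Lt.Term α)
  | @Term.func _ _ 1 _ ts => Term.func invSym ![transTerm (ts 0)]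
  | @Term.func _ _ 2 _ ts => Term.func mulSym ![transTerm (ts 0), transTerm (ts 1)]
  | @Term.func _ _ (_ + 3) f _ => (show PEmpty from f).elim

/-- The translation of formulas of the punctured language. -/
def transFormula {α : Type*} : {k : ℕ} → pmLang.{0}.BoundedFormula α k → Lt.BoundedFormula α k
  | _, .falsum => .falsum
  | _, .equal t s => .equal (transTerm t) (transTerm s)
  | _, @BoundedFormula.rel _ _ _ n r ts =>
    match r with
    | Sum.inl h => .rel circSym ![transTerm (ts ⟨0, by have := h.down; omega⟩),
        transTerm (ts ⟨1, by have := h.down; omega⟩), transTerm (ts ⟨2, by have := h.down; omega⟩)]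
    | Sum.inr h => .equal
        (sumTerm (n - 1) fun i => transTerm (ts (Fin.castLE (by omega) i)))
        (transTerm (ts ⟨n - 1, by have := h.down; omega⟩))
  | _, .imp φ ψ => .imp (transFormula φ) (transFormula ψ)
  | k, .all φ => .all (.imp (.imp (.equal (.var (Sum.inr (Fin.last k)))
      (Term.func zeroSym (![] : Fin 0 → Lt.Term _))) .falsum) (transFormula φ))

variable {F : Type u} [Lt.Structure F] [Field F]

theorem realize_sumTerm (hF : LtCompat F) {α : Type*} (v : α → F) : ∀ (k : ℕ)
    (t : Fin k → Lt.Term α), (sumTerm k t).realize v = ∑ i, (t i).realize v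
  | 0, t => by
    rw [sumTerm, Term.realize, Fin.sum_univ_zero, ← hF.1]
    exact congrArg _ (Subsingleton.elim _ _)
  | k + 1, t => by
    rw [sumTerm, Term.realize, Fin.sum_univ_castSucc, ← realize_sumTerm hF v k, ← hF.2.2.2.2.1]
    refine congrArg _ (funext fun i => ?_)
    fin_cases i <;> rfl

theorem realize_transTerm (hF : LtCompat F) {α : Type*} (v : α → Punct F) (t : pmLang.{0}.Term α) :
    (transTerm t).realize (fun i => (v i).1) =
      (@Term.realize _ _ (punctStructure F) _ v t).1 := by
  let _ : pmLang.{0}.Structure (Punct F) := punctStructure F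
  induction t with
  | var i => rfl
  | @func n f ts ih =>
    match n, f, ts, ih with
    | 0, _, ts, _ =>
      rw [transTerm, Term.realize]
      refine Eq.trans ?_ hF.2.1
      exact congrArg _ (Subsingleton.elim _ _)
    | 1, _, ts, ih =>
      rw [transTerm, Term.realize]
      refine Eq.trans (congrArg _ ?_) ((hF.2.2.2.1 _).trans (congrArg _ (ih 0)))
      funext i
      fin_cases i
      rfl
    | 2, _, ts, ih =>
      rw [transTerm, Term.realize]
      refine Eq.trans (congrArg _ ?_) ((hF.2.2.2.2.2 _ _).trans (congrArg₂ _ (ih 0) (ih 1)))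
      funext i
      fin_cases i <;> rfl
    | _ + 3, f, _, _ => exact (show PEmpty from f).elim

theorem realize_transFormula (hF : LtCompat F) {α : Type*} (v : α → Punct F) {k : ℕ}
    (φ : pmLang.{0}.BoundedFormula α k) (xs : Fin k → Punct F) :
    (transFormula φ).Realize (fun i => (v i).1) (fun i => (xs i).1) ↔
      @BoundedFormula.Realize _ _ (punctStructure F) _ _ φ v xs := by
  let _ : pmLang.{0}.Structure (Punct F) := punctStructure F
  have hterm : ∀ {k : ℕ} (xs : Fin k → Punct F) (t : pmLang.{0}.Term (α ⊕ Fin k)),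
      (transTerm t).realize (Sum.elim (fun i => (v i).1) fun i => (xs i).1) =
        (t.realize (Sum.elim v xs)).1 := by
    intro k xs t
    rw [← realize_transTerm hF]
    congr 1
    funext i
    rcases i with i | i <;> rfl
  induction φ with
  | falsum => rfl
  | equal t s =>
    refine Iff.trans ?_ Subtype.ext_iff.symm
    exact iff_of_eq (congrArg₂ _ (hterm xs t) (hterm xs s))
  | @rel _ n r ts =>
    rcases r with h | h
    · have h3 := congr (congrArg₂ (circRel F) (hterm xs (ts ⟨0, by have := h.down; omega⟩))
        (hterm xs (ts ⟨1, by have := h.down; omega⟩)))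
        (hterm xs (ts ⟨2, by have := h.down; omega⟩))
      refine Iff.trans (iff_of_eq ?_) (iff_of_eq h3)
      refine congrArg (Structure.RelMap (M := F) circSym) ?_
      funext i
      fin_cases i <;> rfl
    · refine iff_of_eq (congrArg₂ _ ?_ (hterm xs _))
      rw [realize_sumTerm hF]
      exact Finset.sum_congr rfl fun i _ => hterm xs _
  | imp φ ψ ih1 ih2 => exact imp_congr (ih1 xs) (ih2 xs)
  | @all k φ ih =>
    have hzero : ∀ (w : α ⊕ Fin (k + 1) → F),
        (Term.func zeroSym (![] : Fin 0 → Lt.Term (α ⊕ Fin (k + 1)))).realize w = 0 := fun w => by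
      rw [Term.realize, ← hF.1]
      exact congrArg _ (Subsingleton.elim _ _)
    have hsnoc : ∀ x : Punct F, (fun i => ((Fin.snoc xs x : Fin (k + 1) → Punct F) i).1) =
        (Fin.snoc (fun i => (xs i).1) x.1 : Fin (k + 1) → F) := fun x => by
      funext i
      refine Fin.lastCases ?_ (fun i => ?_) i <;> simp
    have hx : ∀ x : Punct F, (transFormula φ).Realize (fun i => (v i).1)
        (Fin.snoc (fun i => (xs i).1) x.1 : Fin (k + 1) → F) ↔
        φ.Realize v (Fin.snoc xs x : Fin (k + 1) → Punct F) := fun x => by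
      rw [← hsnoc]
      exact ih (Fin.snoc xs x : Fin (k + 1) → Punct F)
    constructor
    · intro H x
      refine (hx x).1 (H x.1 fun h => x.2 ?_)
      have h' : (Sum.elim (fun i => (v i).1) (Fin.snoc (fun i => (xs i).1) x.1) :
        α ⊕ Fin (k + 1) → F) (Sum.inr (Fin.last k)) = _ := h
      rw [hzero] at h'
      simpa using h'
    · intro H x hne
      have hx0 : x ≠ 0 := by
        rintro rfl
        refine hne ?_
        refine Eq.trans ?_ (hzero _).symm
        simp [Term.realize]
      exact (hx ⟨x, hx0⟩).2 (H ⟨x, hx0⟩)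

end Translation

section Final

variable {F : Type u} [Lt.Structure F] [Field F]

/-- The translation of a formula of the punctured language, restricted to nonzero tuples. -/
noncomputable def punctFormula {n m : ℕ} (φ : pmLang.{0}.Formula (Fin n ⊕ Fin m)) :
    Lt.Formula (Fin n ⊕ Fin m) :=
  transFormula φ ⊓ BoundedFormula.iInf fun i : Fin n =>
    ∼((Term.var (Sum.inl (Sum.inl i))).bdEqual
      (Term.func zeroSym (![] : Fin 0 → Lt.Term ((Fin n ⊕ Fin m) ⊕ Fin 0))))

theorem realizeIn_punctFormula (hF : LtCompat F) {n m : ℕ}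
    (φ : pmLang.{0}.Formula (Fin n ⊕ Fin m)) (b : Fin n → F) (c : Fin m → Punct F) :
    RealizeIn (circRel F) (punctFormula φ) (Sum.elim b fun k => (c k).1) ↔
      ∃ b' : Fin n → Punct F, (b = fun i => (b' i).1) ∧
        @Formula.Realize _ _ (punctStructure F) _ φ (Sum.elim b' c) := by
  have hz : ∀ w : (Fin n ⊕ Fin m) ⊕ Fin 0 → F,
      (Term.func zeroSym (![] : Fin 0 → Lt.Term ((Fin n ⊕ Fin m) ⊕ Fin 0))).realize w = 0 :=
    fun w => by
      rw [Term.realize, ← hF.1]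
      exact congrArg _ (Subsingleton.elim _ _)
  have hb : ∀ b' : Fin n → Punct F, (transFormula φ).Realize
      (Sum.elim (fun i => (b' i).1) fun k => (c k).1) default ↔
      @Formula.Realize _ _ (punctStructure F) _ φ (Sum.elim b' c) := fun b' => by
    refine Iff.trans (iff_of_eq ?_) (realize_transFormula hF (Sum.elim b' c) φ default)
    congr 1
    · funext i
      rcases i with i | i <;> rfl
    · exact Subsingleton.elim _ _
  have key : (punctFormula φ).Realize (Sum.elim b fun k => (c k).1) ↔
      (transFormula φ).Realize (Sum.elim b fun k => (c k).1) default ∧ ∀ i, b i ≠ 0 := by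
    rw [punctFormula, Formula.Realize, BoundedFormula.realize_inf, BoundedFormula.realize_iInf]
    refine and_congr Iff.rfl (forall_congr' fun i => ?_)
    rw [BoundedFormula.realize_not, BoundedFormula.realize_bdEqual, hz]
    rfl
  have hS : RealizeIn (circRel F) (punctFormula φ) (Sum.elim b fun k => (c k).1) ↔
      (punctFormula φ).Realize (Sum.elim b fun k => (c k).1) := by
    rw [RealizeIn, ← eq_ltOf F hF]
  rw [hS, key]
  constructor
  · rintro ⟨h1, h2⟩
    exact ⟨fun i => ⟨b i, h2 i⟩, rfl, (hb _).1 h1⟩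
  · rintro ⟨b', rfl, h⟩
    exact ⟨(hb b').2 h, fun i => (b' i).2⟩

end Final

end Auxiliary

/-- **Theorem 7.13**: For `p = 0` or `p` a prime, the punctured theory `ACFO_p^×` — the theory
of the circularly ordered multiplicative group `F^×` of a model `F` of `ACFO` of characteristic
`p`, with addition encoded by the relations `Σ_n` — is NATP.  (Here `ACFO` is the model
companion of the class of algebraically closed fields with a multiplication-invariant circular
order.) -/
theorem ACFO_punctured_is_NATP
    (p : ℕ) (hp : p = 0 ∨ p.Prime)
    (TA : Lt.Theory) (hTA : IsModelCompanionOfClass.{u} TA (fun F SF => IsACFOminus F SF))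
    (F : Type u) [SF : Lt.Structure F] [Field F]
    (hF : IsACFOminusWith F) (hFmodels : F ⊨ TA) (hchar : CharP F p) :
    letI := punctStructure F
    (pmLang.completeTheory (Punct F)).IsNATP := by
  let _ : pmLang.{0}.Structure (Punct F) := punctStructure F
  rintro ⟨M, n, m, φ, a, ha⟩
  have := hF.2.1
  have h : ∀ σ : pmLang.{0}.Sentence, M ⊨ σ → Punct F ⊨ σ := fun σ =>
    (realize_iff_of_model_completeTheory (Punct F) M σ).1
  choose a' h1 h2 using exists_finite_antichain_tree h ha
  refine no_finite_antichain_trees hTA hF.isCircField (by rwa [← eq_ltOf F hF.1])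
    (punctFormula φ) (fun d η k => (a' d η k).1) (fun d X hX hanti => ?_)
    fun d η ν hlη hlν hne hcomp => ?_
  · obtain ⟨b, hb⟩ := h1 d X hX hanti
    exact ⟨fun i => (b i).1, fun η hη =>
      (realizeIn_punctFormula hF.1 φ _ _).2 ⟨b, rfl, hb η hη⟩⟩
  · rintro ⟨b, hη, hν⟩
    obtain ⟨b1, rfl, hb1⟩ := (realizeIn_punctFormula hF.1 φ _ _).1 hη
    obtain ⟨b2, hb, hb2⟩ := (realizeIn_punctFormula hF.1 φ _ _).1 hν
    obtain rfl : b1 = b2 := funext fun i => Subtype.ext (congrFun hb i)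
    exact h2 d η ν hlη hlν hne hcomp ⟨b1, hb1, hb2⟩

end NATPPaper
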